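/- Let N(σ,T) denote the number of zeros ρ = β + iγ of the Riemann zeta function, counted with multiplicity, with |γ| ≤ T and β ≥ σ. Then uniformly for 1/2 ≤ σ ≤ 1 and T ≥ 2, N(σ,T) ≪ T^{1 − (σ − 1/2)/4} log T, with an absolute implied constant. -/

import Mathlib

open Filter MeasureTheory Real Complex Set

open Classical in
/-- Multiplicity of a point as a zero of the Riemann zeta function. -/
noncomputable def zetaZeroMult (ρ : ℂ) : ℕ :=
  if h : AnalyticAt ℂ riemannZeta ρ then (analyticOrderAt riemannZeta ρ).toNat else 0

/-- Nontrivial zeros with imaginary part in `(0, T]`. -/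
def zetaZerosUpTo (T : ℝ) : Set ℂ :=
  {ρ : ℂ | riemannZeta ρ = 0 ∧ 0 < ρ.re ∧ ρ.re < 1 ∧ 0 < ρ.im ∧ ρ.im ≤ T}

/-- `N(T)`: number of nontrivial zeros with `0 < γ ≤ T`, counted with multiplicity. -/
noncomputable def zetaN (T : ℝ) : ℕ := ∑ᶠ ρ ∈ zetaZerosUpTo T, zetaZeroMult ρ

/-- Explicit density `g` when `α = a log p / (2 π q)`. -/
noncomputable def gPAQ (p a q : ℕ) (t : ℝ) : ℝ :=
  -(((p : ℝ) ^ ((a : ℝ) / 2) * Real.cos (2 * π * q * t) - 1) * Real.log p) /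
    (π * ((p : ℝ) ^ (a : ℝ) - 2 * (p : ℝ) ^ ((a : ℝ) / 2) * Real.cos (2 * π * q * t) + 1))

/-- `α` has the special form `a log p / (2 π q)` with `p` prime, `a, q` coprime positive. -/
def IsSpecialForm (α : ℝ) (p a q : ℕ) : Prop :=
  p.Prime ∧ 0 < a ∧ 0 < q ∧ Nat.Coprime a q ∧ α = a * Real.log p / (2 * π * q)

/-- `g` is the density `g_α` associated with `α`. -/
def IsDensityOf (α : ℝ) (g : ℝ → ℝ) : Prop :=
  (∀ p a q : ℕ, IsSpecialForm α p a q → g = gPAQ p a q) ∧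
    ((¬ ∃ p a q : ℕ, IsSpecialForm α p a q) → g = 0)

/-- Sum of `h(αγ)` over zeros with `0 < γ ≤ T`, with multiplicity; `h` is `1`-periodic so this
equals the sum of `h({αγ})`. -/
noncomputable def zetaZeroSum (α : ℝ) (h : ℝ → ℂ) (T : ℝ) : ℂ :=
  ∑ᶠ ρ ∈ zetaZerosUpTo T, (zetaZeroMult ρ : ℂ) * h (α * ρ.im)

/-- `h` is (a lift of) an absolutely continuous function on `𝕋 = ℝ/ℤ`, with derivative `h'`. -/
def IsAbsContTorus (h h' : ℝ → ℂ) : Prop :=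
  Function.Periodic h 1 ∧ Function.Periodic h' 1 ∧
    (∀ a b : ℝ, IntervalIntegrable h' volume a b) ∧
    ∀ y : ℝ, h y = h 0 + ∫ t in (0:ℝ)..y, h' t

/-- `L¹` modulus of continuity on the torus. -/
noncomputable def modCont (f : ℝ → ℂ) (δ : ℝ) : ℝ :=
  sSup ((fun u => ∫ t in (0:ℝ)..1, ‖f (t + u) - f t‖) '' Set.Icc (-δ) δ)

/-- `M_α(y;T)`. -/
noncomputable def Mfun (α y T : ℝ) : ℝ :=
  (1 / T) * (∑ᶠ ρ ∈ {ρ : ℂ | riemannZeta ρ = 0 ∧ 0 < ρ.re ∧ ρ.re < 1 ∧ 0 < ρ.im ∧ ρ.im ≤ T ∧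
      Int.fract (α * ρ.im) < y}, (zetaZeroMult ρ : ℝ)) - y * (zetaN T) / T

/-- Normalized discrepancy `D*_α(T)`. -/
noncomputable def Dstar (α T : ℝ) : ℝ :=
  sSup ((fun y => (T / (zetaN T)) * |Mfun α y T|) '' Set.Icc (0:ℝ) 1)

/-- `N(σ, T)`: zeros with `|γ| ≤ T` and `β ≥ σ`, counted with multiplicity. -/
noncomputable def zetaNsigma (σ T : ℝ) : ℕ :=
  ∑ᶠ ρ ∈ {ρ : ℂ | riemannZeta ρ = 0 ∧ 0 < ρ.re ∧ ρ.re < 1 ∧ |ρ.im| ≤ T ∧ σ ≤ ρ.re},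
    zetaZeroMult ρ

section
namespace ZD
open scoped ArithmeticFunction.Moebius

/-- Möbius as a real number -/
noncomputable def mu (n : ℕ) : ℝ := (μ n : ℝ)

lemma abs_mu_le (n : ℕ) : |mu n| ≤ 1 := by
  have := ArithmeticFunction.abs_moebius_le_one (n := n)
  unfold mu
  exact_mod_cast this

lemma mu_one : mu 1 = 1 := by simp [mu]

lemma sum_divisors_mu (n : ℕ) (hn : n ≠ 0) : ∑ d ∈ n.divisors, mu d = if n = 1 then 1 else 0 := by
  have h : ((μ : ArithmeticFunction ℤ) * (ArithmeticFunction.zeta : ArithmeticFunction ℤ)) n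
      = (1 : ArithmeticFunction ℤ) n := by
    rw [ArithmeticFunction.moebius_mul_coe_zeta]
  rw [ArithmeticFunction.coe_mul_zeta_apply, ArithmeticFunction.one_apply] at h
  unfold mu
  have := congrArg (fun z : ℤ => (z : ℝ)) h
  push_cast at this
  exact this

/-- Dirichlet hyperbola rearrangement -/
lemma sum_mul_le (N : ℕ) (f : ℕ → ℕ → ℝ) :
    ∑ m ∈ Finset.Icc 1 N, ∑ k ∈ Finset.Icc 1 (N / m), f m k
      = ∑ n ∈ Finset.Icc 1 N, ∑ d ∈ n.divisors, f d (n / d) := by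
  rw [Finset.sum_sigma', Finset.sum_sigma']
  refine Finset.sum_bij' (fun p _ => ⟨p.1 * p.2, p.1⟩) (fun p _ => ⟨p.2, p.1 / p.2⟩) ?_ ?_ ?_ ?_ ?_
  · rintro ⟨m, k⟩ h
    simp only [Finset.mem_sigma, Finset.mem_Icc, Nat.mem_divisors] at h ⊢
    obtain ⟨⟨h1, h2⟩, h3, h4⟩ := h
    have : k * m ≤ N := (Nat.le_div_iff_mul_le (by omega)).1 h4
    refine ⟨⟨Nat.mul_pos h1 h3, by linarith [mul_comm k m]⟩, Dvd.intro _ rfl, by positivity⟩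
  · rintro ⟨n, d⟩ h
    simp only [Finset.mem_sigma, Finset.mem_Icc, Nat.mem_divisors] at h ⊢
    obtain ⟨⟨h1, h2⟩, h3, h4⟩ := h
    have hd := Nat.pos_of_dvd_of_pos h3 h1
    exact ⟨⟨hd, (Nat.le_of_dvd h1 h3).trans h2⟩, Nat.div_pos (Nat.le_of_dvd h1 h3) hd,
      Nat.div_le_div_right h2⟩
  · rintro ⟨m, k⟩ h
    simp only [Finset.mem_sigma, Finset.mem_Icc] at h
    simp only [Sigma.mk.injEq, heq_eq_eq, true_and]
    exact Nat.mul_div_cancel_left _ h.1.1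
  · rintro ⟨n, d⟩ h
    simp only [Finset.mem_sigma, Finset.mem_Icc, Nat.mem_divisors] at h
    simp only [Sigma.mk.injEq, heq_eq_eq, and_true]
    exact Nat.mul_div_cancel' h.2.1
  · rintro ⟨m, k⟩ h
    simp only [Finset.mem_sigma, Finset.mem_Icc] at h
    simp only
    rw [Nat.mul_div_cancel_left _ h.1.1]

lemma sum_mu_harm (N : ℕ) (hN : 1 ≤ N) (w : ℕ → ℝ) (hw : w 1 = 1)
    (hmul : ∀ d k, 0 < d → 0 < k → w (d * k) = w d * w k) :
    ∑ m ∈ Finset.Icc 1 N, mu m * w m * ∑ k ∈ Finset.Icc 1 (N / m), w k = 1 := by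
  have h1 : ∀ m ∈ Finset.Icc 1 N, mu m * w m * ∑ k ∈ Finset.Icc 1 (N / m), w k
      = ∑ k ∈ Finset.Icc 1 (N / m), mu m * (w m * w k) := by
    intro m _; rw [Finset.mul_sum]; exact Finset.sum_congr rfl fun k _ => by ring
  rw [Finset.sum_congr rfl h1, sum_mul_le N (fun m k => mu m * (w m * w k))]
  have h2 : ∀ n ∈ Finset.Icc 1 N, ∑ d ∈ n.divisors, mu d * (w d * w (n / d))
      = if n = 1 then 1 else 0 := by
    intro n hn
    rw [Finset.mem_Icc] at hn
    have : ∀ d ∈ n.divisors, mu d * (w d * w (n / d)) = mu d * w n := by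
      intro d hd
      have hd' := Nat.dvd_of_mem_divisors hd
      have h0 := Nat.pos_of_mem_divisors hd
      rw [← hmul d (n / d) h0 (Nat.div_pos (Nat.le_of_dvd (by omega) hd') h0),
        Nat.mul_div_cancel' hd']
    rw [Finset.sum_congr rfl this, ← Finset.sum_mul, sum_divisors_mu n (by omega)]
    split_ifs with h
    · subst h; simp [hw]
    · simp
  rw [Finset.sum_congr rfl h2]
  simp [hN]

/-- `|∑_{m ≤ N} μ(m)/m| ≤ 2`. -/
lemma abs_sum_mu_div_le (N : ℕ) : |∑ m ∈ Finset.Icc 1 N, mu m / m| ≤ 2 := by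
  rcases Nat.eq_zero_or_pos N with rfl | hN
  · simp
  have h := sum_mu_harm N hN (fun _ => 1) rfl (by simp)
  simp only [mul_one, Finset.sum_const, Nat.card_Icc, add_tsub_cancel_right, nsmul_eq_mul] at h
  have hN' : (0:ℝ) < N := by exact_mod_cast hN
  have key : |(N:ℝ) * ∑ m ∈ Finset.Icc 1 N, mu m / m - 1| ≤ N := by
    rw [← h, Finset.mul_sum, ← Finset.sum_sub_distrib]
    refine (Finset.abs_sum_le_sum_abs _ _).trans ?_
    calc _ ≤ ∑ m ∈ Finset.Icc 1 N, (1:ℝ) := by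
          refine Finset.sum_le_sum fun m hm => ?_
          rw [Finset.mem_Icc] at hm
          have hm' : (0:ℝ) < m := by exact_mod_cast hm.1
          have e : (N:ℝ) * (mu m / m) - mu m * ((N / m : ℕ) : ℝ)
              = mu m * ((N:ℝ) / m - ((N / m : ℕ) : ℝ)) := by ring
          rw [e, abs_mul]
          have h1 : ((N / m : ℕ) : ℝ) ≤ (N:ℝ) / m := Nat.cast_div_le
          have h2 : (N:ℝ) / m < ((N / m : ℕ) : ℝ) + 1 := by
            rw [div_lt_iff₀ hm']
            have := Nat.lt_div_mul_add hm.1 (a := N)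
            have h' : (N:ℝ) < ((N / m : ℕ) : ℝ) * m + m := by exact_mod_cast this
            linarith
          have h3 : |(N:ℝ) / m - ((N / m : ℕ) : ℝ)| ≤ 1 := by rw [abs_le]; constructor <;> linarith
          calc _ ≤ 1 * 1 := mul_le_mul (abs_mu_le m) h3 (abs_nonneg _) zero_le_one
            _ = 1 := by ring
      _ = N := by simp
  have h1 : (1:ℝ) ≤ N := by exact_mod_cast hN
  rw [abs_le] at key ⊢
  constructor <;> nlinarith

lemma harm_log (u : ℝ) (hu : 1 ≤ u) :
    |∑ k ∈ Finset.Icc 1 ⌊u⌋₊, (1:ℝ) / k - Real.eulerMascheroniConstant - Real.log u| ≤ 2 / u := by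
  set n := ⌊u⌋₊ with hn
  have hn1 : 1 ≤ n := Nat.one_le_floor_iff u |>.2 hu
  have h1 : (n:ℝ) ≤ u := Nat.floor_le (by linarith)
  have h2 : u < n + 1 := Nat.lt_floor_add_one u
  have hn0 : (1:ℝ) ≤ n := by exact_mod_cast hn1
  have hH : ∑ k ∈ Finset.Icc 1 n, (1:ℝ) / k = (harmonic n : ℝ) := by
    rw [harmonic_eq_sum_Icc]; push_cast; simp
  rw [hH]
  have a1 := Real.eulerMascheroniSeq_lt_eulerMascheroniConstant n
  have a2 := Real.eulerMascheroniConstant_lt_eulerMascheroniSeq' n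
  unfold Real.eulerMascheroniSeq at a1
  unfold Real.eulerMascheroniSeq' at a2
  rw [if_neg (by omega)] at a2
  have l1 : Real.log n ≤ Real.log u := Real.log_le_log (by linarith) h1
  have l2 : Real.log u ≤ Real.log (n+1) := Real.log_le_log (by linarith) h2.le
  have l3 : Real.log (n+1) - Real.log n ≤ 1 / n := by
    rw [← Real.log_div (by linarith) (by linarith)]
    have := Real.log_le_sub_one_of_pos (x := ((n:ℝ)+1)/n) (by positivity)
    refine this.trans (le_of_eq ?_)
    field_simp; ring
  have l4 : 1 / (n:ℝ) ≤ 2 / u := by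
    rw [div_le_div_iff₀ (by linarith) (by linarith)]; linarith
  rw [abs_le]; constructor <;> linarith

/-- `|∑_{m ≤ N} μ(m)/m log⁺(y/m)| ≤ 7`. -/
lemma L_one_bound (N : ℕ) (y : ℝ) (hy0 : 0 ≤ y) (hy : y ≤ N) :
    |∑ m ∈ Finset.Icc 1 N, mu m / m * Real.posLog (y / m)| ≤ 7 := by
  have hred : ∑ m ∈ Finset.Icc 1 N, mu m / m * Real.posLog (y / m)
      = ∑ m ∈ Finset.Icc 1 ⌊y⌋₊, mu m / m * Real.log (y / m) := by
    have hsub : Finset.Icc 1 ⌊y⌋₊ ⊆ Finset.Icc 1 N :=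
      Finset.Icc_subset_Icc_right (Nat.floor_le_of_le hy)
    rw [← Finset.sum_subset hsub]
    · refine Finset.sum_congr rfl fun m hm => ?_
      rw [Finset.mem_Icc] at hm
      have hm0 : (0:ℝ) < m := by exact_mod_cast hm.1
      have : (m:ℝ) ≤ y := (Nat.le_floor_iff hy0).1 hm.2
      rw [Real.posLog_eq_log]
      rw [abs_of_nonneg (by positivity), le_div_iff₀ hm0]; linarith
    · intro m hm hm'
      rw [Finset.mem_Icc] at hm hm'
      have hm0 : (0:ℝ) < m := by exact_mod_cast hm.1
      have : y < m := (Nat.floor_lt hy0).1 (by omega)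
      rw [(Real.posLog_eq_zero_iff _).2, mul_zero]
      rw [abs_of_nonneg (by positivity), div_le_one hm0]; linarith
  rw [hred]
  rcases lt_or_ge y 1 with h | h1
  · rw [Nat.floor_eq_zero.2 h]; simp
  set n := ⌊y⌋₊ with hn
  have hn1 : 1 ≤ n := Nat.one_le_floor_iff y |>.2 h1
  have hs := sum_mu_harm n hn1 (fun k => 1 / (k:ℝ)) (by simp) (by intro d k _ _; push_cast; rw [one_div_mul_one_div])
  set γ := Real.eulerMascheroniConstant
  have hγ : |γ| ≤ 1 := by
    rw [abs_le]; constructor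
    · linarith [Real.one_half_lt_eulerMascheroniConstant]
    · linarith [Real.eulerMascheroniConstant_lt_two_thirds]
  have hdec : ∑ m ∈ Finset.Icc 1 n, mu m / m * Real.log (y / m)
      = 1 - γ * ∑ m ∈ Finset.Icc 1 n, mu m / m
        - ∑ m ∈ Finset.Icc 1 n, mu m / m *
          (∑ k ∈ Finset.Icc 1 ⌊y / m⌋₊, (1:ℝ) / k - γ - Real.log (y / m)) := by
    refine Eq.trans ?_ (congrArg (fun z => z - γ * ∑ m ∈ Finset.Icc 1 n, mu m / m
        - ∑ m ∈ Finset.Icc 1 n, mu m / m *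
          (∑ k ∈ Finset.Icc 1 ⌊y / m⌋₊, (1:ℝ) / k - γ - Real.log (y / m))) hs)
    rw [Finset.mul_sum, ← Finset.sum_sub_distrib, ← Finset.sum_sub_distrib]
    refine Finset.sum_congr rfl fun m hm => ?_
    have : ⌊y / m⌋₊ = n / m := by rw [hn, Nat.floor_div_natCast]
    rw [this]; ring
  rw [hdec]
  have e1 : |γ * ∑ m ∈ Finset.Icc 1 n, mu m / m| ≤ 2 := by
    rw [abs_mul]
    calc _ ≤ 1 * 2 := mul_le_mul hγ (abs_sum_mu_div_le n) (abs_nonneg _) zero_le_one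
      _ = 2 := by norm_num
  have e2 : |∑ m ∈ Finset.Icc 1 n, mu m / m *
          (∑ k ∈ Finset.Icc 1 ⌊y / m⌋₊, (1:ℝ) / k - γ - Real.log (y / m))| ≤ 2 := by
    refine (Finset.abs_sum_le_sum_abs _ _).trans ?_
    calc _ ≤ ∑ m ∈ Finset.Icc 1 n, 2 / y := by
          refine Finset.sum_le_sum fun m hm => ?_
          rw [Finset.mem_Icc] at hm
          have hm0 : (0:ℝ) < m := by exact_mod_cast hm.1
          have hmy : (m:ℝ) ≤ y := (Nat.le_floor_iff hy0).1 hm.2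
          have := harm_log (y / m) ((one_le_div hm0).2 hmy)
          rw [abs_mul, abs_div, abs_of_pos hm0]
          calc |mu m| / m * _ ≤ 1 / m * (2 / (y / m)) := by
                gcongr; exact abs_mu_le m
            _ = 2 / y := by field_simp
      _ = n * (2 / y) := by simp
      _ ≤ y * (2 / y) := by
          gcongr; exact Nat.floor_le hy0
      _ = 2 := by field_simp
  rw [abs_le] at *
  constructor <;> linarith [e1.1, e1.2, e2.1, e2.2]

end ZD
end

section
namespace ZD
open scoped ArithmeticFunction.Moebius

lemma kappa_rep (κ c l : ℝ) (hl : 0 ≤ l) (hlc : l ≤ c) :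
    ∫ v in (0:ℝ)..c, max 0 (v - l) * (Real.exp (-κ * v) * (κ ^ 2 * (c - v) + 2 * κ))
      = Real.exp (-κ * l) * (c - l) - Real.exp (-κ * c) * (c - l) := by
  have hi : ∀ a b : ℝ, IntervalIntegrable (fun v => max 0 (v - l) * (Real.exp (-κ * v) * (κ ^ 2 * (c - v) + 2 * κ))) volume a b := by
    intro a b
    apply Continuous.intervalIntegrable
    fun_prop
  rw [← intervalIntegral.integral_add_adjacent_intervals (hi 0 l) (hi l c)]
  have h1 : ∫ v in (0:ℝ)..l, max 0 (v - l) * (Real.exp (-κ * v) * (κ ^ 2 * (c - v) + 2 * κ)) = 0 := by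
    rw [intervalIntegral.integral_congr (g := fun _ => 0)]
    · simp
    · intro v hv
      rw [uIcc_of_le hl] at hv
      simp only
      rw [max_eq_left (by linarith [hv.2]), zero_mul]
  have h2 : ∫ v in l..c, max 0 (v - l) * (Real.exp (-κ * v) * (κ ^ 2 * (c - v) + 2 * κ))
      = ∫ v in l..c, (v - l) * (Real.exp (-κ * v) * (κ ^ 2 * (c - v) + 2 * κ)) := by
    apply intervalIntegral.integral_congr
    intro v hv
    rw [uIcc_of_le hlc] at hv
    simp only
    rw [max_eq_right (by linarith [hv.1])]
  rw [h1, h2, zero_add]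
  have hd : ∀ v ∈ uIcc l c, HasDerivAt (fun v => (v - l) * (- Real.exp (-κ * v) * (κ * (c - v) + 1)) - Real.exp (-κ * v) * (c - v))
      ((v - l) * (Real.exp (-κ * v) * (κ ^ 2 * (c - v) + 2 * κ))) v := by
    intro v _
    have he : HasDerivAt (fun v => Real.exp (-κ * v)) (Real.exp (-κ * v) * (-κ)) v := by
      have := ((hasDerivAt_id v).const_mul (-κ)).exp
      simpa using this
    have hc : HasDerivAt (fun v => c - v) (-1) v := by
      simpa using (hasDerivAt_id v).const_sub c
    have hl : HasDerivAt (fun v => v - l) 1 v := by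
      simpa using (hasDerivAt_id v).sub_const l
    have := (hl.mul (he.neg.mul ((hc.const_mul κ).add_const 1))).sub (he.mul hc)
    refine HasDerivAt.congr_deriv this ?_
    simp only [Pi.neg_apply, Pi.mul_apply]
    ring
  rw [intervalIntegral.integral_eq_sub_of_hasDerivAt hd]
  · simp; ring
  · apply Continuous.intervalIntegrable; fun_prop

lemma kappa_tot (κ c : ℝ) :
    ∫ v in (0:ℝ)..c, (Real.exp (-κ * v) * (κ ^ 2 * (c - v) + 2 * κ))
      = κ * c + 1 - Real.exp (-κ * c)  := by
  have hd : ∀ v ∈ uIcc 0 c, HasDerivAt (fun v => (- Real.exp (-κ * v) * (κ * (c - v) + 1)))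
      ((Real.exp (-κ * v) * (κ ^ 2 * (c - v) + 2 * κ))) v := by
    intro v _
    have he : HasDerivAt (fun v => Real.exp (-κ * v)) (Real.exp (-κ * v) * (-κ)) v := by
      have := ((hasDerivAt_id v).const_mul (-κ)).exp
      simpa using this
    have hc : HasDerivAt (fun v => c - v) (-1) v := by
      simpa using (hasDerivAt_id v).const_sub c
    have := ((he.neg.mul ((hc.const_mul κ).add_const 1)))
    refine HasDerivAt.congr_deriv this ?_
    simp only [Pi.neg_apply, Pi.mul_apply]
    ring
  rw [intervalIntegral.integral_eq_sub_of_hasDerivAt hd]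
  · simp; ring
  · apply Continuous.intervalIntegrable; fun_prop

/-- weight `μ(m) m^{-1-κ}` -/
noncomputable def wt (κ : ℝ) (m : ℕ) : ℝ := mu m * (m:ℝ) ^ (-(1 + κ))

lemma posLog_exp_div (v : ℝ) (m : ℕ) (hm : 1 ≤ m) :
    Real.posLog (Real.exp v / m) = max 0 (v - Real.log m) := by
  have : (0:ℝ) < m := by exact_mod_cast hm
  rw [Real.posLog, Real.log_div (Real.exp_pos v).ne' this.ne', Real.log_exp]

lemma L_kappa_bound (N : ℕ) (κ y : ℝ) (hκ : 0 ≤ κ) (hy1 : 1 ≤ y) (hy : y ≤ N)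
    (hκy : κ * Real.log y ≤ 1) :
    |∑ m ∈ Finset.Icc 1 N, wt κ m * Real.posLog (y / m)| ≤ 14 := by
  set c := Real.log y with hc
  have hc0 : 0 ≤ c := Real.log_nonneg hy1
  have hyc : y = Real.exp c := by rw [hc, Real.exp_log (by linarith)]
  set Φ : ℝ → ℝ := fun v => Real.exp (-κ * v) * (κ ^ 2 * (c - v) + 2 * κ) with hΦ
  have hΦc : Continuous Φ := by rw [hΦ]; fun_prop
  set Lf : ℝ → ℝ := fun v => ∑ m ∈ Finset.Icc 1 N, mu m / m * max 0 (v - Real.log m) with hLf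
  have hLfc : Continuous Lf := by rw [hLf]; fun_prop
  have hLb : ∀ v, v ≤ c → |Lf v| ≤ 7 := by
    intro v hv
    have := L_one_bound N (Real.exp v) (Real.exp_pos v).le
      (le_trans (by rw [hyc]; exact Real.exp_le_exp.2 hv) hy)
    refine le_trans (le_of_eq ?_) this
    congr 1
    refine Finset.sum_congr rfl fun m hm => ?_
    rw [posLog_exp_div v m (Finset.mem_Icc.1 hm).1]
  have key : ∑ m ∈ Finset.Icc 1 N, wt κ m * Real.posLog (y / m)
      = Real.exp (-κ * c) * Lf c + ∫ v in (0:ℝ)..c, Lf v * Φ v := by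
    have h1 : ∫ v in (0:ℝ)..c, Lf v * Φ v = ∑ m ∈ Finset.Icc 1 N, mu m / m * ∫ v in (0:ℝ)..c, max 0 (v - Real.log m) * Φ v := by
      simp_rw [← intervalIntegral.integral_const_mul]
      rw [← intervalIntegral.integral_finsetSum]
      · apply intervalIntegral.integral_congr
        intro v _
        simp only [hLf]
        rw [Finset.sum_mul]
        exact Finset.sum_congr rfl fun m _ => by ring
      · intro m _
        apply Continuous.intervalIntegrable; fun_prop
    rw [h1, hLf]
    simp only
    rw [Finset.mul_sum, ← Finset.sum_add_distrib]
    refine Finset.sum_congr rfl fun m hm => ?_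
    have hm1 := (Finset.mem_Icc.1 hm).1
    have hm0 : (0:ℝ) < m := by exact_mod_cast hm1
    have hl0 : 0 ≤ Real.log m := Real.log_nonneg (by exact_mod_cast hm1)
    rw [hyc, posLog_exp_div c m hm1]
    rcases le_total (Real.log m) c with h | h
    · rw [kappa_rep κ c _ hl0 h, max_eq_right (by linarith), wt, neg_add, Real.rpow_add hm0,
        Real.rpow_neg_one, Real.rpow_def_of_pos hm0]
      rw [show Real.log m * -κ = -κ * Real.log m by ring]
      ring
    · rw [max_eq_left (by linarith)]
      have : ∫ v in (0:ℝ)..c, max 0 (v - Real.log m) * Φ v = 0 := by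
        rw [intervalIntegral.integral_congr (g := fun _ => 0)]
        · simp
        · intro v hv
          rw [uIcc_of_le hc0] at hv
          simp only
          rw [max_eq_left (by linarith [hv.2]), zero_mul]
      rw [this]; ring
  rw [key]
  have hI : |∫ v in (0:ℝ)..c, Lf v * Φ v| ≤ 7 * (κ * c + 1 - Real.exp (-κ * c)) := by
    rw [← kappa_tot, ← intervalIntegral.integral_const_mul]
    rw [← Real.norm_eq_abs]
    apply intervalIntegral.norm_integral_le_of_norm_le hc0
    · refine Eventually.of_forall fun v hv => ?_
      have hp : 0 ≤ Φ v := by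
        have : 0 ≤ c - v := by linarith [hv.2]
        simp only [hΦ]; positivity
      rw [norm_mul, Real.norm_eq_abs, Real.norm_eq_abs, abs_of_nonneg hp]
      exact mul_le_mul_of_nonneg_right (hLb v hv.2) hp
    · apply Continuous.intervalIntegrable; fun_prop
  have hE : |Real.exp (-κ * c) * Lf c| ≤ 7 * Real.exp (-κ * c) := by
    rw [abs_mul, abs_of_pos (Real.exp_pos _), mul_comm]
    exact mul_le_mul_of_nonneg_right (hLb c le_rfl) (Real.exp_pos _).le
  refine (abs_add_le _ _).trans ?_
  linarith

/-- sum over `m` coprime to the primes in `S` -/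
noncomputable def LS (S : Finset ℕ) (κ : ℝ) (N : ℕ) (y : ℝ) : ℝ :=
  ∑ m ∈ (Finset.Icc 1 N).filter (fun m => ∀ p ∈ S, ¬ p ∣ m), wt κ m * Real.posLog (y / m)

lemma mu_prime_mul (p m : ℕ) (hp : p.Prime) : mu (p * m) = if p ∣ m then 0 else - mu m := by
  unfold mu
  split_ifs with h
  · rw [ArithmeticFunction.moebius_eq_zero_of_not_squarefree]
    · simp
    · intro hs
      obtain ⟨k, rfl⟩ := h
      have := hs p ⟨k, by ring⟩
      exact hp.not_isUnit this
  · rw [ArithmeticFunction.isMultiplicative_moebius.map_mul_of_coprime ((hp.coprime_iff_not_dvd).2 h),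
      ArithmeticFunction.moebius_apply_prime hp]
    simp

lemma posLog_div_zero (y : ℝ) (hy : 0 ≤ y) (m : ℕ) (h : y ≤ m) : Real.posLog (y / m) = 0 := by
  rw [Real.posLog_eq_zero_iff, abs_of_nonneg (by positivity)]
  exact div_le_one_of_le₀ h (by positivity)

lemma LS_rec (S : Finset ℕ) (hS : ∀ p ∈ S, p.Prime) (p : ℕ) (hp : p.Prime) (hpS : p ∉ S)
    (κ : ℝ) (N : ℕ) (y : ℝ) (hy0 : 0 ≤ y) (hy : y ≤ N) :
    LS (insert p S) κ N y = LS S κ N y + (p:ℝ) ^ (-(1 + κ)) * LS (insert p S) κ N (y / p) := by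
  have hp0 : (0:ℝ) < p := by exact_mod_cast hp.pos
  have h1 : LS S κ N y = LS (insert p S) κ N y + 
      ∑ m ∈ (Finset.Icc 1 N).filter (fun m => (∀ p ∈ S, ¬ p ∣ m) ∧ p ∣ m), wt κ m * Real.posLog (y / m) := by
    unfold LS
    rw [← Finset.sum_filter_add_sum_filter_not ((Finset.Icc 1 N).filter (fun m => ∀ p ∈ S, ¬ p ∣ m)) (fun m => ¬ p ∣ m)]
    rw [Finset.filter_filter, Finset.filter_filter]
    simp only [not_not]
    congr 2
    ext m; simp only [Finset.mem_filter, Finset.forall_mem_insert]; tauto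
  have h2 : ∑ m ∈ (Finset.Icc 1 N).filter (fun m => (∀ p ∈ S, ¬ p ∣ m) ∧ p ∣ m), wt κ m * Real.posLog (y / m)
      = - ((p:ℝ) ^ (-(1 + κ)) * LS (insert p S) κ N (y / p)) := by
    unfold LS
    have h3 : ∑ m ∈ (Finset.Icc 1 N).filter (fun m => (∀ p ∈ S, ¬ p ∣ m) ∧ p ∣ m), wt κ m * Real.posLog (y / m)
      = ∑ k ∈ (Finset.Icc 1 (N/p)).filter (fun m => (∀ p ∈ S, ¬ p ∣ m)), wt κ (p * k) * Real.posLog (y / (p * k : ℕ)) := by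
      symm
      refine Finset.sum_bij' (fun k _ => p * k) (fun m _ => m / p) ?_ ?_ ?_ ?_ ?_
      · intro k hk
        simp only [Finset.mem_filter, Finset.mem_Icc] at hk ⊢
        obtain ⟨⟨a, b⟩, c⟩ := hk
        refine ⟨⟨Nat.mul_pos hp.pos a, ?_⟩, ?_, Dvd.intro _ rfl⟩
        · rw [mul_comm]; exact (Nat.le_div_iff_mul_le hp.pos).1 b
        · intro q hq hqk
          rcases (Nat.Prime.dvd_mul (hS q hq)).1 hqk with h | h
          · rw [Nat.prime_dvd_prime_iff_eq (hS q hq) hp] at h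
            exact hpS (h ▸ hq)
          · exact c q hq h
      · intro m hm
        simp only [Finset.mem_filter, Finset.mem_Icc] at hm ⊢
        obtain ⟨⟨a, b⟩, c, d⟩ := hm
        refine ⟨⟨Nat.div_pos (Nat.le_of_dvd a d) hp.pos, Nat.div_le_div_right b⟩, ?_⟩
        intro q hq hqk
        exact c q hq (hqk.trans (Nat.div_dvd_of_dvd d))
      · intro k _; exact Nat.mul_div_cancel_left _ hp.pos
      · intro m hm
        simp only [Finset.mem_filter] at hm
        exact Nat.mul_div_cancel' hm.2.2
      · intro k _; rfl
    rw [h3, Finset.mul_sum, ← Finset.sum_neg_distrib]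
    have h4 : (Finset.Icc 1 (N/p)).filter (fun m => (∀ q ∈ insert p S, ¬ q ∣ m)) ⊆ (Finset.Icc 1 N).filter (fun m => (∀ q ∈ insert p S, ¬ q ∣ m)) :=
      Finset.filter_subset_filter _ (Finset.Icc_subset_Icc_right (Nat.div_le_self _ _))
    have h4' : (Finset.Icc 1 (N/p)).filter (fun m => (∀ q ∈ insert p S, ¬ q ∣ m)) ⊆ (Finset.Icc 1 (N/p)).filter (fun m => (∀ q ∈ S, ¬ q ∣ m)) := by
      intro m hm
      simp only [Finset.mem_filter, Finset.forall_mem_insert] at hm ⊢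
      exact ⟨hm.1, hm.2.2⟩
    rw [← Finset.sum_subset h4, ← Finset.sum_subset h4']
    · refine Finset.sum_congr rfl fun k hk => ?_
      simp only [Finset.mem_filter, Finset.forall_mem_insert] at hk
      rw [wt, wt, mu_prime_mul p k hp, if_neg hk.2.1]
      push_cast
      rw [Real.mul_rpow hp0.le (by positivity), div_div]
      ring
    · intro k hk hk'
      have : p ∣ k := by
        by_contra h
        apply hk'
        simp only [Finset.mem_filter, Finset.forall_mem_insert] at hk ⊢
        exact ⟨hk.1, h, hk.2⟩
      rw [wt, mu_prime_mul p k hp, if_pos this]; ring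
    · intro k hk hk'
      have : N / p < k := by
        by_contra h
        apply hk'
        simp only [Finset.mem_filter, Finset.mem_Icc] at hk ⊢
        exact ⟨⟨hk.1.1, by omega⟩, hk.2⟩
      rw [posLog_div_zero (y / p) (by positivity) k]
      · ring
      · rw [div_le_iff₀ hp0]
        have := (Nat.div_lt_iff_lt_mul hp.pos).1 this
        have : (N:ℝ) ≤ k * p := by exact_mod_cast this.le
        linarith
  rw [h1, h2]; ring

lemma LS_bound (S : Finset ℕ) (hS : ∀ p ∈ S, p.Prime) (κ : ℝ) (hκ : 0 ≤ κ) (N : ℕ) (Y : ℝ) 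
    (hκY : κ * Real.log Y ≤ 1) : ∀ y : ℝ, 0 ≤ y → y ≤ N → y ≤ Y →
    |LS S κ N y| ≤ 14 * ∏ p ∈ S, ((p:ℝ) / (p - 1)) := by
  induction S using Finset.induction_on with
  | empty =>
    intro y hy0 hy hyY
    rcases lt_or_ge y 1 with h | h
    · have : LS ∅ κ N y = 0 := by
        unfold LS
        refine Finset.sum_eq_zero fun m hm => ?_
        rw [posLog_div_zero y hy0 m, mul_zero]
        have := (Finset.mem_Icc.1 (Finset.mem_filter.1 hm).1).1
        have : (1:ℝ) ≤ m := by exact_mod_cast this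
        linarith
      rw [this]; simp
    · have := L_kappa_bound N κ y hκ h hy (le_trans (by gcongr) hκY)
      simpa [LS] using this
  | insert p S hpS ih =>
    have hp : p.Prime := hS p (by simp)
    have hS' : ∀ q ∈ S, q.Prime := fun q hq => hS q (by simp [hq])
    have ih' := ih hS'
    have hp2 : (2:ℝ) ≤ p := by exact_mod_cast hp.two_le
    rw [Finset.prod_insert hpS]
    set B := ∏ p ∈ S, ((p:ℝ) / (p - 1)) with hB
    have hB0 : 0 ≤ B := by
      refine Finset.prod_nonneg fun q hq => ?_
      have : (2:ℝ) ≤ q := by exact_mod_cast (hS' q hq).two_le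
      exact div_nonneg (by linarith) (by linarith)
    have main : ∀ n : ℕ, ∀ y : ℝ, 0 ≤ y → y ≤ N → y ≤ Y → y < 2 ^ n →
        |LS (insert p S) κ N y| ≤ 14 * ((p:ℝ) / (p - 1) * B) := by
      intro n
      induction n with
      | zero =>
        intro y hy0 hy hyY h
        have : LS (insert p S) κ N y = 0 := by
          unfold LS
          refine Finset.sum_eq_zero fun m hm => ?_
          rw [posLog_div_zero y hy0 m, mul_zero]
          have := (Finset.mem_Icc.1 (Finset.mem_filter.1 hm).1).1
          have : (1:ℝ) ≤ m := by exact_mod_cast this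
          simp at h
          linarith
        rw [this, abs_zero]
        have : 0 ≤ (p:ℝ) / (p - 1) := div_nonneg (by linarith) (by linarith)
        positivity
      | succ n ihn =>
        intro y hy0 hy hyY h
        rw [LS_rec S hS' p hp hpS κ N y hy0 hy]
        have hle : y / p ≤ y := div_le_self hy0 (by linarith)
        have h1 := ihn (y / p) (by positivity) (hle.trans hy) (hle.trans hyY) (by
          rw [div_lt_iff₀ (by linarith)]
          have : (0:ℝ) < 2 ^ n := by positivity
          rw [pow_succ] at h
          nlinarith)
        have h2 := ih' y hy0 hy hyY
        have h3 : (p:ℝ) ^ (-(1 + κ)) ≤ 1 / p := by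
          rw [one_div, ← Real.rpow_neg_one]
          exact Real.rpow_le_rpow_of_exponent_le (by linarith) (by linarith)
        refine (abs_add_le _ _).trans ?_
        rw [abs_mul, abs_of_nonneg (Real.rpow_nonneg (by linarith) _)]
        have h4 : (p:ℝ) ^ (-(1 + κ)) * |LS (insert p S) κ N (y / p)| ≤ 1 / p * (14 * ((p:ℝ) / (p - 1) * B)) := by
          gcongr
        have h5 : 1 / (p:ℝ) * (14 * ((p:ℝ) / (p - 1) * B)) + 14 * B = 14 * ((p:ℝ) / (p - 1) * B) := by
          have : (p:ℝ) - 1 ≠ 0 := by linarith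
          field_simp; ring
        linarith
    intro y hy0 hy hyY
    obtain ⟨n, hn⟩ := pow_unbounded_of_one_lt y (one_lt_two)
    exact main n y hy0 hy hyY hn

end ZD
end

section
namespace ZD
open scoped ArithmeticFunction.Moebius

noncomputable def xi (L : ℝ) : ℝ := Real.exp (L / 4)
noncomputable def XX (L : ℝ) : ℝ := Real.exp (L / 8)
noncomputable def NN (L : ℝ) : ℕ := ⌈xi L⌉₊
/-- mollifier coefficients -/
noncomputable def lam (L : ℝ) (h : ℕ) : ℝ :=
  mu h * ((Real.posLog (xi L / h) - Real.posLog (XX L / h)) / (L / 8))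

lemma sum_sqfree_le (N : ℕ) (f : ℕ → ℝ) (hf : ∀ p, 0 ≤ f p) :
    ∑ d ∈ (Finset.Icc 1 N).filter Squarefree, ∏ p ∈ d.primeFactors, f p
      ≤ ∏ p ∈ Finset.Icc 1 N, (1 + f p) := by
  rw [Finset.prod_one_add]
  have hinj : Set.InjOn Nat.primeFactors ((Finset.Icc 1 N).filter Squarefree : Finset ℕ) := by
    intro a ha b hb hab
    simp only [Finset.coe_filter, mem_setOf_eq] at ha hb
    rw [← Nat.prod_primeFactors_of_squarefree ha.2, ← Nat.prod_primeFactors_of_squarefree hb.2, hab]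
  rw [← Finset.sum_image (f := fun t => ∏ p ∈ t, f p) hinj]
  refine Finset.sum_le_sum_of_subset_of_nonneg ?_ ?_
  · intro t ht
    simp only [Finset.mem_image, Finset.mem_filter, Finset.mem_Icc] at ht
    obtain ⟨d, ⟨⟨h1, h2⟩, h3⟩, rfl⟩ := ht
    rw [Finset.mem_powerset]
    intro p hp
    rw [Finset.mem_Icc]
    exact ⟨Nat.pos_of_mem_primeFactors hp, (Nat.le_of_mem_primeFactors hp).trans h2⟩
  · intro t _ _
    exact Finset.prod_nonneg fun p _ => hf p

lemma sum_inv_sq_Icc (N : ℕ) : ∑ p ∈ Finset.Icc 1 N, ((p:ℝ) ^ 2)⁻¹ ≤ 2 := by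
  have := sum_Ioo_inv_sq_le (α := ℝ) 0 (N+1)
  have e : Finset.Ioo 0 (N+1) = Finset.Icc 1 N := by ext; simp; omega
  rw [e] at this
  simpa using this

noncomputable def ww (q : ℕ) : ℝ := ∏ p ∈ q.primeFactors, ((p:ℝ) * (p + 1) / (p - 1) ^ 2)

lemma ww_sum (N : ℕ) : ∑ q ∈ (Finset.Icc 1 N).filter Squarefree, ww q / q
    ≤ Real.exp 20 * (1 + Real.log N) := by
  set e : ArithmeticFunction ℝ := ArithmeticFunction.prodPrimeFactors (fun p => 10 / (p:ℝ)) with he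
  have hem : e.IsMultiplicative := ArithmeticFunction.IsMultiplicative.prodPrimeFactors _
  have heap : ∀ n : ℕ, n ≠ 0 → e n = ∏ p ∈ n.primeFactors, (10 / (p:ℝ)) := fun n hn =>
    ArithmeticFunction.prodPrimeFactors_apply hn
  have he0 : ∀ n : ℕ, n ≠ 0 → 0 ≤ e n := fun n hn => by
    rw [heap n hn]; exact Finset.prod_nonneg fun p _ => by positivity
  have h1 : ∀ q ∈ (Finset.Icc 1 N).filter Squarefree, ww q / q ≤
      ∑ d ∈ q.divisors, (if Squarefree d then e d / d * (1 / ((q / d : ℕ) : ℝ)) else 0) := by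
    intro q hq
    rw [Finset.mem_filter, Finset.mem_Icc] at hq
    have hq0 : (0:ℝ) < q := by exact_mod_cast hq.1.1
    have a1 : ww q ≤ ∏ p ∈ q.primeFactors, (1 + e p) := by
      refine Finset.prod_le_prod ?_ ?_
      · intro p hp; positivity
      · intro p hp
        have hpp := Nat.prime_of_mem_primeFactors hp
        have hp2 : (2:ℝ) ≤ p := by exact_mod_cast hpp.two_le
        rw [heap p hpp.ne_zero, hpp.primeFactors, Finset.prod_singleton]
        have h0 : (0:ℝ) < p := by linarith
        rw [div_le_iff₀ (by nlinarith), ← sub_nonneg]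
        have : (1 + 10 / (p:ℝ)) * (p - 1) ^ 2 - p * (p + 1) = (p - 2) * (7 * p - 5) / p := by
          field_simp; ring
        rw [this]
        exact div_nonneg (mul_nonneg (by linarith) (by linarith)) h0.le
    rw [hem.prodPrimeFactors_one_add_of_squarefree hq.2] at a1
    calc ww q / q ≤ (∑ d ∈ q.divisors, e d) / q := by gcongr
      _ = ∑ d ∈ q.divisors, (if Squarefree d then e d / d * (1 / ((q / d : ℕ) : ℝ)) else 0) := by
        rw [Finset.sum_div]
        refine Finset.sum_congr rfl fun d hd => ?_
        have hdq := Nat.dvd_of_mem_divisors hd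
        rw [if_pos (hq.2.squarefree_of_dvd hdq)]
        have hd0 : (d:ℝ) ≠ 0 := by
          have := Nat.pos_of_mem_divisors hd
          exact_mod_cast this.ne'
        rw [Nat.cast_div hdq hd0]
        field_simp
  have h2 : ∑ q ∈ (Finset.Icc 1 N).filter Squarefree, ww q / q ≤
      ∑ q ∈ Finset.Icc 1 N, ∑ d ∈ q.divisors, (if Squarefree d then e d / d * (1 / ((q / d : ℕ) : ℝ)) else 0) := by
    refine (Finset.sum_le_sum h1).trans ?_
    refine Finset.sum_le_sum_of_subset_of_nonneg (Finset.filter_subset _ _) ?_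
    intro q _ _
    refine Finset.sum_nonneg fun d hd => ?_
    split_ifs
    · have := he0 d (Nat.pos_of_mem_divisors hd).ne'
      positivity
    · exact le_rfl
  refine h2.trans ?_
  rw [← sum_mul_le N (fun d k => if Squarefree d then e d / d * (1 / (k : ℝ)) else 0)]
  have h3 : ∀ d ∈ Finset.Icc 1 N, ∑ k ∈ Finset.Icc 1 (N / d), (if Squarefree d then e d / d * (1 / (k : ℝ)) else 0)
      ≤ (if Squarefree d then e d / d else 0) * (1 + Real.log N) := by
    intro d hd
    rw [Finset.mem_Icc] at hd
    split_ifs with hs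
    · rw [← Finset.mul_sum]
      have := he0 d (by omega)
      gcongr
      have hh := harmonic_le_one_add_log (N / d)
      rw [harmonic_eq_sum_Icc] at hh; push_cast at hh
      simp only [one_div]
      refine hh.trans ?_
      have hpos : 0 < N / d := Nat.div_pos hd.2 hd.1
      gcongr
      exact Nat.cast_le.2 (Nat.div_le_self _ _)
    · simp
  refine (Finset.sum_le_sum h3).trans ?_
  rw [← Finset.sum_mul]
  have hlog : 0 ≤ Real.log N := Real.log_natCast_nonneg N
  gcongr
  rw [← Finset.sum_filter]
  calc ∑ d ∈ (Finset.Icc 1 N).filter Squarefree, e d / d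
      = ∑ d ∈ (Finset.Icc 1 N).filter Squarefree, ∏ p ∈ d.primeFactors, (10 * ((p:ℝ)^2)⁻¹) := by
        refine Finset.sum_congr rfl fun d hd => ?_
        rw [Finset.mem_filter, Finset.mem_Icc] at hd
        rw [heap d (by omega)]
        have : (d:ℝ) = ∏ p ∈ d.primeFactors, (p:ℝ) := by
          rw [← Nat.cast_prod, Nat.prod_primeFactors_of_squarefree hd.2]
        conv_lhs => rw [this]
        rw [← Finset.prod_div_distrib]
        refine Finset.prod_congr rfl fun p hp => ?_
        have : (p:ℝ) ≠ 0 := by exact_mod_cast (Nat.pos_of_mem_primeFactors hp).ne'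
        field_simp
    _ ≤ ∏ p ∈ Finset.Icc 1 N, (1 + 10 * ((p:ℝ)^2)⁻¹) := sum_sqfree_le N _ (fun p => by positivity)
    _ ≤ ∏ p ∈ Finset.Icc 1 N, Real.exp (10 * ((p:ℝ)^2)⁻¹) := by
        refine Finset.prod_le_prod (fun p _ => by positivity) fun p _ => ?_
        rw [add_comm]; exact Real.add_one_le_exp _
    _ = Real.exp (∑ p ∈ Finset.Icc 1 N, 10 * ((p:ℝ)^2)⁻¹) := (Real.exp_sum _ _).symm
    _ ≤ Real.exp 20 := by
        rw [Real.exp_le_exp, ← Finset.mul_sum]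
        linarith [sum_inv_sq_Icc N]

lemma mu_mul (a b : ℕ) : mu (a * b) = if Nat.Coprime a b then mu a * mu b else 0 := by
  unfold mu
  split_ifs with h
  · rw [ArithmeticFunction.isMultiplicative_moebius.map_mul_of_coprime h]; push_cast; rfl
  · rw [ArithmeticFunction.moebius_eq_zero_of_not_squarefree]
    · simp
    · intro hs; exact h (Nat.coprime_of_squarefree_mul hs)

noncomputable def zq (L κ : ℝ) (q : ℕ) : ℝ :=
  ∑ h ∈ (Finset.Icc 1 (NN L)).filter (fun h => q ∣ h), lam L h * (h:ℝ) ^ (-(1 + κ))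

lemma xi_le_NN (L : ℝ) : xi L ≤ NN L := Nat.le_ceil _
lemma XX_le_xi (L : ℝ) (hL : 0 ≤ L) : XX L ≤ xi L := by
  unfold XX xi; exact Real.exp_le_exp.2 (by linarith)
lemma xi_pos (L : ℝ) : 0 < xi L := Real.exp_pos _
lemma XX_pos (L : ℝ) : 0 < XX L := Real.exp_pos _

lemma zq_eq (L κ : ℝ) (hL : 0 < L) (q : ℕ) (hq : 1 ≤ q) :
    zq L κ q = mu q * (q:ℝ) ^ (-(1 + κ)) *
      ((LS q.primeFactors κ (NN L) (xi L / q) - LS q.primeFactors κ (NN L) (XX L / q)) / (L / 8)) := by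
  unfold zq LS
  rw [← Finset.sum_sub_distrib, Finset.sum_div, Finset.mul_sum]
  have hq0 : (0:ℝ) < q := by exact_mod_cast hq
  set N := NN L
  have h3 : ∑ h ∈ (Finset.Icc 1 N).filter (fun h => q ∣ h), lam L h * (h:ℝ) ^ (-(1 + κ))
      = ∑ m ∈ Finset.Icc 1 (N / q), lam L (q * m) * ((q * m : ℕ):ℝ) ^ (-(1 + κ)) := by
    symm
    refine Finset.sum_bij' (fun k _ => q * k) (fun m _ => m / q) ?_ ?_ ?_ ?_ ?_
    · intro k hk
      simp only [Finset.mem_filter, Finset.mem_Icc] at hk ⊢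
      obtain ⟨a, b⟩ := hk
      refine ⟨⟨Nat.mul_pos hq a, ?_⟩, Dvd.intro _ rfl⟩
      rw [mul_comm]; exact (Nat.le_div_iff_mul_le hq).1 b
    · intro m hm
      simp only [Finset.mem_filter, Finset.mem_Icc] at hm ⊢
      obtain ⟨⟨a, b⟩, d⟩ := hm
      exact ⟨Nat.div_pos (Nat.le_of_dvd a d) hq, Nat.div_le_div_right b⟩
    · intro k _; exact Nat.mul_div_cancel_left _ hq
    · intro m hm
      simp only [Finset.mem_filter] at hm
      exact Nat.mul_div_cancel' hm.2
    · intro k _; rfl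
  rw [h3]
  have hsub : (Finset.Icc 1 (N / q)).filter (fun m => ∀ p ∈ q.primeFactors, ¬ p ∣ m) ⊆
      (Finset.Icc 1 N).filter (fun m => ∀ p ∈ q.primeFactors, ¬ p ∣ m) :=
    Finset.filter_subset_filter _ (Finset.Icc_subset_Icc_right (Nat.div_le_self _ _))
  have hcop : ∀ m : ℕ, (∀ p ∈ q.primeFactors, ¬ p ∣ m) ↔ Nat.Coprime q m := by
    intro m
    constructor
    · intro h
      refine Nat.coprime_of_dvd fun p hp h1 h2 => ?_
      exact h p (Nat.mem_primeFactors.2 ⟨hp, h1, by omega⟩) h2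
    · intro h p hp h2
      have hp' := Nat.prime_of_mem_primeFactors hp
      have := Nat.dvd_gcd (Nat.dvd_of_mem_primeFactors hp) h2
      rw [h] at this
      exact hp'.one_lt.ne' (Nat.dvd_one.1 this)
  rw [← Finset.sum_subset hsub, ← Finset.sum_subset (Finset.filter_subset (fun m => ∀ p ∈ q.primeFactors, ¬ p ∣ m) (Finset.Icc 1 (N / q)))]
  · refine Finset.sum_congr rfl fun m hm => ?_
    rw [Finset.mem_filter, hcop] at hm
    rw [lam, mu_mul, if_pos hm.2, wt]
    push_cast
    rw [Real.mul_rpow hq0.le (by positivity), div_div, div_div]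
    ring
  · intro m hm hm'
    rw [Finset.mem_filter, hcop] at hm'
    rw [lam, mu_mul, if_neg (fun h => hm' ⟨hm, h⟩)]
    ring
  · intro m hm hm'
    have : N / q < m := by
      by_contra h
      apply hm'
      simp only [Finset.mem_filter, Finset.mem_Icc] at hm ⊢
      exact ⟨⟨hm.1.1, by omega⟩, hm.2⟩
    have h1 : xi L ≤ m * q := by
      have := (Nat.div_lt_iff_lt_mul hq).1 this
      have : (N:ℝ) ≤ m * q := by exact_mod_cast this.le
      linarith [xi_le_NN L]
    have h2 := XX_le_xi L hL.le
    rw [posLog_div_zero (xi L / q) (by have := xi_pos L; positivity) m (by rw [div_le_iff₀ hq0]; linarith),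
      posLog_div_zero (XX L / q) (by have := XX_pos L; positivity) m (by rw [div_le_iff₀ hq0]; linarith)]
    simp

lemma zq_bound (L κ : ℝ) (hL : 0 < L) (hκ : 0 ≤ κ) (hκL : κ * L ≤ 1) (q : ℕ) (hq : 1 ≤ q) :
    |zq L κ q| ≤ (q:ℝ) ^ (-(1 + κ)) * (224 / L * ∏ p ∈ q.primeFactors, ((p:ℝ) / (p - 1))) := by
  rw [zq_eq L κ hL q hq]
  have hq1 : (1:ℝ) ≤ q := by exact_mod_cast hq
  have hlx : κ * Real.log (xi L) ≤ 1 := by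
    rw [xi, Real.log_exp]; nlinarith
  have hx := xi_pos L
  have hX := XX_pos L
  have hle := XX_le_xi L hL.le
  have a := LS_bound q.primeFactors (fun p hp => Nat.prime_of_mem_primeFactors hp) κ hκ (NN L) (xi L) hlx
    (xi L / q) (by positivity) ((div_le_self hx.le hq1).trans (xi_le_NN L)) (div_le_self hx.le hq1)
  have b := LS_bound q.primeFactors (fun p hp => Nat.prime_of_mem_primeFactors hp) κ hκ (NN L) (xi L) hlx
    (XX L / q) (by positivity) (((div_le_self hX.le hq1).trans hle).trans (xi_le_NN L)) ((div_le_self hX.le hq1).trans hle)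
  set Q := ∏ p ∈ q.primeFactors, ((p:ℝ) / (p - 1))
  set A := LS q.primeFactors κ (NN L) (xi L / q)
  set B := LS q.primeFactors κ (NN L) (XX L / q)
  rw [abs_mul, abs_mul, abs_of_nonneg (Real.rpow_nonneg (by linarith) (-(1 + κ)) : (0:ℝ) ≤ (q:ℝ) ^ (-(1 + κ)))]
  have hr : (0:ℝ) ≤ (q:ℝ) ^ (-(1 + κ)) := Real.rpow_nonneg (by linarith) _
  have h1 : |(A - B) / (L / 8)| ≤ 224 / L * Q := by
    rw [abs_div, abs_of_pos (show (0:ℝ) < L / 8 by positivity), div_le_iff₀ (by positivity)]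
    have : 224 / L * Q * (L / 8) = 28 * Q := by field_simp; ring
    rw [this]
    have := abs_sub A B
    linarith
  calc |mu q| * (q:ℝ) ^ (-(1 + κ)) * |(A - B) / (L / 8)| ≤ 1 * (q:ℝ) ^ (-(1 + κ)) * (224 / L * Q) := by
        gcongr
        exact abs_mu_le q
    _ = _ := by ring

lemma zq_not_sqfree (L κ : ℝ) (hL : 0 < L) (q : ℕ) (hq : 1 ≤ q) (h : ¬ Squarefree q) : zq L κ q = 0 := by
  rw [zq_eq L κ hL q hq]
  have : mu q = 0 := by unfold mu; rw [ArithmeticFunction.moebius_eq_zero_of_not_squarefree h]; simp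
  rw [this]; ring

lemma sum_div_rpow (q : ℕ) (hs : Squarefree q) (κ : ℝ) (hκ : 0 ≤ κ) :
    ∑ d ∈ q.divisors, (d:ℝ) ^ (1 + κ) ≤ (q:ℝ) ^ κ * ∏ p ∈ q.primeFactors, ((p:ℝ) + 1) := by
  have h := ArithmeticFunction.isMultiplicative_id.prodPrimeFactors_one_add_of_squarefree hs
  have h' : ∏ p ∈ q.primeFactors, ((p:ℝ) + 1) = ∑ d ∈ q.divisors, (d:ℝ) := by
    have := congrArg (fun n : ℕ => (n:ℝ)) h
    simp only [ArithmeticFunction.id_apply] at this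
    push_cast at this
    rw [← this]
    exact Finset.prod_congr rfl fun p _ => by ring
  rw [h', Finset.mul_sum]
  refine Finset.sum_le_sum fun d hd => ?_
  have hd0 : (0:ℝ) < d := by exact_mod_cast Nat.pos_of_mem_divisors hd
  rw [Real.rpow_add hd0, Real.rpow_one, mul_comm]
  gcongr
  exact Nat.divisor_le hd

/-- Part B -/
lemma partB_gen (L κ : ℝ) (hL : 8 ≤ L) (hκ : 0 ≤ κ) (hκL : κ * L ≤ 1) (K : ℕ → ℝ) (B : ℝ) (hB : 0 ≤ B)
    (hK : ∀ d, 1 ≤ d → |K d| ≤ B * (d:ℝ) ^ (1 + κ)) :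
    |∑ h ∈ Finset.Icc 1 (NN L), ∑ k ∈ Finset.Icc 1 (NN L),
      (lam L h * (h:ℝ) ^ (-(1 + κ))) * (lam L k * (k:ℝ) ^ (-(1 + κ))) * K (Nat.gcd h k)|
      ≤ (2 * 224 ^ 2 * Real.exp 20) * B / L := by
  set N := NN L with hN
  set kk : ℕ → ℝ := fun n => ∑ x ∈ n.divisorsAntidiagonal, ((μ x.1 : ℤ) : ℝ) * K x.2 with hkk
  have hinv : ∀ n > 0, ∑ i ∈ n.divisors, kk i = K n :=
    ArithmeticFunction.sum_eq_iff_sum_mul_moebius_eq.2 (fun n _ => rfl)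
  have hkb : ∀ q, 1 ≤ q → |kk q| ≤ B * ∑ d ∈ q.divisors, (d:ℝ) ^ (1 + κ) := by
    intro q hq
    simp only [hkk]
    rw [Nat.sum_divisorsAntidiagonal (fun a b => ((μ a : ℤ) : ℝ) * K b)]
    refine (Finset.abs_sum_le_sum_abs _ _).trans ?_
    rw [← Nat.sum_div_divisors q (fun d => (d:ℝ) ^ (1 + κ)), Finset.mul_sum]
    refine Finset.sum_le_sum fun d hd => ?_
    rw [abs_mul]
    have hd0 := Nat.pos_of_mem_divisors hd
    have := hK (q / d) (Nat.div_pos (Nat.divisor_le hd) hd0)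
    calc _ ≤ 1 * (B * ((q / d : ℕ) : ℝ) ^ (1 + κ)) := mul_le_mul (abs_mu_le d) this (abs_nonneg _) zero_le_one
      _ = _ := one_mul _
  have hgcd : ∀ h ∈ Finset.Icc 1 N, ∀ k ∈ Finset.Icc 1 N,
      K (Nat.gcd h k) = ∑ q ∈ Finset.Icc 1 N, if q ∣ h then (if q ∣ k then kk q else 0) else 0 := by
    intro h hh k hk'
    rw [Finset.mem_Icc] at hh hk'
    rw [← hinv _ (Nat.gcd_pos_of_pos_left k (by omega))]
    rw [Finset.sum_ite, Finset.sum_const_zero, add_zero, Finset.sum_ite, Finset.sum_const_zero, add_zero]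
    refine Finset.sum_congr ?_ fun _ _ => rfl
    ext q
    simp only [Nat.mem_divisors, Finset.mem_filter, Finset.mem_Icc, Nat.dvd_gcd_iff]
    constructor
    · rintro ⟨⟨a, b⟩, c⟩
      exact ⟨⟨⟨Nat.pos_of_dvd_of_pos a hh.1, (Nat.le_of_dvd hh.1 a).trans hh.2⟩, a⟩, b⟩
    · rintro ⟨⟨_, a⟩, b⟩
      exact ⟨⟨a, b⟩, (Nat.gcd_pos_of_pos_left k (by omega)).ne'⟩
  have hmain : ∑ h ∈ Finset.Icc 1 N, ∑ k ∈ Finset.Icc 1 N,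
      (lam L h * (h:ℝ) ^ (-(1 + κ))) * (lam L k * (k:ℝ) ^ (-(1 + κ))) * K (Nat.gcd h k)
      = ∑ q ∈ Finset.Icc 1 N, kk q * zq L κ q ^ 2 := by
    have e1 : ∑ h ∈ Finset.Icc 1 N, ∑ k ∈ Finset.Icc 1 N,
      (lam L h * (h:ℝ) ^ (-(1 + κ))) * (lam L k * (k:ℝ) ^ (-(1 + κ))) * K (Nat.gcd h k)
      = ∑ h ∈ Finset.Icc 1 N, ∑ k ∈ Finset.Icc 1 N, ∑ q ∈ Finset.Icc 1 N,
       (if q ∣ h then lam L h * (h:ℝ) ^ (-(1 + κ)) else 0) * ((if q ∣ k then lam L k * (k:ℝ) ^ (-(1 + κ)) else 0) * kk q) := by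
      refine Finset.sum_congr rfl fun h hh => Finset.sum_congr rfl fun k hk' => ?_
      rw [hgcd h hh k hk', Finset.mul_sum]
      refine Finset.sum_congr rfl fun q _ => ?_
      split_ifs <;> ring
    rw [e1]
    have e2 : ∀ h ∈ Finset.Icc 1 N, ∑ k ∈ Finset.Icc 1 N, ∑ q ∈ Finset.Icc 1 N,
       (if q ∣ h then lam L h * (h:ℝ) ^ (-(1 + κ)) else 0) * ((if q ∣ k then lam L k * (k:ℝ) ^ (-(1 + κ)) else 0) * kk q)
       = ∑ q ∈ Finset.Icc 1 N, (if q ∣ h then lam L h * (h:ℝ) ^ (-(1 + κ)) else 0) * (zq L κ q * kk q) := by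
      intro h _
      rw [Finset.sum_comm]
      refine Finset.sum_congr rfl fun q _ => ?_
      rw [← Finset.mul_sum, ← Finset.sum_mul, zq, Finset.sum_filter]
    rw [Finset.sum_congr rfl e2, Finset.sum_comm]
    refine Finset.sum_congr rfl fun q _ => ?_
    rw [← Finset.sum_mul, ← Finset.sum_filter]
    rw [show ∑ a ∈ (Finset.Icc 1 N).filter (fun h => q ∣ h), lam L a * (a:ℝ) ^ (-(1 + κ)) = zq L κ q from rfl]
    ring
  rw [hmain]
  have hterm : ∀ q ∈ Finset.Icc 1 N, |kk q * zq L κ q ^ 2| ≤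
      if Squarefree q then B * (224 / L) ^ 2 * (ww q / q) else 0 := by
    intro q hq
    have hq1 := (Finset.mem_Icc.1 hq).1
    have hq0 : (0:ℝ) < q := by exact_mod_cast hq1
    split_ifs with hs
    · rw [abs_mul, abs_pow]
      have b1 := (hkb q hq1).trans (mul_le_mul_of_nonneg_left (sum_div_rpow q hs κ hκ) hB)
      have b2 := zq_bound L κ (by linarith) hκ hκL q hq1
      calc |kk q| * |zq L κ q| ^ 2
          ≤ (B * ((q:ℝ) ^ κ * ∏ p ∈ q.primeFactors, ((p:ℝ) + 1))) *
            ((q:ℝ) ^ (-(1 + κ)) * (224 / L * ∏ p ∈ q.primeFactors, ((p:ℝ) / (p - 1)))) ^ 2 := by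
            gcongr
        _ = B * (224 / L) ^ 2 * ((q:ℝ) ^ κ * ((q:ℝ) ^ (-(1 + κ))) ^ 2 * ((∏ p ∈ q.primeFactors, ((p:ℝ) + 1)) *
             (∏ p ∈ q.primeFactors, ((p:ℝ) / (p - 1))) ^ 2)) := by ring
        _ ≤ B * (224 / L) ^ 2 * (ww q / q) := by
            have f1 : (∏ p ∈ q.primeFactors, ((p:ℝ) + 1)) * (∏ p ∈ q.primeFactors, ((p:ℝ) / (p - 1))) ^ 2 = q * ww q := by
              have : (q:ℝ) = ∏ p ∈ q.primeFactors, (p:ℝ) := by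
                rw [← Nat.cast_prod, Nat.prod_primeFactors_of_squarefree hs]
              conv_rhs => rw [this]
              rw [ww, ← Finset.prod_pow, ← Finset.prod_mul_distrib, ← Finset.prod_mul_distrib]
              refine Finset.prod_congr rfl fun p _ => ?_
              rw [div_pow]; ring
            have f2 : (q:ℝ) ^ κ * ((q:ℝ) ^ (-(1 + κ))) ^ 2 ≤ (q:ℝ) ^ (-2 : ℝ) := by
              rw [← Real.rpow_natCast, ← Real.rpow_mul hq0.le, ← Real.rpow_add hq0]
              refine Real.rpow_le_rpow_of_exponent_le (by exact_mod_cast hq1) ?_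
              push_cast; linarith
            have hw : 0 ≤ ww q := Finset.prod_nonneg fun p _ => by positivity
            rw [f1]
            have f3 : (q:ℝ) ^ (-2:ℝ) * (q * ww q) = ww q / q := by
              rw [show (-2:ℝ) = -((2:ℕ):ℝ) by norm_num, Real.rpow_neg hq0.le, Real.rpow_natCast]; field_simp
            rw [← f3]
            gcongr
    · rw [zq_not_sqfree L κ (by linarith) q hq1 hs]; simp
  refine (Finset.abs_sum_le_sum_abs _ _).trans ((Finset.sum_le_sum hterm).trans ?_)
  rw [← Finset.sum_filter, ← Finset.mul_sum]
  have hlogN : 1 + Real.log N ≤ 2 * L := by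
    have h1 : (N:ℝ) ≤ Real.exp L := by
      have := (Nat.ceil_lt_add_one (xi_pos L).le).le
      have e1 : xi L + 1 ≤ Real.exp L := by
        have e2 : Real.exp L = xi L * Real.exp (3 * L / 4) := by
          rw [xi, ← Real.exp_add]; congr 1; ring
        have e3 : 1 ≤ xi L := Real.one_le_exp (by linarith)
        have e4 : 2 ≤ Real.exp (3 * L / 4) := by
          have := Real.add_one_le_exp (3 * L / 4); linarith
        nlinarith
      exact this.trans e1
    have hN1 : (0:ℝ) < N := lt_of_lt_of_le (xi_pos L) (xi_le_NN L)
    have := Real.log_le_log hN1 h1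
    rw [Real.log_exp] at this; linarith
  calc B * (224 / L) ^ 2 * ∑ q ∈ (Finset.Icc 1 N).filter Squarefree, ww q / q
      ≤ B * (224 / L) ^ 2 * (Real.exp 20 * (2 * L)) := by
        gcongr
        refine (ww_sum N).trans ?_
        gcongr
    _ = _ := by field_simp

end ZD
end

section
namespace ZD
open scoped ArithmeticFunction.Moebius

/-- coefficients of `ζ M` -/
noncomputable def an (L : ℝ) (n : ℕ) : ℝ :=
  ∑ h ∈ (Finset.Icc 1 (NN L)).filter (fun h => h ∣ n), lam L h

lemma posLog_xi_div (L : ℝ) (h : ℕ) (hh : 1 ≤ h) : Real.posLog (xi L / h) = max 0 (L / 4 - Real.log h) :=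
  posLog_exp_div _ _ hh
lemma posLog_XX_div (L : ℝ) (h : ℕ) (hh : 1 ≤ h) : Real.posLog (XX L / h) = max 0 (L / 8 - Real.log h) :=
  posLog_exp_div _ _ hh

lemma abs_lam_le (L : ℝ) (hL : 0 < L) (h : ℕ) (hh : 1 ≤ h) : |lam L h| ≤ 1 := by
  rw [lam, abs_mul, posLog_xi_div L h hh, posLog_XX_div L h hh]
  have h1 : |(max 0 (L / 4 - Real.log h) - max 0 (L / 8 - Real.log h)) / (L / 8)| ≤ 1 := by
    rw [abs_div, abs_of_pos (show (0:ℝ) < L / 8 by positivity), div_le_one (by positivity), abs_le]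
    constructor
    · rcases max_cases 0 (L / 4 - Real.log h) with a | a <;> rcases max_cases 0 (L / 8 - Real.log h) with b | b <;> linarith
    · rcases max_cases 0 (L / 4 - Real.log h) with a | a <;> rcases max_cases 0 (L / 8 - Real.log h) with b | b <;> linarith
  calc _ ≤ 1 * 1 := mul_le_mul (abs_mu_le h) h1 (abs_nonneg _) zero_le_one
    _ = 1 := one_mul 1

lemma lam_of_le (L : ℝ) (hL : 0 < L) (h : ℕ) (hh : 1 ≤ h) (hX : (h:ℝ) ≤ XX L) : lam L h = mu h := by
  have hl : Real.log h ≤ L / 8 := by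
    have := Real.log_le_log (by exact_mod_cast hh) hX
    rwa [XX, Real.log_exp] at this
  rw [lam, posLog_xi_div L h hh, posLog_XX_div L h hh, max_eq_right (by linarith), max_eq_right (by linarith)]
  have : (L / 4 - Real.log h - (L / 8 - Real.log h)) / (L / 8) = 1 := by field_simp; ring
  rw [this, mul_one]

lemma an_eq_of_le (L : ℝ) (hL : 0 < L) (n : ℕ) (hn : 1 ≤ n) (hX : (n:ℝ) ≤ XX L) :
    an L n = if n = 1 then 1 else 0 := by
  rw [← sum_divisors_mu n (by omega), an]
  have hs : (Finset.Icc 1 (NN L)).filter (fun h => h ∣ n) = n.divisors := by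
    ext d
    simp only [Finset.mem_filter, Finset.mem_Icc, Nat.mem_divisors]
    constructor
    · rintro ⟨_, a⟩; exact ⟨a, by omega⟩
    · rintro ⟨a, _⟩
      refine ⟨⟨Nat.pos_of_dvd_of_pos a hn, ?_⟩, a⟩
      have h1 := Nat.le_of_dvd hn a
      have h2 : (n:ℝ) ≤ NN L := hX.trans ((XX_le_xi L hL.le).trans (xi_le_NN L))
      exact h1.trans (by exact_mod_cast h2)
  rw [hs]
  refine Finset.sum_congr rfl fun d hd => ?_
  have hd0 := Nat.pos_of_mem_divisors hd
  refine lam_of_le L hL d hd0 (le_trans ?_ hX)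
  exact_mod_cast Nat.divisor_le hd

lemma zeta_partial (s : ℝ) (hs : 1 < s) : Summable (fun n : ℕ => (n:ℝ) ^ (-s)) ∧
    ∑' n : ℕ, (n:ℝ) ^ (-s) ≤ 1 + 1 / (s - 1) := by
  have h1 : Summable (fun n : ℕ => (n:ℝ) ^ (-s)) := Real.summable_nat_rpow.2 (by linarith)
  refine ⟨h1, ?_⟩
  have h2 := ZetaAsymptotics.zeta_limit_aux1 hs
  rw [h1.tsum_eq_zero_add]
  simp only [Nat.cast_zero]
  rw [Real.zero_rpow (by linarith), zero_add]
  have h3 : 0 ≤ ZetaAsymptotics.termTSum s := tsum_nonneg fun n => ZetaAsymptotics.term_nonneg _ _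
  have h4 : ∑' n : ℕ, ((n + 1 : ℕ):ℝ) ^ (-s) = ∑' n : ℕ, 1 / ((n:ℝ) + 1) ^ s := by
    refine tsum_congr fun n => ?_
    rw [Real.rpow_neg (by positivity)]; push_cast; rw [one_div]
  rw [h4]
  nlinarith

lemma hasSum_dvd (s : ℝ) (hs : 1 < s) (m : ℕ) (hm : 1 ≤ m) :
    HasSum (fun n : ℕ => if m ∣ n then (n:ℝ) ^ (-s) else 0) ((m:ℝ) ^ (-s) * ∑' n : ℕ, (n:ℝ) ^ (-s)) := by
  have hinj : Function.Injective (fun k : ℕ => m * k) := fun a b h => Nat.eq_of_mul_eq_mul_left hm h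
  rw [← hinj.hasSum_iff]
  · have := (zeta_partial s hs).1.hasSum.mul_left ((m:ℝ) ^ (-s))
    have e : ((fun n : ℕ => if m ∣ n then (n:ℝ) ^ (-s) else 0) ∘ fun k : ℕ => m * k) = fun i : ℕ => (m:ℝ) ^ (-s) * (i:ℝ) ^ (-s) := by
      funext k
      simp only [Function.comp]
      rw [if_pos (Dvd.intro _ rfl)]
      push_cast
      rw [Real.mul_rpow (by positivity) (by positivity)]
    rw [e]; exact this
  · intro n hn
    rw [if_neg]
    rintro ⟨k, rfl⟩
    exact hn ⟨k, rfl⟩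

lemma an_sq (L : ℝ) (n : ℕ) : an L n ^ 2 = ∑ h ∈ Finset.Icc 1 (NN L), ∑ k ∈ Finset.Icc 1 (NN L),
    lam L h * lam L k * (if Nat.lcm h k ∣ n then 1 else 0) := by
  rw [an, Finset.sum_filter, sq, Finset.sum_mul_sum]
  refine Finset.sum_congr rfl fun h _ => Finset.sum_congr rfl fun k _ => ?_
  by_cases h1 : h ∣ n <;> by_cases h2 : k ∣ n <;> simp [h1, h2, Nat.lcm_dvd_iff]

/-- Part C -/
lemma partC (L : ℝ) (hL : 8 ≤ L) (M : ℕ) (hM : Real.log M ≤ 2 * L) :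
    ∑ n ∈ Finset.Icc 1 M, an L n ^ 2 / n ≤ 4 * 224 ^ 2 * Real.exp 22 := by
  set κ := 1 / L with hκ
  have hL0 : 0 < L := by linarith
  have hκ0 : 0 < κ := by positivity
  have hκL : κ * L = 1 := by rw [hκ]; field_simp
  set Z := ∑' n : ℕ, (n:ℝ) ^ (-(1+κ)) with hZ
  have hZ1 : Z ≤ 2 * L := by
    have := (zeta_partial (1+κ) (by linarith)).2
    rw [show 1 / (1 + κ - 1) = L by rw [hκ]; simp] at this
    linarith
  have hZ0 : 0 ≤ Z := tsum_nonneg fun n => by positivity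
  have hsum : HasSum (fun n : ℕ => an L n ^ 2 * (n:ℝ) ^ (-(1+κ)))
      (∑ h ∈ Finset.Icc 1 (NN L), ∑ k ∈ Finset.Icc 1 (NN L),
        lam L h * lam L k * (((Nat.lcm h k : ℕ):ℝ) ^ (-(1+κ)) * Z)) := by
    have : (fun n : ℕ => an L n ^ 2 * (n:ℝ) ^ (-(1+κ))) = fun n : ℕ => ∑ h ∈ Finset.Icc 1 (NN L), ∑ k ∈ Finset.Icc 1 (NN L),
        lam L h * lam L k * (if Nat.lcm h k ∣ n then (n:ℝ) ^ (-(1+κ)) else 0) := by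
      funext n
      rw [an_sq, Finset.sum_mul]
      refine Finset.sum_congr rfl fun h _ => ?_
      rw [Finset.sum_mul]
      refine Finset.sum_congr rfl fun k _ => ?_
      split_ifs <;> ring
    rw [this]
    refine hasSum_sum fun h hh => hasSum_sum fun k hk => ?_
    rw [Finset.mem_Icc] at hh hk
    exact (hasSum_dvd (1+κ) (by linarith) _ (Nat.lcm_pos (by omega) (by omega))).mul_left _
  have hval : ∑ h ∈ Finset.Icc 1 (NN L), ∑ k ∈ Finset.Icc 1 (NN L),
        lam L h * lam L k * (((Nat.lcm h k : ℕ):ℝ) ^ (-(1+κ)) * Z)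
      = Z * ∑ h ∈ Finset.Icc 1 (NN L), ∑ k ∈ Finset.Icc 1 (NN L),
      (lam L h * (h:ℝ) ^ (-(1 + κ))) * (lam L k * (k:ℝ) ^ (-(1 + κ))) * ((Nat.gcd h k : ℕ) : ℝ) ^ (1 + κ) := by
    rw [Finset.mul_sum]
    refine Finset.sum_congr rfl fun h hh => ?_
    rw [Finset.mul_sum]
    refine Finset.sum_congr rfl fun k hk => ?_
    rw [Finset.mem_Icc] at hh hk
    have hg : 0 < Nat.gcd h k := Nat.gcd_pos_of_pos_left k (by omega)
    have hg' : (0:ℝ) < (Nat.gcd h k : ℕ) := by exact_mod_cast hg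
    have e : ((Nat.lcm h k : ℕ):ℝ) ^ (-(1+κ)) = (h:ℝ) ^ (-(1 + κ)) * (k:ℝ) ^ (-(1 + κ)) * ((Nat.gcd h k : ℕ) : ℝ) ^ (1 + κ) := by
      have h1 : ((Nat.gcd h k : ℕ) : ℝ) * (Nat.lcm h k : ℕ) = h * k := by exact_mod_cast Nat.gcd_mul_lcm h k
      have h2 : ((Nat.lcm h k : ℕ):ℝ) = h * k * ((Nat.gcd h k : ℕ) : ℝ)⁻¹ := by rw [← h1]; field_simp
      rw [h2, Real.mul_rpow (by positivity) (by positivity), Real.mul_rpow (by positivity) (by positivity),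
        Real.inv_rpow (by positivity), ← Real.rpow_neg (by positivity), neg_neg]
    rw [e]; ring
  have hB := partB_gen L κ hL hκ0.le hκL.le (fun d => (d:ℝ) ^ (1+κ)) 1 zero_le_one
    (fun d _ => by rw [abs_of_nonneg (by positivity), one_mul])
  rw [hval] at hsum
  have hfin : ∑ n ∈ Finset.Icc 1 M, an L n ^ 2 * (n:ℝ) ^ (-(1+κ)) ≤ 4 * 224 ^ 2 * Real.exp 20 := by
    refine (sum_le_hasSum (Finset.Icc 1 M) (fun n _ => by positivity) hsum).trans ?_
    calc _ ≤ (2 * L) * ((2 * 224 ^ 2 * Real.exp 20) * 1 / L) := by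
          refine (mul_le_mul_of_nonneg_left (le_abs_self _) hZ0).trans ?_
          exact mul_le_mul hZ1 hB (abs_nonneg _) (by positivity)
      _ = _ := by field_simp; ring
  have hstep : ∀ n ∈ Finset.Icc 1 M, an L n ^ 2 / n ≤ Real.exp 2 * (an L n ^ 2 * (n:ℝ) ^ (-(1+κ))) := by
    intro n hn
    rw [Finset.mem_Icc] at hn
    have hn0 : (0:ℝ) < n := by exact_mod_cast hn.1
    have h1 : (n:ℝ) ^ κ ≤ Real.exp 2 := by
      rw [Real.rpow_def_of_pos hn0, Real.exp_le_exp]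
      have : Real.log n ≤ Real.log M := Real.log_le_log hn0 (by exact_mod_cast hn.2)
      nlinarith
    have h2 : (n:ℝ) ^ (-(1+κ)) = (n:ℝ)⁻¹ * ((n:ℝ)^κ)⁻¹ := by
      rw [neg_add, Real.rpow_add hn0, Real.rpow_neg_one, Real.rpow_neg hn0.le]
    rw [h2]
    have h3 : 0 < (n:ℝ)^κ := Real.rpow_pos_of_pos hn0 _
    have h4 : 1 ≤ Real.exp 2 * ((n:ℝ)^κ)⁻¹ := by
      rw [← div_eq_mul_inv, one_le_div h3]; exact h1
    calc an L n ^ 2 / n = an L n ^ 2 / n * 1 := by ring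
      _ ≤ an L n ^ 2 / n * (Real.exp 2 * ((n:ℝ)^κ)⁻¹) := by gcongr
      _ = _ := by rw [div_eq_mul_inv]; ring
  refine (Finset.sum_le_sum hstep).trans ?_
  rw [← Finset.mul_sum]
  calc _ ≤ Real.exp 2 * (4 * 224 ^ 2 * Real.exp 20) := by gcongr
    _ = _ := by rw [show (22:ℝ) = 2 + 20 by norm_num, Real.exp_add]; ring

end ZD
end

section
namespace ZD

/-- sum over an arithmetic progression against the integral -/
lemma AP_bound (f : ℝ → ℝ) (B W : ℝ) (hB : 0 ≤ B) (l a n : ℕ) (ha : 1 ≤ a) (hal : a ≤ l)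
    (hf : AntitoneOn f (Ici 0)) (hf0 : ∀ u, 0 ≤ u → 0 ≤ f u) (hW : f 0 ≤ W)
    (hfB : ∀ u, B < u → f u = 0) (hn : B ≤ n) (hn1 : 1 ≤ n) :
    |∑ j ∈ Finset.range n, f (a + j * l) - (1 / (l:ℝ)) * ∫ u in (0:ℝ)..B, f u| ≤ W := by
  have hl : (0:ℝ) < l := by exact_mod_cast (lt_of_lt_of_le ha hal)
  have hl1 : (1:ℝ) ≤ l := by exact_mod_cast (ha.trans hal)
  have ha0 : (0:ℝ) < a := by exact_mod_cast ha
  have hal' : (a:ℝ) ≤ l := by exact_mod_cast hal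
  set x₀ := (a:ℝ) / l with hx₀
  have hx0 : 0 < x₀ := by positivity
  have hx1 : x₀ ≤ 1 := (div_le_one hl).2 hal'
  set ft : ℝ → ℝ := fun s => f (l * s) with hft
  have hanti : AntitoneOn ft (Ici 0) := by
    intro s hs t ht hst
    simp only [hft, mem_Ici] at *
    exact hf (by simp only [mem_Ici]; positivity) (by simp only [mem_Ici]; positivity) (by gcongr)
  have hfW : ∀ u, 0 ≤ u → f u ≤ W := fun u hu => (hf (by simp) hu hu).trans hW
  have hIntg : ∀ b c : ℝ, 0 ≤ b → 0 ≤ c → IntervalIntegrable f volume b c := by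
    intro b c hb hc
    apply AntitoneOn.intervalIntegrable
    exact hf.mono (fun z hz => le_trans (le_min hb hc) hz.1)
  have hintt : ∀ b c : ℝ, 0 ≤ b → 0 ≤ c → IntervalIntegrable ft volume b c := by
    intro b c hb hc
    apply AntitoneOn.intervalIntegrable
    exact hanti.mono (fun z hz => le_trans (le_min hb hc) hz.1)
  -- the integral rescaled
  have hI : (1 / (l:ℝ)) * ∫ u in (0:ℝ)..B, f u = ∫ s in (0:ℝ)..(x₀ + n), ft s := by
    have h1 : ∫ s in (0:ℝ)..(x₀ + n), ft s = (l:ℝ)⁻¹ • ∫ u in (l * 0 : ℝ)..(l * (x₀ + n)), f u :=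
      intervalIntegral.integral_comp_mul_left f hl.ne'
    rw [h1, mul_zero, smul_eq_mul, one_div]
    congr 1
    have hbig : B ≤ l * (x₀ + n) := by
      have : (n:ℝ) ≤ l * n := by nlinarith [(Nat.cast_nonneg n : (0:ℝ) ≤ n)]
      nlinarith [mul_pos hl hx0]
    rw [← intervalIntegral.integral_add_adjacent_intervals (hIntg 0 B le_rfl hB) (hIntg B (l * (x₀ + n)) hB (hB.trans hbig))]
    have : ∫ u in B..(l * (x₀ + n)), f u = 0 := by
      apply intervalIntegral.integral_zero_ae
      refine Eventually.of_forall fun u hu => ?_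
      rw [uIoc_of_le hbig] at hu
      exact hfB u hu.1
    rw [this, add_zero]
  rw [hI]
  have hx0n : 0 ≤ x₀ + n := by positivity
  rw [← intervalIntegral.integral_add_adjacent_intervals (hintt 0 x₀ le_rfl hx0.le) (hintt x₀ (x₀ + n) hx0.le hx0n)]
  have hsum : ∀ j : ℕ, f (a + j * l) = ft (x₀ + j) := by
    intro j
    simp only [hft, hx₀]
    congr 1
    field_simp
  have hm : AntitoneOn ft (Icc x₀ (x₀ + n)) := hanti.mono fun z hz => le_trans hx0.le hz.1
  have u1 := hm.integral_le_sum
  have u2 := hm.sum_le_integral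
  have hfirst : ∫ s in (0:ℝ)..x₀, ft s ≤ W := by
    have : ∫ s in (0:ℝ)..x₀, ft s ≤ ∫ s in (0:ℝ)..x₀, W := by
      apply intervalIntegral.integral_mono_on hx0.le (hintt 0 x₀ le_rfl hx0.le) (by simp)
      intro s hs
      exact hfW _ (mul_nonneg hl.le hs.1)
    rw [intervalIntegral.integral_const, smul_eq_mul, sub_zero] at this
    have hW0 : 0 ≤ W := (hf0 0 le_rfl).trans hW
    nlinarith
  have hfirst0 : 0 ≤ ∫ s in (0:ℝ)..x₀, ft s :=
    intervalIntegral.integral_nonneg hx0.le fun s hs => hf0 _ (mul_nonneg hl.le hs.1)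
  have hs1 : ∑ j ∈ Finset.range n, f (a + j * l) = ∑ j ∈ Finset.range n, ft (x₀ + j) :=
    Finset.sum_congr rfl fun j _ => hsum j
  rw [hs1]
  have hs2 : ∑ j ∈ Finset.range n, ft (x₀ + j) ≤ W + ∑ j ∈ Finset.range n, ft (x₀ + (j + 1 : ℕ)) := by
    have e := Finset.sum_range_succ' (fun j : ℕ => ft (x₀ + j)) n
    have e' := Finset.sum_range_succ (fun j : ℕ => ft (x₀ + j)) n
    have h0 : 0 ≤ ft (x₀ + n) := hf0 _ (by positivity)
    have h1 : ft (x₀ + (0:ℕ)) ≤ W := hfW _ (by positivity)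
    have h2 : ft (x₀ + (n:ℕ)) = ft (x₀ + n) := rfl
    linarith
  rw [abs_le]
  constructor <;> linarith

lemma residue_exists (h k : ℕ) (hh : 1 ≤ h) (hk : 1 ≤ k) (r : ℤ) (hr : ((Nat.gcd h k : ℕ) : ℤ) ∣ r) :
    ∃ a : ℕ, 1 ≤ a ∧ a ≤ Nat.lcm h k ∧ ∀ m : ℕ, (h ∣ m ∧ (k:ℤ) ∣ (m:ℤ) + r) ↔ m ≡ a [MOD Nat.lcm h k] := by
  obtain ⟨s, hs⟩ := hr
  have hb := Nat.gcd_eq_gcd_ab h k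
  set l := Nat.lcm h k with hl
  have hl0 : 0 < l := Nat.lcm_pos (by omega) (by omega)
  set m0 : ℤ := -(h * Nat.gcdA h k * s) with hm0
  have e2 : m0 + r = k * (Nat.gcdB h k * s) := by
    rw [hs, hb, hm0]; ring
  refine ⟨((m0 - 1) % l).toNat + 1, by omega, ?_, ?_⟩
  · have := Int.emod_lt_of_pos (m0 - 1) (show (0:ℤ) < l by exact_mod_cast hl0)
    have := Int.emod_nonneg (m0 - 1) (show (l:ℤ) ≠ 0 by exact_mod_cast hl0.ne')
    omega
  · intro m
    have hnn := Int.emod_nonneg (m0 - 1) (show (l:ℤ) ≠ 0 by exact_mod_cast hl0.ne')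
    have ha : (((((m0 - 1) % l).toNat + 1 : ℕ)) : ℤ) = (m0 - 1) % l + 1 := by
      push_cast; rw [Int.toNat_of_nonneg hnn]
    have hdiv : (l:ℤ) ∣ m0 - ((m0 - 1) % l + 1) := by
      have := Int.dvd_self_sub_emod (x := m0 - 1) (m := l)
      have e : m0 - ((m0 - 1) % l + 1) = m0 - 1 - (m0 - 1) % l := by ring
      rw [e]; exact this
    have hA : (h ∣ m ∧ (k:ℤ) ∣ (m:ℤ) + r) ↔ (l:ℤ) ∣ m - m0 := by
      have h1 : (h:ℤ) ∣ m0 := by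
        rw [hm0]; exact (dvd_neg).2 ⟨Nat.gcdA h k * s, by ring⟩
      have h2 : (k:ℤ) ∣ m0 + r := ⟨_, e2⟩
      have : (l:ℤ) ∣ m - m0 ↔ (h:ℤ) ∣ m - m0 ∧ (k:ℤ) ∣ m - m0 := by
        rw [Int.natCast_dvd, Int.natCast_dvd, Int.natCast_dvd, hl, Nat.lcm_dvd_iff]
      rw [this]
      constructor
      · rintro ⟨a, b⟩
        refine ⟨dvd_sub (Int.natCast_dvd_natCast.2 a) h1, ?_⟩
        have := dvd_sub b h2
        simpa using this
      · rintro ⟨a, b⟩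
        refine ⟨Int.natCast_dvd_natCast.1 ?_, ?_⟩
        · have := dvd_add a h1; simpa using this
        · have := dvd_add b h2
          have e : (m:ℤ) - m0 + (m0 + r) = m + r := by ring
          rwa [e] at this
    rw [hA, Nat.modEq_iff_dvd, ha]
    constructor
    · intro h
      have := dvd_add h hdiv
      have e : (m:ℤ) - m0 + (m0 - ((m0 - 1) % l + 1)) = -(((m0 - 1) % l + 1) - m) := by ring
      rw [e] at this
      exact (dvd_neg).1 this
    · intro h
      have := dvd_add h hdiv
      have e : ((m0 - 1) % l + 1) - m + (m0 - ((m0 - 1) % l + 1)) = -((m:ℤ) - m0) := by ring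
      rw [e] at this
      exact (dvd_neg).1 this

lemma RS_anti (f : ℝ → ℝ) (B W : ℝ) (hB : 0 ≤ B) (h k M : ℕ) (hh : 1 ≤ h) (hk : 1 ≤ k) (r : ℤ)
    (hf : AntitoneOn f (Ici 0)) (hf0 : ∀ u, 0 ≤ u → 0 ≤ f u) (hW : f 0 ≤ W)
    (hfB : ∀ u, B < u → f u = 0) (hn : B ≤ M) (hn1 : 1 ≤ M) :
    |∑ m ∈ Finset.Icc 1 M, (if h ∣ m ∧ (k:ℤ) ∣ (m:ℤ) + r then f m else 0)
      - (if ((Nat.gcd h k : ℕ) : ℤ) ∣ r then (1 / ((Nat.lcm h k : ℕ):ℝ)) * ∫ u in (0:ℝ)..B, f u else 0)| ≤ W := by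
  have hW0 : 0 ≤ W := (hf0 0 le_rfl).trans hW
  split_ifs with hr
  · obtain ⟨a, ha1, hal, hiff⟩ := residue_exists h k hh hk r hr
    have key := AP_bound f B W hB (Nat.lcm h k) a M ha1 hal hf hf0 hW hfB hn hn1
    set l := Nat.lcm h k with hl
    have hl0 : 0 < l := lt_of_lt_of_le ha1 hal
    have : ∑ m ∈ Finset.Icc 1 M, (if h ∣ m ∧ (k:ℤ) ∣ (m:ℤ) + r then f m else 0)
        = ∑ j ∈ Finset.range M, f (a + j * l) := by
      rw [← Finset.sum_filter]
      have hinj : Set.InjOn (fun j : ℕ => a + j * l) (Finset.range M) := by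
        intro i _ j _ hij
        simp only at hij
        exact Nat.eq_of_mul_eq_mul_right hl0 (by omega)
      have e1 : ∑ j ∈ Finset.range M, f (a + j * l) = ∑ m ∈ (Finset.range M).image (fun j : ℕ => a + j * l), f m := by
        rw [Finset.sum_image hinj]
        refine Finset.sum_congr rfl fun j _ => ?_
        push_cast; rfl
      rw [e1]
      apply Finset.sum_subset
      · intro m hm
        rw [Finset.mem_filter, hiff, Finset.mem_Icc] at hm
        rw [Finset.mem_image]
        obtain ⟨⟨h1, h2⟩, h3⟩ := hm
        -- a ≤ m
        have ham : a ≤ m := by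
          by_contra hlt
          push Not at hlt
          have hd := (Nat.modEq_iff_dvd' hlt.le).1 h3
          have := Nat.le_of_dvd (by omega) hd
          omega
        obtain ⟨j, hj⟩ := (Nat.modEq_iff_dvd' ham).1 h3.symm
        refine ⟨j, ?_, ?_⟩
        · rw [Finset.mem_range]
          have : j ≤ l * j := Nat.le_mul_of_pos_left j hl0
          omega
        · rw [mul_comm]; omega
      · intro m hm hm'
        rw [Finset.mem_image] at hm
        obtain ⟨j, _, rfl⟩ := hm
        apply hfB
        by_contra hle
        push Not at hle
        apply hm'
        rw [Finset.mem_filter, hiff, Finset.mem_Icc]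
        refine ⟨⟨by omega, ?_⟩, ?_⟩
        · have := hle.trans hn
          exact_mod_cast this
        · simp [Nat.ModEq]
    rw [this]; exact key
  · rw [Finset.sum_eq_zero]
    · simpa using hW0
    · intro m _
      rw [if_neg]
      rintro ⟨a, b⟩
      apply hr
      have h1 : ((Nat.gcd h k : ℕ) : ℤ) ∣ m := Int.natCast_dvd_natCast.2 ((Nat.gcd_dvd_left h k).trans a)
      have h2 : ((Nat.gcd h k : ℕ) : ℤ) ∣ (m:ℤ) + r := (Int.natCast_dvd_natCast.2 (Nat.gcd_dvd_right h k)).trans b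
      exact (dvd_add_right h1).1 h2

end ZD
end

section
namespace ZD

lemma RS_c (w : ℝ → ℝ) (B W : ℝ) (hB : 0 ≤ B) (h k M : ℕ) (hh : 1 ≤ h) (hk : 1 ≤ k) (r : ℤ) (b e : ℝ)
    (hf : AntitoneOn w (Ici 0)) (hf0 : ∀ u, 0 ≤ u → 0 ≤ w u) (hW : w 0 ≤ W)
    (hfB : ∀ u, B < u → w u = 0) (hn : B ≤ M) (hn1 : 1 ≤ M) :
    IntervalIntegrable (fun u => if b ≤ e * u then w u else 0) volume 0 B ∧
    |∑ m ∈ Finset.Icc 1 M, (if h ∣ m ∧ (k:ℤ) ∣ (m:ℤ) + r then (if b ≤ e * (m:ℝ) then w m else 0) else 0)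
      - (if ((Nat.gcd h k : ℕ) : ℤ) ∣ r then (1 / ((Nat.lcm h k : ℕ):ℝ)) * ∫ u in (0:ℝ)..B, (if b ≤ e * u then w u else 0) else 0)| ≤ 2 * W := by
  have hW0 : 0 ≤ W := (hf0 0 le_rfl).trans hW
  have hIntg : ∀ f : ℝ → ℝ, AntitoneOn f (Ici 0) → IntervalIntegrable f volume 0 B := by
    intro f hf
    apply AntitoneOn.intervalIntegrable
    exact hf.mono (fun z hz => le_trans (le_min le_rfl hB) hz.1)
  rcases le_or_gt e 0 with he | he
  · have hanti : AntitoneOn (fun u => if b ≤ e * u then w u else 0) (Ici 0) := by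
      intro s hs t ht hst
      simp only [mem_Ici] at hs ht
      simp only
      split_ifs with h1 h2 h2
      · exact hf hs ht hst
      · exact absurd (h1.trans (mul_le_mul_of_nonpos_left hst he)) h2
      · exact hf0 s hs
      · exact le_rfl
    refine ⟨hIntg _ hanti, ?_⟩
    refine (RS_anti (fun u => if b ≤ e * u then w u else 0) B W hB h k M hh hk r hanti ?_ ?_ ?_ hn hn1).trans (by linarith)
    · intro u hu; split_ifs; exacts [hf0 u hu, le_rfl]
    · split_ifs; exacts [hW, hW0]
    · intro u hu; rw [hfB u hu]; simp
  · have hanti : AntitoneOn (fun u => if b ≤ e * u then 0 else w u) (Ici 0) := by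
      intro s hs t ht hst
      simp only [mem_Ici] at hs ht
      simp only
      split_ifs with h1 h2 h2
      · exact le_rfl
      · exact hf0 s hs
      · exact absurd (h2.trans (mul_le_mul_of_nonneg_left hst he.le)) h1
      · exact hf hs ht hst
    have h1 := RS_anti w B W hB h k M hh hk r hf hf0 hW hfB hn hn1
    have h2 := RS_anti (fun u => if b ≤ e * u then 0 else w u) B W hB h k M hh hk r hanti
      (by intro u hu; split_ifs; exacts [le_rfl, hf0 u hu])
      (by split_ifs; exacts [hW0, hW])
      (by intro u hu; rw [hfB u hu]; simp) hn hn1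
    have efun : (fun u => if b ≤ e * u then w u else 0) = fun u => w u - (if b ≤ e * u then 0 else w u) := by
      funext u; split_ifs <;> simp
    refine ⟨?_, ?_⟩
    · rw [efun]; exact (hIntg _ hf).sub (hIntg _ hanti)
    have e1 : ∑ m ∈ Finset.Icc 1 M, (if h ∣ m ∧ (k:ℤ) ∣ (m:ℤ) + r then (if b ≤ e * (m:ℝ) then w m else 0) else 0)
        = ∑ m ∈ Finset.Icc 1 M, (if h ∣ m ∧ (k:ℤ) ∣ (m:ℤ) + r then w m else 0)
          - ∑ m ∈ Finset.Icc 1 M, (if h ∣ m ∧ (k:ℤ) ∣ (m:ℤ) + r then (if b ≤ e * (m:ℝ) then 0 else w m) else 0) := by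
      rw [← Finset.sum_sub_distrib]
      refine Finset.sum_congr rfl fun m _ => ?_
      split_ifs <;> simp
    have e2 : ∫ u in (0:ℝ)..B, (if b ≤ e * u then w u else 0) = (∫ u in (0:ℝ)..B, w u) -
        ∫ u in (0:ℝ)..B, (if b ≤ e * u then 0 else w u) := by
      rw [efun]; exact intervalIntegral.integral_sub (hIntg _ hf) (hIntg _ hanti)
    rw [e1, e2]
    have := (abs_sub _ _).trans (add_le_add h1 h2)
    refine le_trans (le_of_eq ?_) (this.trans (by linarith))
    congr 1
    split_ifs <;> ring

noncomputable def GG (η v : ℝ) (r : ℤ) (u : ℝ) : ℝ :=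
  (if v * r ≤ (1 + 2 * η - v) * u then 1 else 0) - 2 * (if v * r ≤ (1 + η - v) * u then 1 else 0)
    + (if v * r ≤ (1 - v) * u then 1 else 0)

noncomputable def gg (η v : ℝ) : ℝ :=
  (if v ≤ 1 + 2 * η then 1 else 0) - 2 * (if v ≤ 1 + η then 1 else 0) + (if v ≤ 1 then 1 else 0)

lemma RS_G (η v : ℝ) (w : ℝ → ℝ) (B W : ℝ) (hB : 0 ≤ B) (h k M : ℕ) (hh : 1 ≤ h) (hk : 1 ≤ k) (r : ℤ)
    (hf : AntitoneOn w (Ici 0)) (hf0 : ∀ u, 0 ≤ u → 0 ≤ w u) (hW : w 0 ≤ W)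
    (hfB : ∀ u, B < u → w u = 0) (hn : B ≤ M) (hn1 : 1 ≤ M) :
    IntervalIntegrable (fun u => GG η v r u * w u) volume 0 B ∧
    |∑ m ∈ Finset.Icc 1 M, (if h ∣ m ∧ (k:ℤ) ∣ (m:ℤ) + r then GG η v r m * w m else 0)
      - (if ((Nat.gcd h k : ℕ) : ℤ) ∣ r then (1 / ((Nat.lcm h k : ℕ):ℝ)) * ∫ u in (0:ℝ)..B, GG η v r u * w u else 0)| ≤ 8 * W := by
  obtain ⟨i1, h1⟩ := RS_c w B W hB h k M hh hk r (v * r) (1 + 2 * η - v) hf hf0 hW hfB hn hn1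
  obtain ⟨i2, h2⟩ := RS_c w B W hB h k M hh hk r (v * r) (1 + η - v) hf hf0 hW hfB hn hn1
  obtain ⟨i3, h3⟩ := RS_c w B W hB h k M hh hk r (v * r) (1 - v) hf hf0 hW hfB hn hn1
  have efun : (fun u => GG η v r u * w u) = fun u => ((if v * r ≤ (1 + 2 * η - v) * u then w u else 0)
      - 2 * (if v * r ≤ (1 + η - v) * u then w u else 0)) + (if v * r ≤ (1 - v) * u then w u else 0) := by
    funext u; unfold GG; split_ifs <;> ring
  refine ⟨?_, ?_⟩
  · rw [efun]; exact (i1.sub (i2.const_mul 2)).add i3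
  have e2 : ∫ u in (0:ℝ)..B, GG η v r u * w u = (∫ u in (0:ℝ)..B, (if v * r ≤ (1 + 2 * η - v) * u then w u else 0))
     - 2 * (∫ u in (0:ℝ)..B, (if v * r ≤ (1 + η - v) * u then w u else 0)) + ∫ u in (0:ℝ)..B, (if v * r ≤ (1 - v) * u then w u else 0) := by
    rw [efun, intervalIntegral.integral_add (i1.sub (i2.const_mul 2)) i3, intervalIntegral.integral_sub i1 (i2.const_mul 2),
      intervalIntegral.integral_const_mul]
  have e1 : ∑ m ∈ Finset.Icc 1 M, (if h ∣ m ∧ (k:ℤ) ∣ (m:ℤ) + r then GG η v r m * w m else 0)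
      = ∑ m ∈ Finset.Icc 1 M, (if h ∣ m ∧ (k:ℤ) ∣ (m:ℤ) + r then (if v * r ≤ (1 + 2 * η - v) * (m:ℝ) then w m else 0) else 0)
        - 2 * ∑ m ∈ Finset.Icc 1 M, (if h ∣ m ∧ (k:ℤ) ∣ (m:ℤ) + r then (if v * r ≤ (1 + η - v) * (m:ℝ) then w m else 0) else 0)
        + ∑ m ∈ Finset.Icc 1 M, (if h ∣ m ∧ (k:ℤ) ∣ (m:ℤ) + r then (if v * r ≤ (1 - v) * (m:ℝ) then w m else 0) else 0) := by
    rw [Finset.mul_sum, ← Finset.sum_sub_distrib, ← Finset.sum_add_distrib]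
    refine Finset.sum_congr rfl fun m _ => ?_
    rw [show GG η v r (m:ℝ) * w m = _ from congrFun efun (m:ℝ)]
    by_cases hc : h ∣ m ∧ (k:ℤ) ∣ (m:ℤ) + r
    · simp only [if_pos hc]
    · simp only [if_neg hc]; ring
  rw [e1, e2]
  rw [abs_le] at *
  by_cases hd : ((Nat.gcd h k : ℕ) : ℤ) ∣ r
  · simp only [if_pos hd] at *
    constructor <;> nlinarith [h1.1, h1.2, h2.1, h2.2, h3.1, h3.2]
  · simp only [if_neg hd] at *
    constructor <;> linarith [h1.1, h1.2, h2.1, h2.2, h3.1, h3.2]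

lemma GG_eq_gg (η v : ℝ) (n m : ℕ) (hm : 1 ≤ m) : GG η v ((n:ℤ) - m) m = gg η (n * v / m) := by
  have hm0 : (0:ℝ) < m := by exact_mod_cast hm
  have : ∀ c : ℝ, v * (((n:ℤ) - (m:ℤ) : ℤ) : ℝ) ≤ (c - v) * m ↔ n * v / m ≤ c := by
    intro c
    rw [div_le_iff₀ hm0]
    push_cast
    constructor <;> intro h <;> linarith
  unfold GG gg
  simp only [this]

lemma GG_ne_zero {η v : ℝ} (hη : 0 ≤ η) {r : ℤ} {u : ℝ} (hu : 0 ≤ u) (h : GG η v r u ≠ 0) :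
    (1 - v) * u < v * r ∧ v * r ≤ (1 + 2 * η - v) * u := by
  by_contra hc
  apply h
  unfold GG
  rw [not_and_or, not_lt, not_le] at hc
  have hm : 0 ≤ η * u := mul_nonneg hη hu
  rcases hc with hc | hc
  · rw [if_pos (by nlinarith), if_pos (by nlinarith), if_pos hc]; ring
  · rw [if_neg (by linarith), if_neg (by nlinarith), if_neg (by nlinarith)]; ring

/-- reindexing `n = m + r` -/
lemma reindex (η v x1 : ℝ) (hη : 0 < η) (hv1 : 1 ≤ v) (hv2 : v ≤ 1 + 2 * η) (R M m k : ℕ) (hm : 1 ≤ m)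
    (hmx : (m:ℝ) ≤ v * x1) (hR : 2 * η * x1 ≤ R) (hM : (1 + 2 * η) * x1 ≤ M) :
    ∑ n ∈ Finset.Icc 1 M, (if k ∣ n then gg η (n * v / m) else 0)
      = ∑ r ∈ Finset.Icc (-(R:ℤ)) R, (if (k:ℤ) ∣ (m:ℤ) + r then GG η v r m else 0) := by
  have hm0 : (0:ℝ) < m := by exact_mod_cast hm
  have hv0 : 0 < v := by linarith
  set φ : ℤ → ℝ := fun j => if (k:ℤ) ∣ j then GG η v (j - m) m else 0 with hφ
  have hsupp : ∀ j : ℤ, φ j ≠ 0 → (1 ≤ j ∧ j ≤ M) ∧ (m - R ≤ j ∧ j ≤ m + R) := by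
    intro j hj
    have hG : GG η v (j - m) m ≠ 0 := by
      intro h0; apply hj; simp only [hφ, h0, ite_self]
    obtain ⟨h1, h2⟩ := GG_ne_zero hη.le hm0.le hG
    push_cast at h1 h2
    have hmx' : (m:ℝ) / v ≤ x1 := by rw [div_le_iff₀ hv0]; linarith
    have a1 : (m:ℝ) / v < j := by rw [div_lt_iff₀ hv0]; nlinarith
    have a2 : (j:ℝ) ≤ (1 + 2 * η) * (m / v) := by
      rw [← mul_div_assoc, le_div_iff₀ hv0]; nlinarith
    have a0 : 0 < (m:ℝ) / v := by positivity
    have a3 : (m:ℝ) = v * (m / v) := by field_simp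
    refine ⟨⟨?_, ?_⟩, ?_, ?_⟩
    · have : (0:ℝ) < j := by linarith
      have : (0:ℤ) < j := by exact_mod_cast this
      omega
    · have : (j:ℝ) ≤ M := a2.trans (le_trans (by gcongr) hM)
      exact_mod_cast this
    · have : (m:ℝ) - R ≤ j := by nlinarith
      exact_mod_cast this
    · have : (j:ℝ) ≤ m + R := by nlinarith
      exact_mod_cast this
  have e1 : ∑ n ∈ Finset.Icc 1 M, (if k ∣ n then gg η (n * v / m) else 0) = ∑ j ∈ Finset.Icc (1:ℤ) M, φ j := by
    refine Finset.sum_bij (fun n _ => (n:ℤ)) ?_ ?_ ?_ ?_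
    · intro n hn; simp only [Finset.mem_Icc] at *; omega
    · intro a _ b _ hab; exact_mod_cast hab
    · intro j hj
      rw [Finset.mem_Icc] at hj
      exact ⟨j.toNat, by rw [Finset.mem_Icc]; omega, by omega⟩
    · intro n _
      simp only [hφ, Int.natCast_dvd_natCast, GG_eq_gg η v n m hm]
  have e2 : ∑ r ∈ Finset.Icc (-(R:ℤ)) R, (if (k:ℤ) ∣ (m:ℤ) + r then GG η v r m else 0)
      = ∑ j ∈ Finset.Icc ((m:ℤ) - R) (m + R), φ j := by
    refine Finset.sum_bij (fun r _ => (m:ℤ) + r) ?_ ?_ ?_ ?_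
    · intro n hn; simp only [Finset.mem_Icc] at *; omega
    · intro a _ b _ hab; simpa using hab
    · intro j hj
      rw [Finset.mem_Icc] at hj
      exact ⟨j - m, by rw [Finset.mem_Icc]; omega, by omega⟩
    · intro r _
      simp only [hφ, add_sub_cancel_left]
  rw [e1, e2]
  have e3 : ∀ s t : Finset ℤ, (∀ j, φ j ≠ 0 → j ∈ s ∧ j ∈ t) → ∑ j ∈ s, φ j = ∑ j ∈ t, φ j := by
    intro s t hst
    rw [← Finset.sum_filter_ne_zero s, ← Finset.sum_filter_ne_zero t]
    refine Finset.sum_congr ?_ fun _ _ => rfl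
    ext j
    simp only [Finset.mem_filter]
    constructor
    · rintro ⟨_, h⟩; exact ⟨(hst j h).2, h⟩
    · rintro ⟨_, h⟩; exact ⟨(hst j h).1, h⟩
  apply e3
  intro j hj
  simp only [Finset.mem_Icc]
  exact hsupp j hj

/-- sum over multiples of `d` of the second difference is at most one -/
lemma sum_GG_le (η v x1 u : ℝ) (hη : 0 < η) (hv1 : 1 ≤ v) (hv2 : v ≤ 1 + 2 * η) (R d : ℕ) (hd : 1 ≤ d)
    (hu0 : 0 ≤ u) (hux : u ≤ v * x1) (hR : 2 * η * x1 ≤ R) :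
    |∑ r ∈ Finset.Icc (-(R:ℤ)) R, (if (d:ℤ) ∣ r then GG η v r u else 0)| ≤ 1 := by
  have hv0 : 0 < v := by linarith
  have hd0 : (0:ℝ) < d := by exact_mod_cast hd
  set A := (1 - v) * (u / v) with hA
  set δ := η * (u / v) with hδ
  have huv : u / v ≤ x1 := by rw [div_le_iff₀ hv0]; linarith
  have huv0 : 0 ≤ u / v := by positivity
  have hcount : ∀ t : ℝ, -(R:ℝ) ≤ t → t ≤ R →
      ∑ r ∈ Finset.Icc (-(R:ℤ)) R, (if (d:ℤ) ∣ r then (if (r:ℝ) ≤ t then (1:ℝ) else 0) else 0)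
        = (⌊t / d⌋ : ℝ) - ⌊((-(R:ℤ) - 1 : ℤ) : ℝ) / d⌋ := by
    intro t ht1 ht2
    have hf1 : ⌊t⌋ ≤ R := by
      have : ⌊t⌋ ≤ ⌊((R:ℤ):ℝ)⌋ := Int.floor_le_floor (by simpa using ht2)
      simpa using this
    have hf2 : -(R:ℤ) ≤ ⌊t⌋ := by rw [Int.le_floor]; push_cast; exact ht1
    rw [← Finset.sum_filter, ← Finset.sum_filter, Finset.filter_filter]
    have hset : (Finset.Icc (-(R:ℤ)) R).filter (fun r => (d:ℤ) ∣ r ∧ (r:ℝ) ≤ t)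
        = (Finset.Ioc (-(R:ℤ) - 1) ⌊t⌋).filter (fun r => (d:ℤ) ∣ r) := by
      ext r
      simp only [Finset.mem_filter, Finset.mem_Icc, Finset.mem_Ioc, Int.le_floor]
      constructor
      · rintro ⟨⟨a, b⟩, c, e⟩; exact ⟨⟨by omega, e⟩, c⟩
      · rintro ⟨⟨a, b⟩, c⟩
        have : r ≤ ⌊t⌋ := Int.le_floor.2 b
        exact ⟨⟨by omega, by omega⟩, c, b⟩
    rw [hset, Finset.sum_const, nsmul_eq_mul, mul_one]
    have := Int.Ioc_filter_dvd_card (-(R:ℤ) - 1) ⌊t⌋ (r := (d:ℤ)) (by exact_mod_cast hd)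
    have hdiv : ⌊t⌋ / (d:ℤ) = ⌊t / d⌋ := (Int.floor_div_natCast t d).symm
    have hdiv2 : (-(R:ℤ) - 1) / (d:ℤ) = ⌊((-(R:ℤ) - 1 : ℤ) : ℝ) / d⌋ := by
      rw [Int.floor_div_natCast, Int.floor_intCast]
    have hle : (-(R:ℤ) - 1) / (d:ℤ) ≤ ⌊t⌋ / (d:ℤ) := Int.ediv_le_ediv (by exact_mod_cast hd) (by omega)
    have q1 : ⌊((⌊t⌋ : ℤ) : ℚ) / ((d:ℤ):ℚ)⌋ = ⌊t⌋ / (d:ℤ) := by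
      rw [Int.cast_natCast, Int.floor_div_natCast, Int.floor_intCast]
    have q2 : ⌊((-(R:ℤ) - 1 : ℤ) : ℚ) / ((d:ℤ):ℚ)⌋ = (-(R:ℤ) - 1) / (d:ℤ) := by
      rw [Int.cast_natCast, Int.floor_div_natCast, Int.floor_intCast]
    rw [q1, q2, max_eq_left (by linarith), hdiv, hdiv2] at this
    exact_mod_cast this
  have hsplit : ∑ r ∈ Finset.Icc (-(R:ℤ)) R, (if (d:ℤ) ∣ r then GG η v r u else 0)
      = ∑ r ∈ Finset.Icc (-(R:ℤ)) R, (if (d:ℤ) ∣ r then (if (r:ℝ) ≤ A + 2 * δ then (1:ℝ) else 0) else 0)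
        - 2 * ∑ r ∈ Finset.Icc (-(R:ℤ)) R, (if (d:ℤ) ∣ r then (if (r:ℝ) ≤ A + δ then (1:ℝ) else 0) else 0)
        + ∑ r ∈ Finset.Icc (-(R:ℤ)) R, (if (d:ℤ) ∣ r then (if (r:ℝ) ≤ A then (1:ℝ) else 0) else 0) := by
    rw [Finset.mul_sum, ← Finset.sum_sub_distrib, ← Finset.sum_add_distrib]
    refine Finset.sum_congr rfl fun r _ => ?_
    have hu' : u = v * (u / v) := by field_simp
    have c1 : v * r ≤ (1 + 2 * η - v) * u ↔ (r:ℝ) ≤ A + 2 * δ := by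
      have e : (1 + 2 * η - v) * u = v * (A + 2 * δ) := by rw [hA, hδ]; field_simp; ring
      rw [e]; exact mul_le_mul_iff_right₀ hv0
    have c2 : v * r ≤ (1 + η - v) * u ↔ (r:ℝ) ≤ A + δ := by
      have e : (1 + η - v) * u = v * (A + δ) := by rw [hA, hδ]; field_simp; ring
      rw [e]; exact mul_le_mul_iff_right₀ hv0
    have c3 : v * r ≤ (1 - v) * u ↔ (r:ℝ) ≤ A := by
      have e : (1 - v) * u = v * A := by rw [hA]; field_simp
      rw [e]; exact mul_le_mul_iff_right₀ hv0
    unfold GG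
    simp only [c1, c2, c3]
    split_ifs <;> ring
  have hA1 : -(2 * η * x1) ≤ A := by rw [hA]; nlinarith
  have hδ0 : 0 ≤ δ := by rw [hδ]; positivity
  have hδ1 : δ ≤ η * x1 := by rw [hδ]; gcongr
  have hA0 : A ≤ 0 := by rw [hA]; nlinarith
  rw [hsplit, hcount _ (by linarith) (by linarith), hcount _ (by linarith) (by linarith), hcount _ (by linarith) (by linarith)]
  have f1 := Int.floor_le ((A + 2 * δ) / d)
  have f1' := Int.lt_floor_add_one ((A + 2 * δ) / d)
  have f2 := Int.floor_le ((A + δ) / d)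
  have f2' := Int.lt_floor_add_one ((A + δ) / d)
  have f3 := Int.floor_le (A / d)
  have f3' := Int.lt_floor_add_one (A / d)
  set p := ⌊(A + 2 * δ) / d⌋
  set q := ⌊(A + δ) / d⌋
  set s := ⌊A / d⌋
  have hlin : (A + 2 * δ) / d - 2 * ((A + δ) / d) + A / d = 0 := by field_simp; ring
  have g1 : ((p - 2 * q + s : ℤ) : ℝ) < 2 := by push_cast; linarith
  have g2 : (-2:ℝ) < ((p - 2 * q + s : ℤ) : ℝ) := by push_cast; linarith
  have g1' : p - 2 * q + s < 2 := by exact_mod_cast g1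
  have g2' : -2 < p - 2 * q + s := by exact_mod_cast g2
  have g3 : |p - 2 * q + s| ≤ 1 := by rw [abs_le]; omega
  have g4 : |((p - 2 * q + s : ℤ) : ℝ)| ≤ 1 := by exact_mod_cast g3
  refine le_trans (le_of_eq ?_) g4
  congr 1
  push_cast; ring

end ZD
end

section
namespace ZD

noncomputable def om (x0 x1 x : ℝ) : ℝ := if x ≤ x1 then 1 / max x x0 else 0

lemma om_nonneg {x0 : ℝ} (h0 : 0 < x0) (x1 x : ℝ) : 0 ≤ om x0 x1 x := by
  unfold om; split_ifs
  · have : 0 < max x x0 := lt_max_of_lt_right h0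
    positivity
  · exact le_rfl

lemma om_anti {x0 : ℝ} (h0 : 0 < x0) (x1 : ℝ) : Antitone (om x0 x1) := by
  intro s t hst
  by_cases ht : t ≤ x1
  · have hs : s ≤ x1 := hst.trans ht
    unfold om
    rw [if_pos ht, if_pos hs]
    have : 0 < max s x0 := lt_max_of_lt_right h0
    exact one_div_le_one_div_of_le this (max_le_max_right _ hst)
  · have : om x0 x1 t = 0 := by unfold om; rw [if_neg ht]
    rw [this]; exact om_nonneg h0 _ _

lemma om_le {x0 : ℝ} (h0 : 0 < x0) (x1 x : ℝ) : om x0 x1 x ≤ 1 / x0 := by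
  unfold om; split_ifs
  · exact one_div_le_one_div_of_le h0 (le_max_right _ _)
  · positivity

lemma int_om {x0 x1 v : ℝ} (h0 : 0 < x0) (h1 : x0 ≤ x1) (hv : 0 < v) :
    ∫ u in (0:ℝ)..(v * x1), om x0 x1 (u / v) ≤ v * (1 + Real.log (x1 / x0)) := by
  have hIntg : ∀ a b : ℝ, IntervalIntegrable (om x0 x1) volume a b := fun a b => (om_anti h0 x1).intervalIntegrable
  rw [intervalIntegral.integral_comp_div (om x0 x1) hv.ne', smul_eq_mul, zero_div, mul_div_cancel_left₀ _ hv.ne']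
  apply mul_le_mul_of_nonneg_left _ hv.le
  rw [← intervalIntegral.integral_add_adjacent_intervals (hIntg 0 x0) (hIntg x0 x1)]
  apply add_le_add
  · have := intervalIntegral.integral_mono_on (g := fun _ => 1 / x0) h0.le (hIntg 0 x0) (by simp) (fun x _ => om_le h0 x1 x)
    refine this.trans (le_of_eq ?_)
    rw [intervalIntegral.integral_const]; simp [h0.ne']
  · rw [← integral_one_div_of_pos h0 (h0.trans_le h1)]
    refine intervalIntegral.integral_mono_on h1 (hIntg x0 x1) ?_ ?_
    · apply ContinuousOn.intervalIntegrable
      rw [uIcc_of_le h1]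
      exact continuousOn_const.div continuousOn_id (fun x hx => (h0.trans_le hx.1).ne')
    · intro x hx
      unfold om
      rw [if_pos hx.2, max_eq_left hx.1]

noncomputable def Qhk (η v x0 x1 : ℝ) (M h k : ℕ) : ℝ :=
  ∑ m ∈ Finset.Icc 1 M, ∑ n ∈ Finset.Icc 1 M,
    (if h ∣ m then 1 else 0) * (if k ∣ n then 1 else 0) * (gg η (n * v / m) * om x0 x1 (m / v))

noncomputable def Dd (η v x0 x1 : ℝ) (R d : ℕ) : ℝ :=
  ∑ r ∈ Finset.Icc (-(R:ℤ)) R, if (d:ℤ) ∣ r then ∫ u in (0:ℝ)..(v * x1), GG η v r u * om x0 x1 (u / v) else 0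

lemma Qhk_bound (η v x0 x1 : ℝ) (hη : 0 < η) (hv1 : 1 ≤ v) (hv2 : v ≤ 1 + 2 * η) (h0 : 0 < x0) (h1 : x0 ≤ x1)
    (R M h k : ℕ) (hh : 1 ≤ h) (hk : 1 ≤ k) (hR : 2 * η * x1 ≤ R) (hM : (1 + 2 * η) * x1 ≤ M) (hM1 : 1 ≤ M) :
    |Qhk η v x0 x1 M h k - 1 / ((Nat.lcm h k : ℕ):ℝ) * Dd η v x0 x1 R (Nat.gcd h k)| ≤ (2 * R + 1) * (8 / x0) := by
  have hv0 : 0 < v := by linarith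
  have hB : 0 ≤ v * x1 := by nlinarith
  have hBM : v * x1 ≤ M := le_trans (by gcongr; linarith) hM
  have hanti : AntitoneOn (fun u => om x0 x1 (u / v)) (Ici 0) := by
    intro s _ t _ hst
    exact om_anti h0 x1 (by gcongr)
  have hz : ∀ u, v * x1 < u → om x0 x1 (u / v) = 0 := by
    intro u hu
    unfold om; rw [if_neg]
    rw [not_le, lt_div_iff₀ hv0]; linarith
  have key := fun r : ℤ => (RS_G η v (fun u => om x0 x1 (u / v)) (v * x1) (1 / x0) hB h k M hh hk r hanti
    (fun u _ => om_nonneg h0 _ _) (om_le h0 _ _) hz hBM hM1).2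
  have e : Qhk η v x0 x1 M h k = ∑ r ∈ Finset.Icc (-(R:ℤ)) R,
      ∑ m ∈ Finset.Icc 1 M, (if h ∣ m ∧ (k:ℤ) ∣ (m:ℤ) + r then GG η v r m * om x0 x1 (m / v) else 0) := by
    rw [Finset.sum_comm]
    unfold Qhk
    refine Finset.sum_congr rfl fun m hm => ?_
    rw [Finset.mem_Icc] at hm
    by_cases hmx : (m:ℝ) ≤ v * x1
    · have := reindex η v x1 hη hv1 hv2 R M m k hm.1 hmx hR hM
      have e1 : ∑ n ∈ Finset.Icc 1 M, (if h ∣ m then (1:ℝ) else 0) * (if k ∣ n then 1 else 0) * (gg η (n * v / m) * om x0 x1 (m / v))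
        = (if h ∣ m then 1 else 0) * om x0 x1 (m / v) * ∑ n ∈ Finset.Icc 1 M, (if k ∣ n then gg η (n * v / m) else 0) := by
        rw [Finset.mul_sum]
        refine Finset.sum_congr rfl fun n _ => ?_
        by_cases hkn : k ∣ n
        · simp only [if_pos hkn]; ring
        · simp only [if_neg hkn]; ring
      rw [e1, this, Finset.mul_sum]
      refine Finset.sum_congr rfl fun r _ => ?_
      by_cases a : h ∣ m <;> by_cases b : (k:ℤ) ∣ (m:ℤ) + r <;> simp [a, b] ; ring
    · push Not at hmx
      rw [hz m hmx]; simp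
  have e2 : 1 / ((Nat.lcm h k : ℕ):ℝ) * Dd η v x0 x1 R (Nat.gcd h k) = ∑ r ∈ Finset.Icc (-(R:ℤ)) R,
      (if ((Nat.gcd h k : ℕ) : ℤ) ∣ r then (1 / ((Nat.lcm h k : ℕ):ℝ)) * ∫ u in (0:ℝ)..(v * x1), GG η v r u * om x0 x1 (u / v) else 0) := by
    unfold Dd
    rw [Finset.mul_sum]
    refine Finset.sum_congr rfl fun r _ => ?_
    split_ifs <;> simp
  rw [e, e2, ← Finset.sum_sub_distrib]
  refine (Finset.abs_sum_le_sum_abs _ _).trans ?_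
  refine (Finset.sum_le_sum fun r _ => key r).trans ?_
  rw [Finset.sum_const, Int.card_Icc, nsmul_eq_mul]
  have : (((R:ℤ) + 1 - -(R:ℤ)).toNat : ℝ) = 2 * R + 1 := by
    have : ((R:ℤ) + 1 - -(R:ℤ)).toNat = 2 * R + 1 := by omega
    rw [this]; push_cast; ring
  rw [this]
  apply le_of_eq; ring

lemma Dd_bound (η v x0 x1 : ℝ) (hη : 0 < η) (hv1 : 1 ≤ v) (hv2 : v ≤ 1 + 2 * η) (h0 : 0 < x0) (h1 : x0 ≤ x1)
    (R d : ℕ) (hd : 1 ≤ d) (hR : 2 * η * x1 ≤ R) :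
    |Dd η v x0 x1 R d| ≤ v * (1 + Real.log (x1 / x0)) := by
  have hv0 : 0 < v := by linarith
  have hB : 0 ≤ v * x1 := by nlinarith
  have hanti : Antitone (fun u => om x0 x1 (u / v)) := by
    intro s t hst
    exact om_anti h0 x1 (by gcongr)
  have hz : ∀ u, v * x1 < u → om x0 x1 (u / v) = 0 := by
    intro u hu
    unfold om; rw [if_neg]
    rw [not_le, lt_div_iff₀ hv0]; linarith
  obtain ⟨M, hM⟩ := exists_nat_ge (v * x1 + 1)
  have hM1 : 1 ≤ M := by
    have : (1:ℝ) ≤ M := by linarith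
    exact_mod_cast this
  have hi := fun r : ℤ => (RS_G η v (fun u => om x0 x1 (u / v)) (v * x1) (1 / x0) hB 1 1 M le_rfl le_rfl r (hanti.antitoneOn _)
    (fun u _ => om_nonneg h0 _ _) (om_le h0 _ _) hz (by linarith) hM1).1
  have e : Dd η v x0 x1 R d = ∫ u in (0:ℝ)..(v * x1),
      (∑ r ∈ Finset.Icc (-(R:ℤ)) R, if (d:ℤ) ∣ r then GG η v r u else 0) * om x0 x1 (u / v) := by
    have : ∀ u, (∑ r ∈ Finset.Icc (-(R:ℤ)) R, if (d:ℤ) ∣ r then GG η v r u else 0) * om x0 x1 (u / v)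
        = ∑ r ∈ Finset.Icc (-(R:ℤ)) R, (if (d:ℤ) ∣ r then 1 else 0) * (GG η v r u * om x0 x1 (u / v)) := by
      intro u; rw [Finset.sum_mul]
      refine Finset.sum_congr rfl fun r _ => ?_
      split_ifs <;> ring
    simp only [this]
    rw [intervalIntegral.integral_finsetSum (fun r _ => (hi r).const_mul _)]
    unfold Dd
    refine Finset.sum_congr rfl fun r _ => ?_
    rw [intervalIntegral.integral_const_mul]
    split_ifs <;> ring
  rw [e]
  refine le_trans ?_ (int_om h0 h1 hv0)
  rw [← Real.norm_eq_abs]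
  refine intervalIntegral.norm_integral_le_of_norm_le hB ?_ hanti.intervalIntegrable
  refine Filter.Eventually.of_forall fun u hu => ?_
  rw [norm_mul, Real.norm_eq_abs, Real.norm_eq_abs, abs_of_nonneg (om_nonneg h0 _ _)]
  have := sum_GG_le η v x1 u hη hv1 hv2 R d hd hu.1.le hu.2 hR
  calc _ ≤ 1 * om x0 x1 (u / v) := by
        apply mul_le_mul_of_nonneg_right this (om_nonneg h0 _ _)
    _ = _ := one_mul _

noncomputable def QQ (L η v x0 x1 : ℝ) (M : ℕ) : ℝ :=
  ∑ m ∈ Finset.Icc 1 M, ∑ n ∈ Finset.Icc 1 M, an L m * an L n * (gg η (n * v / m) * om x0 x1 (m / v))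

lemma an_ind (L : ℝ) (n : ℕ) : an L n = ∑ h ∈ Finset.Icc 1 (NN L), lam L h * (if h ∣ n then 1 else 0) := by
  unfold an
  rw [Finset.sum_filter]
  refine Finset.sum_congr rfl fun h _ => ?_
  split_ifs <;> simp

lemma QQ_eq (L η v x0 x1 : ℝ) (M : ℕ) : QQ L η v x0 x1 M =
    ∑ h ∈ Finset.Icc 1 (NN L), ∑ k ∈ Finset.Icc 1 (NN L), lam L h * lam L k * Qhk η v x0 x1 M h k := by
  have : ∀ m n : ℕ, an L m * an L n * (gg η (n * v / m) * om x0 x1 (m / v)) =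
      ∑ h ∈ Finset.Icc 1 (NN L), ∑ k ∈ Finset.Icc 1 (NN L), lam L h * lam L k *
        ((if h ∣ m then 1 else 0) * (if k ∣ n then 1 else 0) * (gg η (n * v / m) * om x0 x1 (m / v))) := by
    intro m n
    rw [an_ind, an_ind, Finset.sum_mul_sum, Finset.sum_mul]
    refine Finset.sum_congr rfl fun h _ => ?_
    rw [Finset.sum_mul]
    refine Finset.sum_congr rfl fun k _ => ?_
    ring
  unfold QQ
  simp only [this]
  calc _ = ∑ m ∈ Finset.Icc 1 M, ∑ h ∈ Finset.Icc 1 (NN L), ∑ n ∈ Finset.Icc 1 M,  ∑ k ∈ Finset.Icc 1 (NN L), lam L h * lam L k *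
        ((if h ∣ m then 1 else 0) * (if k ∣ n then 1 else 0) * (gg η (n * v / m) * om x0 x1 (m / v))) := by
        refine Finset.sum_congr rfl fun m _ => Finset.sum_comm
    _ = ∑ h ∈ Finset.Icc 1 (NN L), ∑ m ∈ Finset.Icc 1 M, ∑ k ∈ Finset.Icc 1 (NN L), ∑ n ∈ Finset.Icc 1 M, lam L h * lam L k *
        ((if h ∣ m then 1 else 0) * (if k ∣ n then 1 else 0) * (gg η (n * v / m) * om x0 x1 (m / v))) := by
        rw [Finset.sum_comm]
        refine Finset.sum_congr rfl fun h _ => Finset.sum_congr rfl fun m _ => Finset.sum_comm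
    _ = _ := by
        refine Finset.sum_congr rfl fun h _ => ?_
        rw [Finset.sum_comm]
        refine Finset.sum_congr rfl fun k _ => ?_
        unfold Qhk
        rw [Finset.mul_sum]
        refine Finset.sum_congr rfl fun m _ => ?_
        rw [Finset.mul_sum]

lemma NN_le (L : ℝ) (hL : 0 ≤ L) : (NN L : ℝ) ≤ 2 * xi L := by
  have h1 : (1:ℝ) ≤ xi L := by unfold xi; exact Real.one_le_exp (by linarith)
  have : (NN L : ℝ) < xi L + 1 := by unfold NN; exact Nat.ceil_lt_add_one (by linarith)
  linarith

noncomputable def CQ : ℝ := 4 * 224^2 * Real.exp 20 + 30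

lemma CQ_pos : 0 < CQ := by unfold CQ; positivity

lemma QQ_bound (L η v : ℝ) (hL : 8 ≤ L) (hη : 0 < η) (hηL : η ≤ Real.exp (-L) / 20) (hv1 : 1 ≤ v) (hv2 : v ≤ 1 + 2 * η)
    (M : ℕ) (hM : (1 + 2 * η) * (xi L ^ 2 / η) ≤ M) (hM1 : 1 ≤ M) :
    |QQ L η v (1 / (2 * η)) (xi L ^ 2 / η) M| ≤ CQ := by
  have hx1 : (1:ℝ) ≤ xi L := by unfold xi; exact Real.one_le_exp (by linarith)
  have hxi2 : (1:ℝ) ≤ xi L ^ 2 := one_le_pow₀ hx1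
  have hxi4 : xi L ^ 4 = Real.exp L := by
    unfold xi; rw [← Real.exp_nat_mul]; congr 1; push_cast; ring
  have hη1 : η ≤ 1 / 20 := hηL.trans (by
    have : Real.exp (-L) ≤ 1 := Real.exp_le_one_iff.2 (by linarith)
    linarith)
  set x0 := 1 / (2 * η) with hx0
  set x1 := xi L ^ 2 / η with hx1d
  have h0 : 0 < x0 := by rw [hx0]; positivity
  have h01 : x0 ≤ x1 := by
    rw [hx0, hx1d, div_le_div_iff₀ (by positivity) hη]; nlinarith
  set R := ⌈2 * xi L ^ 2⌉₊ with hRd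
  have hR : 2 * η * x1 ≤ R := by
    rw [hx1d]
    have : 2 * η * (xi L ^ 2 / η) = 2 * xi L ^ 2 := by field_simp
    rw [this]; exact Nat.le_ceil _
  have hR2 : (R:ℝ) ≤ 3 * xi L ^ 2 := by
    have := Nat.ceil_lt_add_one (a := 2 * xi L ^ 2) (by positivity)
    linarith
  have hD : ∀ d : ℕ, 1 ≤ d → |Dd η v x0 x1 R d| ≤ 2 * L := by
    intro d hd
    refine (Dd_bound η v x0 x1 hη hv1 hv2 h0 h01 R d hd hR).trans ?_
    have e : x1 / x0 = 2 * xi L ^ 2 := by rw [hx0, hx1d]; field_simp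
    have hl : Real.log (x1 / x0) = Real.log 2 + L / 2 := by
      rw [e, Real.log_mul (by norm_num) (by positivity), Real.log_pow]
      unfold xi; rw [Real.log_exp]; push_cast; ring
    rw [hl]
    have := Real.log_two_lt_d9
    have h2 : 0 < Real.log 2 := Real.log_pos (by norm_num)
    nlinarith
  have hB := partB_gen L 0 hL le_rfl (by linarith) (fun d => d * Dd η v x0 x1 R d) (2 * L) (by linarith) (by
    intro d hd
    rw [abs_mul, abs_of_nonneg (by positivity), add_zero, Real.rpow_one, mul_comm]
    exact mul_le_mul_of_nonneg_right (hD d hd) (by positivity))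
  have herr : |QQ L η v x0 x1 M - ∑ h ∈ Finset.Icc 1 (NN L), ∑ k ∈ Finset.Icc 1 (NN L),
      (lam L h * (h:ℝ)^(-(1+0:ℝ)))*(lam L k * (k:ℝ)^(-(1+0:ℝ)))*((fun d:ℕ => d * Dd η v x0 x1 R d) (Nat.gcd h k))|
      ≤ (NN L : ℝ) * ((NN L : ℝ) * ((2 * R + 1) * (8 / x0))) := by
    rw [QQ_eq, ← Finset.sum_sub_distrib]
    refine (Finset.abs_sum_le_sum_abs _ _).trans ?_
    have : (NN L : ℝ) * ((NN L : ℝ) * ((2 * R + 1) * (8 / x0))) =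
      ∑ h ∈ Finset.Icc 1 (NN L), ∑ k ∈ Finset.Icc 1 (NN L), (2 * R + 1) * (8 / x0) := by simp
    rw [this]
    refine Finset.sum_le_sum fun h hh => ?_
    rw [← Finset.sum_sub_distrib]
    refine (Finset.abs_sum_le_sum_abs _ _).trans (Finset.sum_le_sum fun k hk => ?_)
    rw [Finset.mem_Icc] at hh hk
    have hh0 : (0:ℝ) < h := by exact_mod_cast hh.1
    have hk0 : (0:ℝ) < k := by exact_mod_cast hk.1
    have e1 : (1:ℝ) / ((Nat.lcm h k : ℕ):ℝ) = (h:ℝ)⁻¹ * (k:ℝ)⁻¹ * (Nat.gcd h k : ℕ) := by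
      have : ((Nat.gcd h k : ℕ):ℝ) * (Nat.lcm h k : ℕ) = h * k := by exact_mod_cast Nat.gcd_mul_lcm h k
      have hl : (0:ℝ) < (Nat.lcm h k : ℕ) := by exact_mod_cast Nat.lcm_pos hh.1 hk.1
      field_simp; linarith
    have e2 : ∀ x : ℝ, 0 < x → x ^ (-(1+0:ℝ)) = x⁻¹ := by
      intro x hx; rw [add_zero, Real.rpow_neg_one]
    have q := Qhk_bound η v x0 x1 hη hv1 hv2 h0 h01 R M h k hh.1 hk.1 hR hM hM1
    have e3 : lam L h * lam L k * Qhk η v x0 x1 M h k - (lam L h * (h:ℝ)^(-(1+0:ℝ)))*(lam L k * (k:ℝ)^(-(1+0:ℝ)))*((fun d:ℕ => d * Dd η v x0 x1 R d) (Nat.gcd h k))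
      = lam L h * lam L k * (Qhk η v x0 x1 M h k - 1 / ((Nat.lcm h k : ℕ):ℝ) * Dd η v x0 x1 R (Nat.gcd h k)) := by
      rw [e1, e2 _ hh0, e2 _ hk0]; ring
    rw [e3, abs_mul, abs_mul]
    have l1 := abs_lam_le L (by linarith : 0 < L) h hh.1
    have l2 := abs_lam_le L (by linarith : 0 < L) k hk.1
    calc _ ≤ 1 * 1 * ((2 * R + 1) * (8 / x0)) := by gcongr
      _ = _ := by ring
  have hN := NN_le L (by linarith)
  have herr2 : (NN L : ℝ) * ((NN L : ℝ) * ((2 * R + 1) * (8 / x0))) ≤ 30 := by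
    have e : 8 / x0 = 16 * η := by rw [hx0]; field_simp; norm_num
    rw [e]
    calc _ ≤ (2 * xi L) * ((2 * xi L) * ((2 * (3 * xi L ^ 2) + xi L ^ 2) * (16 * η))) := by gcongr
      _ = 448 * (xi L ^ 4 * η) := by ring
      _ ≤ 448 * (Real.exp L * (Real.exp (-L) / 20)) := by rw [hxi4]; gcongr
      _ = 448 / 20 := by
        rw [Real.exp_neg]
        have := Real.exp_pos L
        field_simp
      _ ≤ 30 := by norm_num
  have hB2 : (2*224^2*Real.exp 20)*(2*L)/L = 4*224^2*Real.exp 20 := by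
    have : L ≠ 0 := by linarith
    field_simp; ring
  rw [hB2] at hB
  unfold CQ
  have t := abs_sub_abs_le_abs_sub (QQ L η v x0 x1 M) (∑ h ∈ Finset.Icc 1 (NN L), ∑ k ∈ Finset.Icc 1 (NN L),
      (lam L h * (h:ℝ)^(-(1+0:ℝ)))*(lam L k * (k:ℝ)^(-(1+0:ℝ)))*((fun d:ℕ => d * Dd η v x0 x1 R d) (Nat.gcd h k)))
  have t2 := (sub_le_iff_le_add.1 t).trans (add_le_add (herr.trans herr2) hB)
  linarith

end ZD
end

section
namespace ZD

lemma gg_ne_zero {η v : ℝ} (hη : 0 ≤ η) (h : gg η v ≠ 0) : 1 < v ∧ v ≤ 1 + 2 * η := by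
  by_contra hc
  apply h
  unfold gg
  rw [not_and_or, not_lt, not_le] at hc
  rcases hc with hc | hc
  · rw [if_pos (by linarith), if_pos (by linarith), if_pos hc]; ring
  · rw [if_neg (by linarith), if_neg (by linarith), if_neg (by linarith)]; ring

lemma gg_abs_le {η : ℝ} (hη : 0 ≤ η) (v : ℝ) : |gg η v| ≤ 1 := by
  unfold gg
  split_ifs <;> first | (exfalso; linarith) | norm_num

lemma gg_meas (η : ℝ) : Measurable (gg η) := by
  unfold gg
  refine ((Measurable.ite measurableSet_Iic ?_ ?_).sub ((Measurable.ite measurableSet_Iic ?_ ?_).const_mul 2)).add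
    (Measurable.ite measurableSet_Iic ?_ ?_) <;> exact measurable_const

lemma om_meas {x0 : ℝ} (h0 : 0 < x0) (x1 : ℝ) : Measurable (om x0 x1) := (om_anti h0 x1).measurable

lemma integrable_bdd {f : ℝ → ℝ} (hm : Measurable f) (a b C : ℝ) (h : ∀ x, f x ≠ 0 → x ∈ Icc a b) (hC : ∀ x, |f x| ≤ C) :
    Integrable f := by
  have h1 : IntegrableOn f (Icc a b) := by
    apply Measure.integrableOn_of_bounded (M := C)
    · simp
    · exact hm.aestronglyMeasurable
    · exact Filter.Eventually.of_forall fun x => hC x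
  exact (integrableOn_iff_integrable_of_support_subset (fun x hx => h x hx)).1 h1

lemma subst_inv (φ : ℝ → ℝ) (m : ℝ) (hm : 0 < m) :
    ∫ x in Ioi (0:ℝ), φ x / x = ∫ v in Ioi (0:ℝ), φ (m / v) / v := by
  have h1 := integral_comp_rpow_Ioi (fun y => φ (m * y) / y) (p := -1) (by norm_num)
  have h2 := integral_comp_mul_left_Ioi (fun x => φ x / x) 0 hm
  rw [mul_zero, smul_eq_mul] at h2
  have h3 : ∫ x in Ioi (0:ℝ), φ x / x = ∫ y in Ioi (0:ℝ), φ (m * y) / y := by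
    have : ∫ y in Ioi (0:ℝ), φ (m * y) / y = m * ∫ y in Ioi (0:ℝ), φ (m * y) / (m * y) := by
      rw [← integral_const_mul]
      refine setIntegral_congr_fun measurableSet_Ioi fun y hy => ?_
      have : y ≠ 0 := ne_of_gt hy
      field_simp
    rw [this, h2]; field_simp
  rw [h3, ← h1]
  refine setIntegral_congr_fun measurableSet_Ioi fun y hy => ?_
  have hy0 : (0:ℝ) < y := hy
  simp only [smul_eq_mul]
  rw [Real.rpow_neg_one, show (-1 - 1 : ℝ) = ((-2:ℤ):ℝ) by norm_num, Real.rpow_intCast]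
  simp only [abs_neg, abs_one, one_mul, div_eq_mul_inv, inv_inv, zpow_neg]
  have : (y ^ (2:ℤ)) = y * y := by rw [zpow_ofNat]; ring
  rw [this]; field_simp

noncomputable def FP (L η : ℝ) (M : ℕ) (x : ℝ) : ℝ := ∑ n ∈ Finset.Icc 1 M, an L n * gg η (n / x)

lemma FP_meas (L η : ℝ) (M : ℕ) : Measurable (FP L η M) := by
  unfold FP
  refine Finset.measurable_sum _ fun n _ => ?_
  exact ((gg_meas η).comp (measurable_const.div measurable_id)).const_mul _

lemma gg_div_mem {η : ℝ} (hη : 0 ≤ η) {m : ℕ} {x : ℝ} (h : gg η (m / x) ≠ 0) :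
    0 < x ∧ x < m ∧ m ≤ (1 + 2 * η) * x := by
  obtain ⟨h1, h2⟩ := gg_ne_zero hη h
  have hx : 0 < x := by
    by_contra hx
    push Not at hx
    have : (m:ℝ) / x ≤ 0 := div_nonpos_of_nonneg_of_nonpos (by positivity) hx
    linarith
  rw [lt_div_iff₀ hx] at h1
  rw [div_le_iff₀ hx] at h2
  exact ⟨hx, by linarith, h2⟩

lemma partE (L η : ℝ) (hL : 8 ≤ L) (hη : 0 < η) (hηL : η ≤ Real.exp (-L) / 20)
    (M : ℕ) (hM : (1 + 2 * η) * (xi L ^ 2 / η) ≤ M) (hM1 : 1 ≤ M) :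
    Integrable (fun x => FP L η M x ^ 2 * om (1 / (2 * η)) (xi L ^ 2 / η) x / x) ∧
    ∫ x in Ioi (0:ℝ), FP L η M x ^ 2 * om (1 / (2 * η)) (xi L ^ 2 / η) x / x ≤ 2 * η * CQ := by
  set x0 := 1 / (2 * η) with hx0
  set x1 := xi L ^ 2 / η with hx1d
  have h0 : 0 < x0 := by rw [hx0]; positivity
  have hom := om_nonneg h0 x1
  have homle := om_le h0 x1
  set f : ℕ → ℕ → ℝ → ℝ := fun m n x => gg η (m / x) * gg η (n / x) * om x0 x1 x with hf
  have hfm : ∀ m n, Measurable (f m n) := by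
    intro m n
    exact (((gg_meas η).comp (measurable_const.div measurable_id)).mul ((gg_meas η).comp (measurable_const.div measurable_id))).mul
      (om_meas h0 x1)
  have hfb : ∀ m n x, |f m n x| ≤ 1 / x0 := by
    intro m n x
    simp only [hf]
    rw [abs_mul, abs_mul, abs_of_nonneg (hom x)]
    calc _ ≤ 1 * 1 * (1 / x0) := by
          gcongr
          · exact hom x
          · exact gg_abs_le hη.le _
          · exact gg_abs_le hη.le _
          · exact homle x
      _ = _ := by ring
  have hfs : ∀ m n x, f m n x ≠ 0 → 0 < x ∧ x < m ∧ m ≤ (1 + 2 * η) * x := by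
    intro m n x h
    apply gg_div_mem hη.le
    intro h0; apply h; simp only [hf, h0]; ring
  -- x side
  have hix : ∀ m n : ℕ, 1 ≤ m → Integrable (fun x => f m n x / x) := by
    intro m n hm
    have hm0 : (0:ℝ) < m := by exact_mod_cast hm
    apply integrable_bdd ((hfm m n).div measurable_id) (m / (1 + 2 * η)) m ((1 / x0) * ((1 + 2 * η) / m))
    · intro x hx
      have := hfs m n x (fun h => hx (by simp [h]))
      refine ⟨?_, this.2.1.le⟩
      rw [div_le_iff₀ (by positivity)]; linarith [this.2.2]
    · intro x
      simp only [Pi.div_apply, id_eq]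
      by_cases hx : f m n x = 0
      · simp only [hx, zero_div, abs_zero]; positivity
      · have := hfs m n x hx
        rw [abs_div, abs_of_pos this.1, div_eq_mul_inv]
        have hle : x⁻¹ ≤ (1 + 2 * η) / m := by
          rw [inv_eq_one_div, div_le_div_iff₀ this.1 hm0]; linarith [this.2.2]
        exact mul_le_mul (hfb m n x) hle (inv_nonneg.2 this.1.le) (by positivity)
  have hiv : ∀ m n : ℕ, 1 ≤ m → Integrable (fun v => f m n (m / v) / v) := by
    intro m n hm
    have hm0 : (0:ℝ) < m := by exact_mod_cast hm
    have hs : ∀ v, f m n (m / v) ≠ 0 → 1 ≤ v ∧ v ≤ 1 + 2 * η := by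
      intro v hv
      have hg : gg η (m / (m / v)) ≠ 0 := by
        intro h0; apply hv; simp only [hf, h0]; ring
      rw [div_div_cancel₀ hm0.ne'] at hg
      have := gg_ne_zero hη.le hg
      exact ⟨this.1.le, this.2⟩
    apply integrable_bdd (((hfm m n).comp (measurable_const.div measurable_id)).div measurable_id) 1 (1 + 2 * η) (1 / x0)
    · intro v hv
      exact hs v (fun h => hv (by simp only [Pi.div_apply, Function.comp, id_eq, h, zero_div]))
    · intro v
      simp only [Pi.div_apply, Function.comp, id_eq]
      by_cases hv : f m n (m / v) = 0
      · rw [hv]; simp only [zero_div, abs_zero]; positivity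
      · have := hs v hv
        rw [abs_div, abs_of_pos (by linarith : 0 < v)]
        refine (div_le_self (abs_nonneg _) this.1).trans (hfb m n _)
  have e1 : ∀ x, FP L η M x ^ 2 * om x0 x1 x / x = ∑ m ∈ Finset.Icc 1 M, ∑ n ∈ Finset.Icc 1 M, an L m * an L n * (f m n x / x) := by
    intro x
    unfold FP
    rw [sq, Finset.sum_mul_sum, Finset.sum_mul, Finset.sum_div]
    refine Finset.sum_congr rfl fun m _ => ?_
    rw [Finset.sum_mul, Finset.sum_div]
    refine Finset.sum_congr rfl fun n _ => ?_
    simp only [hf]; ring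
  simp only [e1]
  have hI : ∀ m ∈ Finset.Icc 1 M, Integrable (fun x => ∑ n ∈ Finset.Icc 1 M, an L m * an L n * (f m n x / x)) := by
    intro m hm
    refine integrable_finsetSum _ fun n _ => (hix m n (Finset.mem_Icc.1 hm).1).const_mul _
  refine ⟨integrable_finsetSum _ hI, ?_⟩
  have e2 : ∫ x in Ioi (0:ℝ), ∑ m ∈ Finset.Icc 1 M, ∑ n ∈ Finset.Icc 1 M, an L m * an L n * (f m n x / x)
      = ∫ v in Ioi (0:ℝ), ∑ m ∈ Finset.Icc 1 M, ∑ n ∈ Finset.Icc 1 M, an L m * an L n * (f m n (m / v) / v) := by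
    rw [integral_finsetSum _ (fun m hm => (hI m hm).integrableOn), integral_finsetSum]
    · refine Finset.sum_congr rfl fun m hm => ?_
      have hm1 := (Finset.mem_Icc.1 hm).1
      have hm0 : (0:ℝ) < m := by exact_mod_cast hm1
      rw [integral_finsetSum _ (fun n _ => ((hix m n hm1).const_mul _).integrableOn),
        integral_finsetSum _ (fun n _ => ((hiv m n hm1).const_mul _).integrableOn)]
      refine Finset.sum_congr rfl fun n _ => ?_
      rw [integral_const_mul, integral_const_mul, subst_inv (f m n) m hm0]
    · intro m hm
      exact (integrable_finsetSum _ fun n _ => (hiv m n (Finset.mem_Icc.1 hm).1).const_mul _).integrableOn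
  rw [e2]
  have e3 : ∀ v ∈ Ioi (0:ℝ), ∑ m ∈ Finset.Icc 1 M, ∑ n ∈ Finset.Icc 1 M, an L m * an L n * (f m n (m / v) / v)
      = gg η v / v * QQ L η v x0 x1 M := by
    intro v hv
    have hv0 : (0:ℝ) < v := hv
    unfold QQ
    rw [Finset.mul_sum]
    refine Finset.sum_congr rfl fun m hm => ?_
    have hm0 : (0:ℝ) < m := by exact_mod_cast (Finset.mem_Icc.1 hm).1
    rw [Finset.mul_sum]
    refine Finset.sum_congr rfl fun n _ => ?_
    simp only [hf]
    rw [div_div_cancel₀ hm0.ne', div_div_eq_mul_div]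
    ring
  rw [setIntegral_congr_fun measurableSet_Ioi e3]
  refine (le_abs_self _).trans ?_
  rw [← Real.norm_eq_abs]
  have hind : IntegrableOn ((Ioc 1 (1 + 2 * η)).indicator fun _ => CQ) (Ioi (0:ℝ)) := by
    apply Integrable.integrableOn
    rw [integrable_indicator_iff measurableSet_Ioc]
    exact integrableOn_const (by rw [Real.volume_Ioc]; exact ENNReal.ofReal_ne_top)
  have := norm_integral_le_of_norm_le (f := fun v => gg η v / v * QQ L η v x0 x1 M) hind (by
    refine (ae_restrict_mem measurableSet_Ioi).mono fun v hv => ?_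
    by_cases hg : gg η v = 0
    · rw [hg]; simp only [zero_div, zero_mul, norm_zero]
      exact indicator_nonneg (fun _ _ => CQ_pos.le) _
    · have h := gg_ne_zero hη.le hg
      rw [indicator_of_mem (show v ∈ Ioc 1 (1 + 2 * η) from h), norm_mul, Real.norm_eq_abs, Real.norm_eq_abs, abs_div,
        abs_of_pos (by linarith : 0 < v)]
      have q := QQ_bound L η v hL hη hηL h.1.le h.2 M hM hM1
      have g1 : |gg η v| / v ≤ 1 := by
        rw [div_le_one (by linarith)]; exact (gg_abs_le hη.le v).trans h.1.le
      calc _ ≤ 1 * CQ := mul_le_mul g1 q (abs_nonneg _) zero_le_one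
        _ = CQ := one_mul _)
  refine this.trans (le_of_eq ?_)
  have hinter : Ioi (0:ℝ) ∩ Ioc 1 (1 + 2 * η) = Ioc 1 (1 + 2 * η) := by
    apply inter_eq_right.2
    intro x hx
    rw [mem_Ioi]; linarith [hx.1]
  rw [setIntegral_indicator measurableSet_Ioc, hinter, setIntegral_const]
  simp only [smul_eq_mul]
  rw [measureReal_def, Real.volume_Ioc, ENNReal.toReal_ofReal (by linarith)]
  ring

end ZD
end

section
namespace ZD

noncomputable def Sfl (η y : ℝ) : ℝ := (⌊(1 + 2 * η) * y⌋ : ℝ) - 2 * ⌊(1 + η) * y⌋ + ⌊y⌋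

noncomputable def FF (L η x : ℝ) : ℝ := ∑ h ∈ Finset.Icc 1 (NN L), lam L h * Sfl η (x / h)

noncomputable def HH (L η x : ℝ) : ℝ := FF L η x - gg η (1 / x)

lemma Sfl_abs_le (η y : ℝ) : |Sfl η y| ≤ 1 := by
  unfold Sfl
  have f1 := Int.floor_le ((1 + 2 * η) * y)
  have f1' := Int.lt_floor_add_one ((1 + 2 * η) * y)
  have f2 := Int.floor_le ((1 + η) * y)
  have f2' := Int.lt_floor_add_one ((1 + η) * y)
  have f3 := Int.floor_le y
  have f3' := Int.lt_floor_add_one y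
  set p := ⌊(1 + 2 * η) * y⌋
  set q := ⌊(1 + η) * y⌋
  set s := ⌊y⌋
  have g1 : ((p - 2 * q + s : ℤ) : ℝ) < 2 := by push_cast; linarith
  have g2 : (-2:ℝ) < ((p - 2 * q + s : ℤ) : ℝ) := by push_cast; linarith
  have g1' : p - 2 * q + s < 2 := by exact_mod_cast g1
  have g2' : -2 < p - 2 * q + s := by exact_mod_cast g2
  have g3 : |p - 2 * q + s| ≤ 1 := by rw [abs_le]; omega
  have g4 : |((p - 2 * q + s : ℤ) : ℝ)| ≤ 1 := by exact_mod_cast g3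
  push_cast at g4
  exact g4

lemma Sfl_meas (η : ℝ) : Measurable (Sfl η) := by
  unfold Sfl
  fun_prop

lemma FF_meas (L η : ℝ) : Measurable (FF L η) := by
  unfold FF
  refine Finset.measurable_sum _ fun n _ => ?_
  exact ((Sfl_meas η).comp (measurable_id.div_const _)).const_mul _

lemma HH_meas (L η : ℝ) : Measurable (HH L η) := by
  unfold HH
  exact (FF_meas L η).sub ((gg_meas η).comp (measurable_const.div measurable_id))

lemma FF_abs_le (L η x : ℝ) (hL : 0 < L) : |FF L η x| ≤ NN L := by
  unfold FF
  refine (Finset.abs_sum_le_sum_abs _ _).trans ?_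
  have : ∀ h ∈ Finset.Icc 1 (NN L), |lam L h * Sfl η (x / h)| ≤ 1 := by
    intro h hh
    rw [abs_mul]
    have := abs_lam_le L hL h (Finset.mem_Icc.1 hh).1
    have := Sfl_abs_le η (x / h)
    calc _ ≤ (1:ℝ) * 1 := by gcongr
      _ = 1 := one_mul _
  refine (Finset.sum_le_sum this).trans ?_
  simp

lemma floor_count (y x : ℝ) (c : ℝ) (hx : 0 < x) (hc : 0 ≤ c) (h M : ℕ) (hh : 1 ≤ h) (hM : c * x ≤ M) :
    (⌊c * (x / h)⌋ : ℝ) = ∑ n ∈ Finset.Icc 1 M, (if h ∣ n then (if (n:ℝ) / x ≤ c then (1:ℝ) else 0) else 0) := by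
  have hcx : 0 ≤ c * x := by positivity
  rw [← Finset.sum_filter, ← Finset.sum_filter, Finset.filter_filter]
  have hset : (Finset.Icc 1 M).filter (fun n => h ∣ n ∧ (n:ℝ) / x ≤ c) = (Finset.Ioc 0 ⌊c * x⌋₊).filter (fun n => h ∣ n) := by
    ext n
    simp only [Finset.mem_filter, Finset.mem_Icc, Finset.mem_Ioc]
    rw [div_le_iff₀ hx, Nat.le_floor_iff hcx]
    constructor
    · rintro ⟨⟨a, b⟩, c, d⟩; exact ⟨⟨by omega, d⟩, c⟩
    · rintro ⟨⟨a, b⟩, c⟩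
      have : (n:ℝ) ≤ M := b.trans hM
      exact ⟨⟨by omega, by exact_mod_cast this⟩, c, b⟩
  rw [hset, Finset.sum_const, nsmul_eq_mul, mul_one, Nat.Ioc_filter_dvd_card_eq_div, ← Nat.floor_div_natCast]
  rw [← natCast_floor_eq_intCast_floor (by positivity), mul_div_assoc]

lemma FF_eq_FP (L η x : ℝ) (hη : 0 < η) (hx : 0 < x) (M : ℕ) (hM : (1 + 2 * η) * x ≤ M) : FF L η x = FP L η M x := by
  unfold FF FP
  have hs : ∀ h ∈ Finset.Icc 1 (NN L), lam L h * Sfl η (x / h) =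
      ∑ n ∈ Finset.Icc 1 M, lam L h * (if h ∣ n then 1 else 0) * gg η (n / x) := by
    intro h hh
    have h1 := (Finset.mem_Icc.1 hh).1
    unfold Sfl
    rw [floor_count 0 x (1 + 2 * η) hx (by linarith) h M h1 hM, floor_count 0 x (1 + η) hx (by linarith) h M h1 (by nlinarith)]
    have := floor_count 0 x 1 hx (by linarith) h M h1 (by nlinarith)
    rw [one_mul] at this
    rw [this, Finset.mul_sum, ← Finset.sum_sub_distrib, ← Finset.sum_add_distrib, Finset.mul_sum]
    refine Finset.sum_congr rfl fun n _ => ?_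
    unfold gg
    by_cases hd : h ∣ n
    · simp only [if_pos hd]; ring
    · simp only [if_neg hd]; ring
  rw [Finset.sum_congr rfl hs, Finset.sum_comm]
  refine Finset.sum_congr rfl fun n _ => ?_
  rw [an_ind, Finset.sum_mul]

lemma FF_small (L η x : ℝ) (hL : 8 ≤ L) (hη : 0 < η) (hη1 : η ≤ 1 / 20) (hx : 0 < x) (hxX : x < XX L / 2) : HH L η x = 0 := by
  obtain ⟨M, hM⟩ := exists_nat_ge ((1 + 2 * η) * x + 1)
  have hM1 : 1 ≤ M := by
    have : (1:ℝ) ≤ M := le_trans (by nlinarith [mul_pos hη hx]) hM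
    exact_mod_cast this
  unfold HH
  rw [FF_eq_FP L η x hη hx M (by linarith)]
  unfold FP
  rw [Finset.sum_eq_single 1]
  · rw [an_eq_of_le L (by linarith) 1 le_rfl (by unfold XX; exact_mod_cast Real.one_le_exp (by linarith))]
    simp
  · intro n hn hn1
    by_cases hg : gg η (n / x) = 0
    · rw [hg]; simp
    · have := gg_div_mem hη.le hg
      rw [an_eq_of_le L (by linarith) n (Finset.mem_Icc.1 hn).1 (by nlinarith [this.2.2]), if_neg hn1]; simp
  · intro h; exact absurd (Finset.mem_Icc.2 ⟨le_rfl, hM1⟩) h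

lemma HH_eq_FF (L η x : ℝ) (hη : 0 < η) (hx : 1 ≤ x) : HH L η x = FF L η x := by
  unfold HH
  have : gg η (1 / x) = 0 := by
    by_contra h
    have := gg_ne_zero hη.le h
    rw [lt_div_iff₀ (by linarith)] at this
    linarith
  rw [this, sub_zero]

/-- at most one `n` contributes when `x ≤ 1/(2η)` -/
lemma FP_sq_small (L η x : ℝ) (hη : 0 < η) (hx : 0 < x) (hx0 : x ≤ 1 / (2 * η)) (M : ℕ) :
    FP L η M x ^ 2 = ∑ n ∈ Finset.Icc 1 M, an L n ^ 2 * gg η (n / x) ^ 2 := by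
  unfold FP
  have hu : ∀ m n : ℕ, gg η (m / x) ≠ 0 → gg η (n / x) ≠ 0 → m = n := by
    intro m n hm hn
    obtain ⟨_, a, b⟩ := gg_div_mem hη.le hm
    obtain ⟨_, c, d⟩ := gg_div_mem hη.le hn
    rw [le_div_iff₀ (by positivity)] at hx0
    have h1 : (m:ℝ) < n + 1 := by nlinarith
    have h2 : (n:ℝ) < m + 1 := by nlinarith
    have h1' : m < n + 1 := by exact_mod_cast h1
    have h2' : n < m + 1 := by exact_mod_cast h2
    omega
  rw [sq, Finset.sum_mul_sum]
  refine Finset.sum_congr rfl fun m hm => ?_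
  rw [Finset.sum_eq_single m]
  · ring
  · intro n _ hnm
    by_cases h1 : gg η (m / x) = 0
    · rw [h1]; ring
    · by_cases h2 : gg η (n / x) = 0
      · rw [h2]; ring
      · exact absurd (hu m n h1 h2).symm hnm
  · intro h; exact absurd hm h

lemma int_gg_sq (η : ℝ) (hη : 0 < η) (hη1 : η ≤ 1 / 20) (n : ℕ) (hn : 1 ≤ n) :
    IntegrableOn (fun x => gg η (n / x) ^ 2 * (x ^ 2)⁻¹) (Ioi 0) ∧
    ∫ x in Ioi (0:ℝ), gg η (n / x) ^ 2 * (x ^ 2)⁻¹ ≤ 8 * η / n := by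
  have hn0 : (0:ℝ) < n := by exact_mod_cast hn
  set I := Ico (n / (1 + 2 * η) : ℝ) n with hI
  have hb : ∀ x : ℝ, ‖gg η (n / x) ^ 2 * (x ^ 2)⁻¹‖ ≤ I.indicator (fun _ => 4 / (n:ℝ) ^ 2) x := by
    intro x
    by_cases hg : gg η (n / x) = 0
    · rw [hg]; simp only [ne_eq, OfNat.ofNat_ne_zero, not_false_eq_true, zero_pow, zero_mul, norm_zero]
      exact indicator_nonneg (fun _ _ => by positivity) _
    · obtain ⟨h1, h2, h3⟩ := gg_div_mem hη.le hg
      have hmem : x ∈ I := ⟨by rw [div_le_iff₀ (by positivity)]; linarith, h2⟩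
      rw [indicator_of_mem hmem, norm_mul, norm_pow, Real.norm_eq_abs, Real.norm_eq_abs, abs_of_nonneg (by positivity : 0 ≤ (x^2)⁻¹)]
      have g1 : |gg η (n / x)| ^ 2 ≤ 1 := pow_le_one₀ (abs_nonneg _) (gg_abs_le hη.le _)
      have g2 : (x ^ 2)⁻¹ ≤ 4 / (n:ℝ) ^ 2 := by
        rw [inv_eq_one_div, div_le_div_iff₀ (by positivity) (by positivity)]
        have : (n:ℝ) ≤ 2 * x := by nlinarith
        nlinarith
      calc _ ≤ 1 * (4 / (n:ℝ)^2) := mul_le_mul g1 g2 (by positivity) zero_le_one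
        _ = _ := one_mul _
  have hind : Integrable (I.indicator (fun _ => 4 / (n:ℝ) ^ 2)) := by
    rw [integrable_indicator_iff measurableSet_Ico]
    exact integrableOn_const (by rw [Real.volume_Ico]; exact ENNReal.ofReal_ne_top)
  have hmeas : Measurable (fun x => gg η (n / x) ^ 2 * (x ^ 2)⁻¹) :=
    (((gg_meas η).comp (measurable_const.div measurable_id)).pow_const 2).mul ((measurable_id.pow_const 2).inv)
  refine ⟨(hind.mono' hmeas.aestronglyMeasurable (Filter.Eventually.of_forall hb)).integrableOn, ?_⟩
  refine (le_abs_self _).trans ?_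
  rw [← Real.norm_eq_abs]
  refine (norm_integral_le_of_norm_le hind.integrableOn (Filter.Eventually.of_forall hb)).trans ?_
  refine (setIntegral_le_integral hind (Filter.Eventually.of_forall fun x => indicator_nonneg (fun _ _ => by positivity) _)).trans ?_
  rw [integral_indicator measurableSet_Ico, setIntegral_const, smul_eq_mul, measureReal_def, Real.volume_Ico, ENNReal.toReal_ofReal]
  · have : (n:ℝ) - n / (1 + 2 * η) ≤ 2 * η * n := by
      have : (n:ℝ) / (1 + 2 * η) * (1 + 2 * η) = n := by field_simp
      have h2 : (n:ℝ) / (1 + 2 * η) ≤ n := div_le_self hn0.le (by linarith)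
      nlinarith
    calc _ ≤ (2 * η * n) * (4 / (n:ℝ)^2) := by gcongr
      _ = _ := by field_simp; ring
  · have h2 : (n:ℝ) / (1 + 2 * η) ≤ n := div_le_self hn0.le (by linarith)
    linarith

end ZD
end

section
namespace ZD

lemma x1_le (L η : ℝ) (hL : 8 ≤ L) (hη0 : Real.exp (-L) / 100 ≤ η) :
    xi L ^ 2 / η ≤ Real.exp (3 * L) := by
  have hη : 0 < η := lt_of_lt_of_le (by positivity) hη0
  rw [div_le_iff₀ hη]
  have h2 : xi L ^ 2 = Real.exp (L / 2) := by unfold xi; rw [← Real.exp_nat_mul]; congr 1; push_cast; ring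
  rw [h2]
  have h3 : (100:ℝ) ≤ Real.exp 5 := by
    have : (2.7182818283:ℝ) ≤ Real.exp 1 := Real.exp_one_gt_d9.le
    have h5 : Real.exp 5 = Real.exp 1 ^ 5 := by rw [← Real.exp_nat_mul]; norm_num
    rw [h5]
    calc (100:ℝ) ≤ 2.7182818283 ^ 5 := by norm_num
      _ ≤ _ := by gcongr
  calc Real.exp (L/2) ≤ Real.exp (2 * L - 5) := Real.exp_le_exp.2 (by linarith)
    _ = Real.exp (3 * L) * (Real.exp (-L) / Real.exp 5) := by
        rw [← Real.exp_sub, ← Real.exp_add]; congr 1; ring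
    _ ≤ Real.exp (3 * L) * (Real.exp (-L) / 100) := by gcongr
    _ ≤ _ := by gcongr

lemma pow_bound (L η σ x : ℝ) (hL : 8 ≤ L) (hη0 : Real.exp (-L) / 100 ≤ η) (hσ1 : 1 / 2 - 1 / L ≤ σ) (hσ2 : σ ≤ 8)
    (hx1 : XX L / 2 ≤ x) (hx2 : x ≤ xi L ^ 2 / η) : x ^ (1 - 2 * σ) ≤ 2 ^ 15 * XX L ^ (1 - 2 * σ) := by
  have hX0 := XX_pos L
  have hx0 : 0 < x := by linarith
  rcases le_or_gt (1/2) σ with h | h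
  · calc x ^ (1 - 2 * σ) ≤ (XX L / 2) ^ (1 - 2 * σ) := Real.rpow_le_rpow_of_nonpos (by linarith) hx1 (by linarith)
      _ = 2 ^ (2 * σ - 1) * XX L ^ (1 - 2 * σ) := by
        rw [Real.div_rpow hX0.le (by norm_num), show 2 * σ - 1 = -(1 - 2 * σ) by ring, Real.rpow_neg (by norm_num)]
        rw [div_eq_mul_inv, mul_comm]
      _ ≤ 2 ^ (15:ℝ) * XX L ^ (1 - 2 * σ) := by
        gcongr
        · norm_num
        · linarith
      _ = _ := by norm_num
  · have hz : 0 ≤ 1 - 2 * σ := by linarith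
    have hX1 : 1 ≤ XX L := by unfold XX; exact Real.one_le_exp (by linarith)
    have h1 : 1 ≤ XX L ^ (1 - 2 * σ) := Real.one_le_rpow hX1 hz
    have hLz : 3 * L * (1 - 2 * σ) ≤ 6 := by
      have : L * (1 / L) = 1 := by field_simp
      nlinarith
    have h6 : Real.exp 6 ≤ 2 ^ 15 := by
      have : Real.exp 1 ≤ 2.7182818286 := Real.exp_one_lt_d9.le
      have h5 : Real.exp 6 = Real.exp 1 ^ 6 := by rw [← Real.exp_nat_mul]; norm_num
      rw [h5]
      calc _ ≤ (2.7182818286:ℝ) ^ 6 := by gcongr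
        _ ≤ _ := by norm_num
    calc x ^ (1 - 2 * σ) ≤ (Real.exp (3 * L)) ^ (1 - 2 * σ) :=
          Real.rpow_le_rpow hx0.le (hx2.trans (x1_le L η hL hη0)) hz
      _ = Real.exp (3 * L * (1 - 2 * σ)) := by rw [← Real.exp_mul]
      _ ≤ Real.exp 6 := Real.exp_le_exp.2 hLz
      _ ≤ 2 ^ 15 * 1 := by linarith
      _ ≤ _ := by gcongr

noncomputable def CD : ℝ := 2 ^ 15 * (8 * (4 * 224^2 * Real.exp 22) + 2 * CQ + 6)

lemma CD_pos : 0 < CD := by unfold CD; have := CQ_pos; positivity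

set_option maxHeartbeats 1000000 in
lemma partD (L η σ : ℝ) (hL : 8 ≤ L) (hη0 : Real.exp (-L) / 100 ≤ η) (hηL : η ≤ Real.exp (-L) / 20)
    (hσ1 : 1 / 2 - 1 / L ≤ σ) (hσ2 : σ ≤ 8) :
    IntegrableOn (fun x => HH L η x ^ 2 * x ^ (-2 * σ - 1)) (Ioi 0) ∧
    ∫ x in Ioi (0:ℝ), HH L η x ^ 2 * x ^ (-2 * σ - 1) ≤ CD * η * XX L ^ (1 - 2 * σ) := by
  have hη : 0 < η := lt_of_lt_of_le (by positivity) hη0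
  have hη1 : η ≤ 1 / 20 := hηL.trans (by
    have : Real.exp (-L) ≤ 1 := Real.exp_le_one_iff.2 (by linarith)
    linarith)
  have hX2 : 2 ≤ XX L := by
    unfold XX
    calc (2:ℝ) ≤ Real.exp 1 := by have := Real.exp_one_gt_d9; linarith
      _ ≤ _ := Real.exp_le_exp.2 (by linarith)
  have hxi1 : (1:ℝ) ≤ xi L := by unfold xi; exact Real.one_le_exp (by linarith)
  set x0 := 1 / (2 * η) with hx0
  set x1 := xi L ^ 2 / η with hx1d
  have h0 : 0 < x0 := by rw [hx0]; positivity
  have h01 : x0 ≤ x1 := by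
    rw [hx0, hx1d, div_le_div_iff₀ (by positivity) hη]; nlinarith [one_le_pow₀ hxi1 (n := 2)]
  have hx1pos : 0 < x1 := h0.trans_le h01
  have hXx1 : XX L / 2 ≤ x1 := by
    rw [hx1d, le_div_iff₀ hη]
    have := XX_le_xi L (by linarith)
    nlinarith [XX_pos L]
  have hσL : 1 / L ≤ 1 / 8 := one_div_le_one_div_of_le (by norm_num) hL
  set M := ⌈(1 + 2 * η) * x1⌉₊ with hMd
  have hM : (1 + 2 * η) * x1 ≤ M := Nat.le_ceil _
  have hM1 : 1 ≤ M := Nat.ceil_pos.2 (by positivity)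
  set M0 := ⌊1 / η⌋₊ with hM0d
  have hM0 : (M0:ℝ) ≤ 1 / η := Nat.floor_le (by positivity)
  have hM0log : Real.log M0 ≤ 2 * L := by
    rcases Nat.eq_zero_or_pos M0 with h | h
    · rw [h]; simp; linarith
    · have hp : (0:ℝ) < M0 := by exact_mod_cast h
      rw [Real.log_le_iff_le_exp hp]
      refine hM0.trans ?_
      rw [div_le_iff₀ hη]
      have h3 : (100:ℝ) ≤ Real.exp L := by
        have : (2.7182818283:ℝ) ≤ Real.exp 1 := Real.exp_one_gt_d9.le
        have h5 : Real.exp 8 = Real.exp 1 ^ 8 := by rw [← Real.exp_nat_mul]; norm_num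
        calc (100:ℝ) ≤ 2.7182818283 ^ 8 := by norm_num
          _ ≤ Real.exp 1 ^ 8 := by gcongr
          _ = Real.exp 8 := h5.symm
          _ ≤ _ := Real.exp_le_exp.2 hL
      calc (1:ℝ) = Real.exp (2 * L) * (Real.exp (-L) / Real.exp L) := by
            rw [← Real.exp_sub, ← Real.exp_add]; ring_nf; simp
        _ ≤ Real.exp (2 * L) * (Real.exp (-L) / 100) := by gcongr
        _ ≤ _ := by gcongr
  obtain ⟨iE, hE⟩ := partE L η hL hη hηL M hM hM1
  have hC := partC L hL M0 hM0log
  -- the dominating functions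
  set A : ℝ → ℝ := fun x => ∑ n ∈ Finset.Icc 1 M0, an L n ^ 2 * (gg η (n / x) ^ 2 * (x ^ 2)⁻¹) with hA
  set E : ℝ → ℝ := fun x => FP L η M x ^ 2 * om x0 x1 x / x with hEd
  set P : ℝ → ℝ := (Ioi x1).indicator (fun x => (NN L : ℝ) ^ 2 * x ^ (-2 * σ - 1)) with hP
  set K := 2 ^ 15 * XX L ^ (1 - 2 * σ) with hK
  have hK0 : 0 < K := by rw [hK]; have := XX_pos L; positivity
  have iA : IntegrableOn A (Ioi 0) := by
    refine integrable_finsetSum _ fun n hn => ((int_gg_sq η hη hη1 n (Finset.mem_Icc.1 hn).1).1).const_mul _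
  have hAi : ∫ x in Ioi (0:ℝ), A x ≤ 8 * η * (4 * 224^2 * Real.exp 22) := by
    rw [hA, integral_finsetSum _ (fun n hn => ((int_gg_sq η hη hη1 n (Finset.mem_Icc.1 hn).1).1).const_mul _)]
    calc _ ≤ ∑ n ∈ Finset.Icc 1 M0, an L n ^ 2 * (8 * η / n) := by
          refine Finset.sum_le_sum fun n hn => ?_
          rw [integral_const_mul]
          exact mul_le_mul_of_nonneg_left (int_gg_sq η hη hη1 n (Finset.mem_Icc.1 hn).1).2 (sq_nonneg _)
      _ = 8 * η * ∑ n ∈ Finset.Icc 1 M0, an L n ^ 2 / n := by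
          rw [Finset.mul_sum]; refine Finset.sum_congr rfl fun n _ => by ring
      _ ≤ _ := by gcongr
  have hneg : -2 * σ - 1 < -1 := by linarith
  have iP0 : IntegrableOn (fun x : ℝ => x ^ (-2 * σ - 1)) (Ioi x1) := integrableOn_Ioi_rpow_of_lt hneg hx1pos
  have iP : IntegrableOn P (Ioi 0) := by
    apply Integrable.integrableOn
    rw [hP, integrable_indicator_iff measurableSet_Ioi]
    exact iP0.const_mul _
  have hPi : ∫ x in Ioi (0:ℝ), P x ≤ K * (6 * η) := by
    rw [hP, setIntegral_indicator measurableSet_Ioi, Ioi_inter_Ioi, max_eq_right hx1pos.le, integral_const_mul,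
      integral_Ioi_rpow_of_lt hneg hx1pos]
    have e1 : -x1 ^ (-2 * σ - 1 + 1) / (-2 * σ - 1 + 1) = x1 ^ (1 - 2 * σ) / x1 / (2 * σ) := by
      rw [← Real.rpow_sub_one hx1pos.ne', show -2 * σ - 1 + 1 = -(2 * σ) by ring, show 1 - 2 * σ - 1 = -(2 * σ) by ring, neg_div_neg_eq]
    rw [e1]
    have hp := pow_bound L η σ x1 hL hη0 hσ1 hσ2 hXx1 le_rfl
    have hN := NN_le L (by linarith)
    have hxs : xi L ^ 2 / x1 = η := by rw [hx1d]; field_simp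
    calc (NN L : ℝ) ^ 2 * (x1 ^ (1 - 2 * σ) / x1 / (2 * σ)) ≤ (2 * xi L) ^ 2 * (K / x1 / (3 / 4)) := by
          have hσ0 : 0 < σ := by linarith
          have hσ3 : 3 / 4 ≤ 2 * σ := by linarith
          gcongr
      _ = 16 / 3 * K * (xi L ^ 2 / x1) := by ring
      _ ≤ _ := by rw [hxs]; nlinarith [mul_pos hK0 hη]
  have hdom : ∀ x ∈ Ioi (0:ℝ), HH L η x ^ 2 * x ^ (-2 * σ - 1) ≤ K * A x + K * E x + P x := by
    intro x hx
    have hx' : (0:ℝ) < x := hx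
    have hA0 : 0 ≤ A x := Finset.sum_nonneg fun n _ => by positivity
    have hE0 : 0 ≤ E x := by
      have := om_nonneg h0 x1 x
      simp only [hEd]; positivity
    have hP0 : 0 ≤ P x := indicator_nonneg (fun y hy => by
      have : (0:ℝ) < y := hx1pos.trans hy
      positivity) _
    have esplit : x ^ (-2 * σ - 1) = x ^ (1 - 2 * σ) * (x ^ 2)⁻¹ := by
      rw [← Real.rpow_natCast x 2, ← Real.rpow_neg hx'.le, ← Real.rpow_add hx']; congr 1; push_cast; ring
    rcases lt_or_ge x (XX L / 2) with h1 | h1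
    · rw [FF_small L η x hL hη hη1 hx' h1]
      have : 0 ≤ K * A x + K * E x + P x := by positivity
      simpa using this
    rw [HH_eq_FF L η x hη (by linarith)]
    rcases lt_or_ge x1 x with h2 | h2
    · have : FF L η x ^ 2 * x ^ (-2 * σ - 1) ≤ P x := by
        rw [hP, indicator_of_mem (show x ∈ Ioi x1 from h2)]
        have : FF L η x ^ 2 ≤ (NN L : ℝ) ^ 2 := by
          rw [← sq_abs]; exact pow_le_pow_left₀ (abs_nonneg _) (FF_abs_le L η x (by linarith)) 2
        exact mul_le_mul_of_nonneg_right this (by positivity)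
      have h3 : 0 ≤ K * A x + K * E x := by positivity
      linarith
    have hp := pow_bound L η σ x hL hη0 hσ1 hσ2 h1 h2
    have hmain : FF L η x ^ 2 * (x ^ 2)⁻¹ ≤ A x + E x := by
      rcases le_or_gt x x0 with h3 | h3
      · have hM0x : (1 + 2 * η) * x ≤ 1 / η := by
          calc (1 + 2 * η) * x ≤ 2 * x0 := by gcongr; linarith
            _ = 1 / η := by rw [hx0]; field_simp
        have e : FF L η x ^ 2 * (x ^ 2)⁻¹ = A x := by
          have hx2 : FF L η x = FP L η M0 x := by
            rw [FF_eq_FP L η x hη hx' (M0 + 1) (hM0x.trans (Nat.lt_floor_add_one _).le |>.trans (by push_cast; exact le_rfl))]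
            unfold FP
            rw [Finset.sum_Icc_succ_top (by omega)]
            have : gg η ((M0 + 1 : ℕ) / x) = 0 := by
              by_contra hg
              have h4 := (gg_div_mem hη.le hg).2.2
              have h5 := Nat.lt_floor_add_one (1 / η)
              push_cast at h4
              linarith
            rw [this]; ring
          rw [hx2, FP_sq_small L η x hη hx' h3, hA, Finset.sum_mul]
          refine Finset.sum_congr rfl fun n _ => by ring
        linarith
      · have e : FF L η x ^ 2 * (x ^ 2)⁻¹ = E x := by
          rw [FF_eq_FP L η x hη hx' M (le_trans (by gcongr) hM)]
          simp only [hEd]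
          unfold om
          rw [if_pos h2, max_eq_left h3.le]
          field_simp
        linarith
    rw [esplit]
    calc FF L η x ^ 2 * (x ^ (1 - 2 * σ) * (x ^ 2)⁻¹) = x ^ (1 - 2 * σ) * (FF L η x ^ 2 * (x ^ 2)⁻¹) := by ring
      _ ≤ K * (A x + E x) := mul_le_mul hp hmain (by positivity) hK0.le
      _ ≤ _ := by linarith
  have iDom : IntegrableOn (fun x => K * A x + K * E x + P x) (Ioi 0) :=
    ((iA.const_mul K).add (iE.integrableOn.const_mul K)).add iP
  have hmeas : Measurable (fun x => HH L η x ^ 2 * x ^ (-2 * σ - 1)) :=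
    ((HH_meas L η).pow_const 2).mul (measurable_id.pow_const _)
  have hIntg : IntegrableOn (fun x => HH L η x ^ 2 * x ^ (-2 * σ - 1)) (Ioi 0) := by
    refine iDom.mono' hmeas.aestronglyMeasurable ((ae_restrict_mem measurableSet_Ioi).mono fun x hx => ?_)
    have hx' : (0:ℝ) < x := hx
    rw [Real.norm_eq_abs, abs_of_nonneg (by positivity)]
    exact hdom x hx
  refine ⟨hIntg, ?_⟩
  refine (setIntegral_mono_on hIntg iDom measurableSet_Ioi hdom).trans ?_
  have iAE : IntegrableOn (fun x => K * A x + K * E x) (Ioi 0) := (iA.const_mul K).add (iE.integrableOn.const_mul K)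
  rw [integral_add iAE iP, integral_add (iA.const_mul K) (iE.integrableOn.const_mul K),
    integral_const_mul, integral_const_mul]
  calc _ ≤ K * (8 * η * (4 * 224^2 * Real.exp 22)) + K * (2 * η * CQ) + K * (6 * η) := by gcongr
    _ = _ := by rw [hK]; unfold CD; ring

end ZD
end

section
namespace ZD

noncomputable def flr (y : ℝ) : ℂ := ((⌊y⁻¹⌋ : ℝ) : ℂ)

lemma flr_meas : Measurable flr := by
  unfold flr
  fun_prop

lemma flr_norm_le (y : ℝ) (hy : 0 < y) : ‖flr y‖ ≤ y ^ (-1:ℝ) := by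
  unfold flr
  rw [Complex.norm_real, Real.norm_eq_abs, Real.rpow_neg_one, abs_of_nonneg]
  · exact Int.floor_le _
  · exact_mod_cast Int.floor_nonneg.2 (inv_nonneg.2 hy.le)

lemma flr_zero (y : ℝ) (hy : 1 < y) : flr y = 0 := by
  unfold flr
  have : ⌊y⁻¹⌋ = 0 := by
    rw [Int.floor_eq_zero_iff]
    exact ⟨by positivity, inv_lt_one_of_one_lt₀ hy⟩
  simp [this]

lemma flr_conv (s : ℂ) (hs : 1 < s.re) : MellinConvergent flr s := by
  refine mellinConvergent_of_isBigO_rpow (a := s.re + 1) (b := 1) ?_ ?_ (by linarith) ?_ hs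
  · have h1 : LocallyIntegrableOn (fun y : ℝ => y ^ (-1:ℝ)) (Ioi 0) :=
      ContinuousOn.locallyIntegrableOn (fun y hy => (Real.continuousAt_rpow_const _ _
        (Or.inl (ne_of_gt hy))).continuousWithinAt) measurableSet_Ioi
    have h2 : LocallyIntegrableOn (fun y : ℝ => if 0 < y then flr y else 0) (Ioi 0) := by
      refine h1.mono (Measurable.aestronglyMeasurable ?_) (Eventually.of_forall fun y => ?_)
      · exact Measurable.ite measurableSet_Ioi flr_meas measurable_const
      · split_ifs with h
        · rw [Real.norm_of_nonneg (by positivity)]; exact flr_norm_le y h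
        · simp
    intro x hx
    obtain ⟨u, hu, hi⟩ := h2 x hx
    refine ⟨u ∩ Ioi 0, inter_mem hu self_mem_nhdsWithin, ?_⟩
    have : IntegrableOn (fun y : ℝ => if 0 < y then flr y else 0) (u ∩ Ioi 0) := hi.mono_set inter_subset_left
    have hn := this.1
    refine Integrable.congr this ?_
    have : ∀ᵐ y ∂(volume.restrict (u ∩ Ioi 0)), y ∈ Ioi (0:ℝ) :=
      ae_mono (Measure.restrict_mono inter_subset_right le_rfl) (ae_restrict_mem measurableSet_Ioi)
    filter_upwards [this] with y hy
    simp [Set.mem_Ioi.1 hy]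
  · refine Asymptotics.IsBigO.of_bound 0 ?_
    filter_upwards [eventually_gt_atTop 1] with y hy
    simp [flr_zero y hy]
  · refine Asymptotics.IsBigO.of_bound 1 ?_
    filter_upwards [self_mem_nhdsWithin] with y hy
    have hy : 0 < y := hy
    rw [one_mul, Real.norm_of_nonneg (by positivity)]; exact flr_norm_le y hy

lemma flr_mellin (s : ℂ) (hs : 1 < s.re) : mellin flr s = riemannZeta s / s := by
  have hs0 : s ≠ 0 := by rintro rfl; simp at hs; linarith
  have h1 := LSeries_eq_mul_integral_of_nonneg (fun _ => 1) (r := 1) zero_le_one hs (by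
    refine Asymptotics.IsBigO.of_bound 1 ?_
    filter_upwards with n
    simp) (fun _ => zero_le_one)
  have h2 : LSeries (fun n => ((1:ℝ):ℂ)) s = riemannZeta s := by
    rw [← LSeries_one_eq_riemannZeta hs]
    congr 1
  rw [h2] at h1
  rw [eq_div_iff hs0, h1, mul_comm]
  congr 1
  have h3 : mellin flr s = mellin (fun t : ℝ => ((⌊t⌋:ℝ):ℂ)) (-s) := by
    rw [← mellin_comp_inv]; rfl
  rw [h3, mellin]
  have e1 : (Ioi (1:ℝ)) ⊆ Ioi 0 := Ioi_subset_Ioi zero_le_one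
  rw [← integral_indicator measurableSet_Ioi, ← integral_indicator measurableSet_Ioi]
  apply integral_congr_ae
  have : ∀ᵐ t : ℝ, t ≠ 1 := by simp [ae_iff]
  filter_upwards [this] with t ht
  by_cases h : 1 < t
  · rw [indicator_of_mem (show t ∈ Ioi 0 by simp; linarith), indicator_of_mem (by simpa using h)]
    simp only [smul_eq_mul, ofReal_one, Finset.sum_const, Nat.card_Icc, nsmul_eq_mul, mul_one]
    rw [mul_comm]
    congr 1
    · rw [← natCast_floor_eq_intCast_floor (by linarith)]; simp
    · congr 1; ring
  · rw [indicator_of_notMem (show t ∉ Ioi 1 by simpa using h)]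
    by_cases h0 : 0 < t
    · rw [indicator_of_mem (by simpa using h0)]
      have : ⌊t⌋ = 0 := by
        rw [Int.floor_eq_zero_iff]
        exact ⟨h0.le, lt_of_le_of_ne (not_lt.1 h) ht⟩
      simp [this]
    · rw [indicator_of_notMem (by simpa using h0)]

lemma mel_bdd (f : ℝ → ℂ) (hf : Measurable f) (K B : ℝ) (hK : ∀ y, ‖f y‖ ≤ K) (hB : ∀ y, B < y → f y = 0)
    (s : ℂ) (hs : 0 < s.re) : MellinConvergent f s ∧ DifferentiableAt ℂ (mellin f) s := by
  have h1 : LocallyIntegrableOn f (Ioi 0) := by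
    apply LocallyIntegrable.locallyIntegrableOn
    refine (locallyIntegrable_const K).mono hf.aestronglyMeasurable (Eventually.of_forall fun y => ?_)
    exact (hK y).trans (le_abs_self K)
  have h2 : f =O[atTop] (fun t : ℝ => t ^ (-(s.re + 1))) := by
    refine Asymptotics.IsBigO.of_bound 0 ?_
    filter_upwards [eventually_gt_atTop B] with y hy
    simp [hB y hy]
  have h3 : f =O[nhdsWithin 0 (Ioi 0)] (fun t : ℝ => t ^ (-(0:ℝ))) := by
    refine Asymptotics.IsBigO.of_bound K ?_
    filter_upwards with y
    simpa using hK y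
  exact ⟨mellinConvergent_of_isBigO_rpow h1 h2 (by linarith) h3 hs,
    mellin_differentiableAt_of_isBigO_rpow h1 h2 (by linarith) h3 hs⟩

noncomputable def Gs (η : ℝ) (s : ℂ) : ℂ :=
  (((1 + 2 * η : ℝ) : ℂ) ^ s - 2 * ((1 + η : ℝ) : ℂ) ^ s + 1) / s

noncomputable def ZZ (η y : ℝ) : ℂ := ((Sfl η y⁻¹ : ℝ) : ℂ)

lemma ZZ_meas (η : ℝ) : Measurable (ZZ η) := by
  unfold ZZ
  exact Complex.measurable_ofReal.comp ((Sfl_meas η).comp measurable_inv)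

lemma ZZ_norm (η y : ℝ) : ‖ZZ η y‖ ≤ 1 := by
  unfold ZZ
  rw [Complex.norm_real]
  exact Sfl_abs_le η _

lemma ZZ_zero (η y : ℝ) (hη : 0 < η) (hy : 1 + 2 * η < y) : ZZ η y = 0 := by
  unfold ZZ Sfl
  have hy0 : 0 < y := by linarith
  have e : ∀ c, 0 ≤ c → c < y → ⌊c * y⁻¹⌋ = 0 := by
    intro c hc hcy
    rw [Int.floor_eq_zero_iff]
    refine ⟨by positivity, ?_⟩
    rw [← div_eq_mul_inv, div_lt_one hy0]; exact hcy
  have e1 := e (1 + 2 * η) (by linarith) hy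
  have e2 := e (1 + η) (by linarith) (by linarith)
  have e3 := e 1 (by linarith) (by linarith)
  rw [one_mul] at e3
  simp [e1, e2, e3]

lemma scale_mellin (f : ℝ → ℂ) (c : ℝ) (hc : 0 < c) (s : ℂ) (hf : MellinConvergent f s) :
    HasMellin (fun y => f (c⁻¹ * y)) s ((c:ℂ) ^ s * mellin f s) := by
  refine ⟨(MellinConvergent.comp_mul_left (inv_pos.2 hc)).2 hf, ?_⟩
  rw [mellin_comp_mul_left _ _ (inv_pos.2 hc), smul_eq_mul]
  congr 1
  rw [ofReal_inv, inv_cpow, cpow_neg, inv_inv]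
  rw [arg_ofReal_of_nonneg hc.le]
  exact Real.pi_pos.ne

lemma comb_mellin (f : ℝ → ℂ) (η : ℝ) (hη : 0 < η) (s : ℂ) (hf : MellinConvergent f s) :
    HasMellin (fun y => f ((1 + 2 * η)⁻¹ * y) - (2:ℂ) • f ((1 + η)⁻¹ * y) + f y) s
      ((((1 + 2 * η : ℝ) : ℂ) ^ s - 2 * ((1 + η : ℝ) : ℂ) ^ s + 1) * mellin f s) := by
  have a1 := scale_mellin f (1 + 2 * η) (by linarith) s hf
  have a2 := scale_mellin f (1 + η) (by linarith) s hf
  have a3 := hasMellin_const_smul a2.1 (2:ℂ)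
  have a4 := hasMellin_sub a1.1 a3.1
  have a5 := hasMellin_add a4.1 hf
  refine ⟨a5.1, ?_⟩
  rw [a5.2, a4.2, a3.2, a2.2, a1.2, smul_eq_mul]
  ring

lemma ZZ_mellin_big (η : ℝ) (hη : 0 < η) (s : ℂ) (hs : 1 < s.re) :
    mellin (ZZ η) s = riemannZeta s * Gs η s := by
  have := (comb_mellin flr η hη s (flr_conv s hs)).2
  rw [flr_mellin s hs] at this
  unfold Gs
  rw [mul_div_assoc', mul_comm (riemannZeta s), mul_div_assoc, ← this]
  congr 1
  ext y
  unfold ZZ Sfl flr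
  simp only [mul_inv, inv_inv]
  push_cast
  simp

lemma Gs_diff (η : ℝ) (hη : 0 < η) (s : ℂ) (hs : s ≠ 0) : DifferentiableAt ℂ (Gs η) s := by
  unfold Gs
  have h1 : ((1 + 2 * η : ℝ) : ℂ) ≠ 0 := by exact_mod_cast (by linarith : (1 + 2 * η : ℝ) ≠ 0)
  have h2 : ((1 + η : ℝ) : ℂ) ≠ 0 := by exact_mod_cast (by linarith : (1 + η : ℝ) ≠ 0)
  refine DifferentiableAt.div ?_ differentiableAt_id hs
  refine ((differentiableAt_id.const_cpow (Or.inl h1)).sub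
    ((differentiableAt_id.const_cpow (Or.inl h2)).const_mul _)).add_const _

lemma ZZ_mellin (η : ℝ) (hη : 0 < η) (s : ℂ) (hs : 0 < s.re) (hs1 : s.im ≠ 0) :
    mellin (ZZ η) s = riemannZeta s * Gs η s := by
  obtain ⟨e, he⟩ : ∃ e : ℝ, 0 < e * s.im := ⟨s.im, mul_self_pos.2 hs1⟩
  have he0 : e ≠ 0 := by rintro rfl; simp at he
  set U : Set ℂ := {z | 0 < z.re} ∩ {z | 0 < e * z.im} with hU
  have hUo : IsOpen U := by
    apply IsOpen.inter
    · exact isOpen_lt continuous_const continuous_re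
    · exact isOpen_lt continuous_const (continuous_const.mul continuous_im)
  have hUc : Convex ℝ U := by
    apply Convex.inter
    · exact convex_halfSpace_re_gt 0
    · intro x hx y hy a b ha hb hab
      have hx : 0 < e * x.im := hx
      have hy : 0 < e * y.im := hy
      change 0 < e * (a • x + b • y).im
      simp only [add_im, smul_im, smul_eq_mul]
      have : a = 1 - b := by linarith
      rcases eq_or_lt_of_le ha with h | h
      · have : b = 1 := by linarith
        rw [← h, this]; linarith
      · nlinarith [mul_pos h hx, mul_nonneg hb hy.le]
  have hUim : ∀ z ∈ U, z ≠ 0 ∧ z ≠ 1 := by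
    rintro z ⟨h1, h2⟩
    have h2 : 0 < e * z.im := h2
    constructor <;> rintro rfl <;> simp at h2
  have hd1 : DifferentiableOn ℂ (mellin (ZZ η)) U := fun z hz =>
    (mel_bdd (ZZ η) (ZZ_meas η) 1 (1 + 2 * η) (ZZ_norm η) (fun y hy => ZZ_zero η y hη hy) z hz.1).2.differentiableWithinAt
  have hd2 : DifferentiableOn ℂ (fun z => riemannZeta z * Gs η z) U := fun z hz =>
    ((differentiableAt_riemannZeta (hUim z hz).2).mul (Gs_diff η hη z (hUim z hz).1)).differentiableWithinAt
  have hz0 : (⟨2, e⟩ : ℂ) ∈ U := ⟨by simp, by simpa using mul_self_pos.2 he0⟩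
  refine AnalyticOnNhd.eqOn_of_preconnected_of_eventuallyEq (hd1.analyticOnNhd hUo) (hd2.analyticOnNhd hUo)
    hUc.isPreconnected hz0 ?_ (show s ∈ U from ⟨hs, he⟩)
  have : {z : ℂ | 1 < z.re} ∈ nhds (⟨2, e⟩ : ℂ) :=
    (isOpen_lt continuous_const continuous_re).mem_nhds (by simp)
  filter_upwards [this] with z hz
  exact ZZ_mellin_big η hη z hz

lemma gg_mellin (η : ℝ) (hη : 0 < η) (s : ℂ) (hs : 0 < s.re) :
    HasMellin (fun y => ((gg η y : ℝ) : ℂ)) s (Gs η s) := by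
  have h0 := hasMellin_one_Ioc hs
  have h1 := comb_mellin _ η hη s h0.1
  rw [h0.2] at h1
  have key : EqOn (fun y : ℝ => (y:ℂ) ^ (s - 1) • (indicator (Ioc 0 1) (fun _ => 1 : ℝ → ℂ) ((1 + 2 * η)⁻¹ * y) -
      (2:ℂ) • indicator (Ioc 0 1) (fun _ => 1 : ℝ → ℂ) ((1 + η)⁻¹ * y) + indicator (Ioc 0 1) (fun _ => 1 : ℝ → ℂ) y))
      (fun y : ℝ => (y:ℂ) ^ (s - 1) • ((gg η y : ℝ) : ℂ)) (Ioi 0) := by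
    intro y hy
    have hy : 0 < y := hy
    dsimp only
    congr 1
    unfold gg
    have e : ∀ c : ℝ, 0 < c → indicator (Ioc 0 1) (fun _ => 1 : ℝ → ℂ) (c⁻¹ * y) = ((if y ≤ c then (1:ℝ) else 0 : ℝ) : ℂ) := by
      intro c hc
      rw [indicator_apply]
      have : (c⁻¹ * y ∈ Ioc (0:ℝ) 1) ↔ y ≤ c := by
        rw [mem_Ioc]
        constructor
        · rintro ⟨_, h⟩
          rwa [inv_mul_le_iff₀ hc, mul_one] at h
        · intro h
          exact ⟨by positivity, by rwa [inv_mul_le_iff₀ hc, mul_one]⟩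
      simp only [this]
      split_ifs <;> simp
    have e1 := e 1 one_pos
    rw [inv_one, one_mul] at e1
    rw [e _ (by linarith), e _ (by linarith), e1]
    push_cast
    rfl
  refine ⟨(integrableOn_congr_fun key measurableSet_Ioi).1 h1.1, ?_⟩
  have h2 := h1.2
  rw [mellin] at h2 ⊢
  rw [setIntegral_congr_fun measurableSet_Ioi key] at h2
  rw [h2, Gs, mul_one_div]

noncomputable def MM (L : ℝ) (s : ℂ) : ℂ := ∑ h ∈ Finset.Icc 1 (NN L), (lam L h : ℂ) * (h:ℂ) ^ (-s)

lemma HH_mellin (L η : ℝ) (hη : 0 < η) (s : ℂ) (hs : 0 < s.re) (hs1 : s.im ≠ 0) :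
    HasMellin (fun y => ((HH L η y⁻¹ : ℝ) : ℂ)) s ((riemannZeta s * MM L s - 1) * Gs η s) := by
  have hZ := (mel_bdd (ZZ η) (ZZ_meas η) 1 (1 + 2 * η) (ZZ_norm η) (fun y hy => ZZ_zero η y hη hy) s hs).1
  have hF : ∀ S : Finset ℕ, S ⊆ Finset.Icc 1 (NN L) →
      HasMellin (fun y => ∑ h ∈ S, (lam L h : ℂ) • ZZ η (h * y)) s
      (∑ h ∈ S, (lam L h : ℂ) * (h:ℂ) ^ (-s) * mellin (ZZ η) s) := by
    intro S
    induction S using Finset.induction_on with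
    | empty => intro _; simp [HasMellin, MellinConvergent, mellin]
    | insert a S ha ih =>
      intro hS
      have ih := ih ((Finset.subset_insert _ _).trans hS)
      have ha1 : 1 ≤ a := (Finset.mem_Icc.1 (hS (Finset.mem_insert_self _ _))).1
      have ha0 : (0:ℝ) < a := by exact_mod_cast ha1
      have c1 : MellinConvergent (fun y => ZZ η (a * y)) s := (MellinConvergent.comp_mul_left ha0).2 hZ
      have c2 := hasMellin_const_smul c1 (lam L a : ℂ)
      have c3 := hasMellin_add c2.1 ih.1
      simp only [Finset.sum_insert ha]
      refine ⟨c3.1, ?_⟩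
      rw [c3.2, c2.2, ih.2, mellin_comp_mul_left _ _ ha0]
      simp only [smul_eq_mul, ofReal_natCast]
      ring
  have h1 := hF _ (Finset.Subset.refl _)
  have h2 := gg_mellin η hη s hs
  have h3 := hasMellin_sub h1.1 h2.1
  rw [h1.2, h2.2, ZZ_mellin η hη s hs hs1, ← Finset.sum_mul] at h3
  convert h3 using 1
  · ext y
    unfold HH FF ZZ
    simp only [mul_inv, smul_eq_mul, div_eq_mul_inv, one_mul, inv_inv]
    push_cast
    congr 1
    refine Finset.sum_congr rfl fun h _ => ?_
    rw [mul_comm (y⁻¹)]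
  · unfold MM; ring

end ZD
end

section
namespace ZD

open scoped FourierTransform SchwartzMap ContDiff

lemma L2_norm_sq (F : Lp (α := ℝ) ℂ 2) : ‖F‖ ^ 2 = ∫ x, ‖F x‖ ^ 2 := by
  have h1 := MeasureTheory.L2.inner_def (𝕜 := ℂ) F F
  rw [inner_self_eq_norm_sq_to_K] at h1
  simp only [inner_self_eq_norm_sq_to_K] at h1
  have h2 : (∫ x, ((‖F x‖:ℂ)) ^ 2) = ((∫ x, ‖F x‖ ^ 2 : ℝ) : ℂ) := by
    rw [← integral_complex_ofReal]
    congr 1; ext x; push_cast; rfl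
  have h3 : ((‖F‖ ^ 2 : ℝ) : ℂ) = ((∫ x, ‖F x‖ ^ 2 : ℝ) : ℂ) := by
    rw [← h2]; push_cast; exact h1
  exact_mod_cast h3

lemma L2_integrable_sq (F : Lp (α := ℝ) ℂ 2) : Integrable (fun x => ‖F x‖ ^ 2) :=
  (memLp_two_iff_integrable_sq_norm (Lp.memLp F).1).1 (Lp.memLp F)

lemma plancherel (g : ℝ → ℂ) (h1 : Integrable g) (h2 : Integrable (fun x => ‖g x‖ ^ 2)) :
    Integrable (fun x => ‖𝓕 g x‖ ^ 2) ∧ ∫ x, ‖𝓕 g x‖ ^ 2 = ∫ x, ‖g x‖ ^ 2 := by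
  have hm : MemLp g 2 := (memLp_two_iff_integrable_sq_norm h1.1).2 h2
  set F : Lp (α := ℝ) ℂ 2 := hm.toLp g with hF
  obtain ⟨Fh, hFh⟩ : ∃ Fh : Lp (α := ℝ) ℂ 2, Fh = 𝓕 F := ⟨_, rfl⟩
  have hFg : F =ᵐ[volume] g := hm.coeFn_toLp
  have hc : Continuous (𝓕 g) :=
    VectorFourier.fourierIntegral_continuous Real.continuous_fourierChar
      (by simpa using! continuous_inner) h1
  have key : ∀ᵐ x, (𝓕 g) x = Fh x := by
    apply ae_eq_of_integral_contDiff_smul_eq hc.locallyIntegrable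
      ((Lp.memLp Fh).locallyIntegrable (by norm_num))
    intro φ hφ hφc
    have hg₁ : HasCompactSupport (Complex.ofRealCLM ∘ φ) := hφc.comp_left rfl
    have hg₂ : ContDiff ℝ ∞ (Complex.ofRealCLM ∘ φ) := by fun_prop
    set ψ : 𝓢(ℝ, ℂ) := hg₁.toSchwartzMap hg₂ with hψ
    have e0 : ∀ x, ψ x = (φ x : ℂ) := fun x => rfl
    have e1 := congrArg (fun D => D ψ) (Lp.fourier_toTemperedDistribution_eq F)
    rw [← hFh] at e1
    simp only [TemperedDistribution.fourier_apply, Lp.toTemperedDistribution_apply] at e1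
    have e2 : ∫ x, φ x • Fh x = ∫ x, ψ x • Fh x := by
      congr 1
    rw [e2, ← e1]
    have e3 : ∫ x, (𝓕 ψ) x • F x = ∫ x, (𝓕 (ψ : ℝ → ℂ)) x • g x := by
      apply integral_congr_ae
      filter_upwards [hFg] with x hx
      rw [hx, SchwartzMap.fourier_coe]
    rw [e3]
    have e4 : ∫ x, φ x • 𝓕 g x = ∫ x, ψ x • 𝓕 g x := by
      congr 1
    rw [e4]
    have := VectorFourier.integral_fourierIntegral_smul_eq_flip (L := innerₗ ℝ) (f := ψ) (g := g)
      Real.continuous_fourierChar (by simpa using! continuous_inner) (ψ.integrable (μ := volume)) h1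
    simpa using! this.symm
  have k2 : (fun x => ‖𝓕 g x‖ ^ 2) =ᵐ[volume] fun x => ‖Fh x‖ ^ 2 := by
    filter_upwards [key] with x hx
    rw [hx]
  refine ⟨(L2_integrable_sq _).congr k2.symm, ?_⟩
  rw [integral_congr_ae k2, ← L2_norm_sq, hFh, Lp.norm_fourier_eq, L2_norm_sq]
  apply integral_congr_ae
  filter_upwards [hFg] with x hx
  rw [hx]


lemma neg_exp_image : (fun u : ℝ => Real.exp (-u)) '' univ = Ioi 0 := by
  rw [image_univ]
  ext x
  simp only [mem_range, mem_Ioi]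
  constructor
  · rintro ⟨y, rfl⟩; exact Real.exp_pos _
  · intro h; exact ⟨-Real.log x, by rw [neg_neg, Real.exp_log h]⟩

lemma neg_exp_deriv (x : ℝ) (_ : x ∈ univ) :
    HasDerivWithinAt (fun u : ℝ => Real.exp (-u)) (-Real.exp (-x)) univ x := by
  have := ((hasDerivAt_id x).fun_neg.exp).hasDerivWithinAt (s := univ)
  simpa using this

lemma neg_exp_inj : InjOn (fun u : ℝ => Real.exp (-u)) univ := by
  intro a _ b _ h
  have := Real.exp_injective h
  linarith

lemma mellin_plancherel (f : ℝ → ℂ) (hfm : Measurable f) (σ : ℝ) (hc : MellinConvergent f σ)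
    (h2 : IntegrableOn (fun y => ‖f y‖ ^ 2 * y ^ (2 * σ - 1)) (Ioi 0)) :
    Integrable (fun t : ℝ => ‖mellin f (σ + t * I)‖ ^ 2) ∧
    ∫ t : ℝ, ‖mellin f (σ + t * I)‖ ^ 2 = 2 * π * ∫ y in Ioi 0, ‖f y‖ ^ 2 * y ^ (2 * σ - 1) := by
  set g : ℝ → ℂ := fun u => Real.exp (-σ * u) • f (Real.exp (-u)) with hg
  have hgm : Measurable g := by
    rw [hg]; refine Measurable.fun_smul ?_ ?_
    · fun_prop
    · exact hfm.comp (by fun_prop)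
  have i1 : Integrable g := by
    unfold MellinConvergent at hc
    rw [← neg_exp_image, integrableOn_image_iff_integrableOn_abs_deriv_smul MeasurableSet.univ
      neg_exp_deriv neg_exp_inj, integrableOn_univ] at hc
    refine hc.mono hgm.aestronglyMeasurable (Eventually.of_forall fun u => le_of_eq ?_)
    simp only [hg, norm_smul, abs_neg, Real.norm_eq_abs, Real.abs_exp]
    rw [Complex.norm_cpow_eq_rpow_re_of_pos (Real.exp_pos _), ← mul_assoc]
    congr 1
    simp only [sub_re, ofReal_re, one_re]
    rw [← Real.exp_mul, ← Real.exp_add]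
    congr 1; ring
  have e2 : ∀ u, |(-Real.exp (-u))| • (‖f (Real.exp (-u))‖ ^ 2 * (Real.exp (-u)) ^ (2 * σ - 1)) = ‖g u‖ ^ 2 := by
    intro u
    simp only [hg, norm_smul, abs_neg, Real.norm_eq_abs, Real.abs_exp, smul_eq_mul]
    rw [← Real.exp_mul, mul_pow, mul_comm (‖f (Real.exp (-u))‖ ^ 2), ← mul_assoc, ← Real.exp_add,
      sq (Real.exp (-σ * u)), ← Real.exp_add]
    congr 2; ring
  have i2 : Integrable (fun u => ‖g u‖ ^ 2) := by
    rw [← neg_exp_image, integrableOn_image_iff_integrableOn_abs_deriv_smul MeasurableSet.univ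
      neg_exp_deriv neg_exp_inj, integrableOn_univ] at h2
    exact h2.congr (Eventually.of_forall e2)
  have i3 : ∫ y in Ioi 0, ‖f y‖ ^ 2 * y ^ (2 * σ - 1) = ∫ u, ‖g u‖ ^ 2 := by
    rw [← neg_exp_image, integral_image_eq_integral_abs_deriv_smul MeasurableSet.univ
      neg_exp_deriv neg_exp_inj, setIntegral_univ]
    exact integral_congr_ae (Eventually.of_forall e2)
  obtain ⟨p1, p2⟩ := plancherel g i1 i2
  have e3 : ∀ t : ℝ, ‖mellin f (σ + t * I)‖ ^ 2 = (fun x => ‖𝓕 g x‖ ^ 2) (t / (2 * π)) := by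
    intro t
    rw [mellin_eq_fourier]
    simp [hg]
  have hpi : (0:ℝ) < 2 * π := by positivity
  simp only [e3]
  refine ⟨p1.comp_div hpi.ne', ?_⟩
  rw [i3, ← p2, Measure.integral_comp_div (fun x => ‖𝓕 g x‖ ^ 2) (2 * π), abs_of_pos hpi, smul_eq_mul]

lemma HH_plancherel (L η σ : ℝ) (hL : 8 ≤ L) (h1 : Real.exp (-L) / 100 ≤ η) (h2 : η ≤ Real.exp (-L) / 20)
    (h3 : 1 / 2 - 1 / L ≤ σ) (h4 : σ ≤ 8) :
    Integrable (fun t : ℝ => ‖(riemannZeta (σ + t * I) * MM L (σ + t * I) - 1) * Gs η (σ + t * I)‖ ^ 2) ∧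
    ∫ t : ℝ, ‖(riemannZeta (σ + t * I) * MM L (σ + t * I) - 1) * Gs η (σ + t * I)‖ ^ 2 ≤
      2 * π * (CD * η * XX L ^ (1 - 2 * σ)) := by
  have hη : 0 < η := lt_of_lt_of_le (by positivity) h1
  have hσ : 0 < σ := by
    have : 1 / L ≤ 1 / 8 := one_div_le_one_div_of_le (by norm_num) hL
    linarith
  obtain ⟨d1, d2⟩ := partD L η σ hL h1 h2 h3 h4
  set f : ℝ → ℂ := fun y => ((HH L η y⁻¹ : ℝ) : ℂ) with hf
  have hfm : Measurable f := Complex.measurable_ofReal.comp ((HH_meas L η).comp measurable_inv)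
  have hcv : MellinConvergent f σ := by
    have := (HH_mellin L η hη (σ + I) (by simpa using hσ) (by simp)).1
    unfold MellinConvergent at this ⊢
    rw [mellin_convergent_iff_norm Subset.rfl measurableSet_Ioi hfm.aestronglyMeasurable] at this ⊢
    simpa using this
  have inv_e : ∀ y ∈ Ioi (0:ℝ), |(-1 : ℝ)| * y ^ ((-1:ℝ) - 1) * (HH L η (y ^ (-1:ℝ)) ^ 2 * (y ^ (-1:ℝ)) ^ (-2 * σ - 1))
      = ‖f y‖ ^ 2 * y ^ (2 * σ - 1) := by
    intro y hy
    have hy : 0 < y := hy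
    simp only [hf, Complex.norm_real, Real.norm_eq_abs, sq_abs, abs_neg, abs_one, one_mul]
    rw [← Real.rpow_mul hy.le, Real.rpow_neg_one, mul_comm, mul_assoc, ← Real.rpow_add hy]
    congr 2; ring
  have i2 : IntegrableOn (fun y => ‖f y‖ ^ 2 * y ^ (2 * σ - 1)) (Ioi 0) := by
    have := (integrableOn_Ioi_comp_rpow_iff (fun x => HH L η x ^ 2 * x ^ (-2 * σ - 1)) (p := -1) (by norm_num)).2 d1
    refine (integrableOn_congr_fun (fun y hy => ?_) measurableSet_Ioi).1 this
    rw [← inv_e y hy]; simp [smul_eq_mul]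
  have i3 : ∫ y in Ioi 0, ‖f y‖ ^ 2 * y ^ (2 * σ - 1) = ∫ x in Ioi 0, HH L η x ^ 2 * x ^ (-2 * σ - 1) := by
    rw [← integral_comp_rpow_Ioi (fun x => HH L η x ^ 2 * x ^ (-2 * σ - 1)) (p := -1) (by norm_num)]
    refine setIntegral_congr_fun measurableSet_Ioi fun y hy => ?_
    rw [← inv_e y hy]; simp [smul_eq_mul]
  obtain ⟨p1, p2⟩ := mellin_plancherel f hfm σ hcv i2
  have ae : (fun t : ℝ => ‖mellin f (σ + t * I)‖ ^ 2) =ᵐ[volume]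
      fun t : ℝ => ‖(riemannZeta (σ + t * I) * MM L (σ + t * I) - 1) * Gs η (σ + t * I)‖ ^ 2 := by
    have : ∀ᵐ t : ℝ, t ≠ 0 := by simp [ae_iff]
    filter_upwards [this] with t ht
    rw [(HH_mellin L η hη (σ + t * I) (by simpa using hσ) (by simpa using ht)).2]
  refine ⟨p1.congr ae, ?_⟩
  rw [← integral_congr_ae ae, p2, i3]
  gcongr

end ZD
end

section
namespace ZD

set_option maxHeartbeats 1000000 in
lemma Gs_lower (T η : ℝ) (hT : 2800 ≤ T) (hη : η = 1 / (20 * T)) (σ t : ℝ) (hσ : 0 ≤ σ) (hσ2 : σ ≤ 8)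
    (ht : T / 2 ≤ |t|) (ht2 : |t| ≤ 3 * T) : 1 / (100000 * T) ≤ ‖Gs η (σ + t * I)‖ := by
  have hT0 : 0 < T := by linarith
  have hη0 : 0 < η := by rw [hη]; positivity
  have hTη : T * η = 1 / 20 := by rw [hη]; field_simp
  have hη1 : η ≤ 1 / 56000 := by
    rw [hη]; apply one_div_le_one_div_of_le <;> linarith
  set s : ℂ := σ + t * I with hs
  have hsre : s.re = σ := by simp [hs]
  have hsim : s.im = t := by simp [hs]
  have hsn : ‖s‖ ≤ 4 * T := by
    have h1 := Complex.norm_le_abs_re_add_abs_im s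
    rw [hsre, hsim, abs_of_nonneg hσ] at h1
    linarith
  have hs0 : s ≠ 0 := by
    intro h
    rw [h] at hsim
    simp at hsim
    rw [← hsim] at ht
    simp at ht; linarith
  set l1 := Real.log (1 + η) with hl1
  set l2 := Real.log (1 + 2 * η) with hl2
  have b1 : l1 ≤ η := by
    have := Real.log_le_sub_one_of_pos (show (0:ℝ) < 1 + η by linarith)
    linarith
  have b2 : 0.9 * η ≤ l1 := by
    have := Real.one_sub_inv_le_log_of_pos (show (0:ℝ) < 1 + η by linarith)
    have h3 : 1 - (1 + η)⁻¹ = η / (1 + η) := by field_simp; ring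
    rw [h3] at this
    refine le_trans ?_ this
    rw [le_div_iff₀ (by linarith)]
    nlinarith
  have c1 : ((1 + η : ℝ) : ℂ) ^ s = Complex.exp (l1 * s) := by
    rw [cpow_def_of_ne_zero (by exact_mod_cast (by linarith : (1 + η : ℝ) ≠ 0)), ← Complex.ofReal_log (by linarith)]
  have c2 : ((1 + 2 * η : ℝ) : ℂ) ^ s = Complex.exp (l2 * s) := by
    rw [cpow_def_of_ne_zero (by exact_mod_cast (by linarith : (1 + 2 * η : ℝ) ≠ 0)), ← Complex.ofReal_log (by linarith)]
  set d := l2 - 2 * l1 with hd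
  have d1 : |d| ≤ 2 * η ^ 2 := by
    have e : d = Real.log ((1 + 2 * η) / (1 + η) ^ 2) := by
      rw [Real.log_div (by linarith) (by positivity), Real.log_pow]; push_cast; rfl
    have hpos : 0 < (1 + 2 * η) / (1 + η) ^ 2 := by positivity
    have u := Real.log_le_sub_one_of_pos hpos
    have v := Real.one_sub_inv_le_log_of_pos hpos
    rw [← e] at u v
    have u2 : (1 + 2 * η) / (1 + η) ^ 2 ≤ 1 := by
      rw [div_le_one (by positivity)]; nlinarith
    have v2 : 1 - ((1 + 2 * η) / (1 + η) ^ 2)⁻¹ = - (η ^ 2 / (1 + 2 * η)) := by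
      field_simp; ring
    have v3 : η ^ 2 / (1 + 2 * η) ≤ η ^ 2 := div_le_self (by positivity) (by linarith)
    rw [abs_le]
    constructor <;> nlinarith
  set w := Complex.exp (l1 * s) with hw
  have e1 : Complex.exp (l2 * s) = w ^ 2 * Complex.exp (d * s) := by
    rw [hw, ← Complex.exp_nat_mul, ← Complex.exp_add]
    congr 1
    rw [hd]; push_cast; ring
  have wre : (l1 * s : ℂ).re = l1 * σ := by rw [re_ofReal_mul, hsre]
  have wim : (l1 * s : ℂ).im = l1 * t := by rw [im_ofReal_mul, hsim]
  have hl10 : 0 ≤ l1 := by nlinarith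
  have nw : ‖w‖ ^ 2 ≤ 2 := by
    rw [hw, Complex.norm_exp, wre, ← Real.exp_nat_mul]
    have : ((2:ℕ):ℝ) * (l1 * σ) ≤ Real.log 2 := by
      have := Real.log_two_gt_d9
      push_cast
      nlinarith
    calc _ ≤ Real.exp (Real.log 2) := Real.exp_le_exp.2 this
      _ = 2 := Real.exp_log (by norm_num)
  have w1 : 1 / 100 ≤ ‖w - 1‖ := by
    have h1 := Complex.abs_im_le_norm (w - 1)
    refine le_trans ?_ h1
    rw [sub_im, one_im, sub_zero, hw, Complex.exp_im, wre, wim, abs_mul, Real.abs_exp]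
    have h2 : 1 ≤ Real.exp (l1 * σ) := Real.one_le_exp (by positivity)
    have h3 : |Real.sin (l1 * t)| = Real.sin (l1 * |t|) := by
      have hpos : 0 ≤ Real.sin (l1 * |t|) := by
        apply Real.sin_nonneg_of_nonneg_of_le_pi
        · positivity
        · have := Real.pi_gt_three
          nlinarith [abs_nonneg t]
      rcases abs_cases t with ⟨h, _⟩ | ⟨h, _⟩
      · rw [h] at hpos ⊢; exact abs_of_nonneg hpos
      · rw [h] at hpos ⊢
        rw [mul_neg, Real.sin_neg] at hpos ⊢
        exact abs_of_nonpos (by linarith)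
    rw [h3]
    have h4 : 0.0225 ≤ l1 * |t| := by nlinarith [abs_nonneg t]
    have h5 : l1 * |t| ≤ 0.15 := by nlinarith [abs_nonneg t]
    have h6 := Real.sin_gt_sub_cube (x := l1 * |t|) (by linarith)
    set x := l1 * |t|
    have h7 : 1 / 100 ≤ Real.sin x := by
      have : x ^ 3 ≤ x * 0.15 ^ 2 := by
        have : x ^ 3 = x * x ^ 2 := by ring
        rw [this]; gcongr
      linarith
    calc (1:ℝ) / 100 ≤ Real.sin x := h7
      _ = 1 * Real.sin x := (one_mul _).symm
      _ ≤ _ := by gcongr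
  have n1 : ‖Complex.exp (d * s) - 1‖ ≤ 2 * (8 * T * η ^ 2) := by
    have hn : ‖(d * s : ℂ)‖ ≤ 8 * T * η ^ 2 := by
      rw [norm_mul, Complex.norm_real, Real.norm_eq_abs]
      calc _ ≤ (2 * η ^ 2) * (4 * T) := by gcongr
        _ = _ := by ring
    refine (Complex.norm_exp_sub_one_le ?_).trans (by linarith)
    refine hn.trans ?_
    nlinarith
  have num : ((1 + 2 * η : ℝ) : ℂ) ^ s - 2 * ((1 + η : ℝ) : ℂ) ^ s + 1 =
      (w - 1) ^ 2 + w ^ 2 * (Complex.exp (d * s) - 1) := by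
    rw [c1, c2, e1]; ring
  have fin : 1 / 25000 ≤ ‖((1 + 2 * η : ℝ) : ℂ) ^ s - 2 * ((1 + η : ℝ) : ℂ) ^ s + 1‖ := by
    rw [num]
    have h1 := norm_sub_le_norm_add ((w - 1) ^ 2) (w ^ 2 * (Complex.exp (d * s) - 1))
    have h2 : (1/100) ^ 2 ≤ ‖(w - 1) ^ 2‖ := by rw [norm_pow]; gcongr
    have h3 : ‖w ^ 2 * (Complex.exp (d * s) - 1)‖ ≤ 2 * (2 * (8 * T * η ^ 2)) := by
      rw [norm_mul, norm_pow]; gcongr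
    have h4 : T * η ^ 2 ≤ 1 / 20 * (1 / 56000) := by nlinarith
    linarith
  unfold Gs
  rw [norm_div]
  have hsp : 0 < ‖s‖ := norm_pos_iff.2 hs0
  calc 1 / (100000 * T) = (1 / 25000) / (4 * T) := by field_simp; norm_num
    _ ≤ _ := by gcongr

noncomputable def ff (L : ℝ) (s : ℂ) : ℂ := 1 - riemannZeta s * MM L s

lemma MM_diff (L : ℝ) : Differentiable ℂ (MM L) := by
  unfold MM
  refine Differentiable.fun_sum fun h hh => ?_
  have h1 : (h:ℂ) ≠ 0 := by
    have := (Finset.mem_Icc.1 hh).1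
    exact_mod_cast (by omega : h ≠ 0)
  refine Differentiable.const_mul ?_ _
  exact fun z => differentiableAt_id.neg.const_cpow (Or.inl h1)

lemma ff_diff (L : ℝ) (s : ℂ) (hs : s ≠ 1) : DifferentiableAt ℂ (ff L) s := by
  unfold ff
  exact ((differentiableAt_riemannZeta hs).mul (MM_diff L s)).const_sub 1

noncomputable def CJ : ℝ := 10 ^ 10 * (2 * π * CD) / 20

lemma CJ_pos : 0 < CJ := by
  have := CD_pos
  unfold CJ; positivity

lemma ff_ne_one (σ e t : ℝ) (he : e = 1 ∨ e = -1) (ht : 0 < t) : (σ + (e * t : ℝ) * I : ℂ) ≠ 1 := by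
  intro h
  have := congrArg Complex.im h
  simp at this
  rcases this with h | h
  · rcases he with h1 | h1 <;> rw [h1] at h <;> norm_num at h
  · exact ht.ne' h

lemma partJ (L σ e : ℝ) (hL : 8 ≤ L) (he : e = 1 ∨ e = -1) (h3 : 1 / 2 - 1 / L ≤ σ) (h4 : σ ≤ 8) :
    ∫ t in Icc (Real.exp L / 2) (3 * Real.exp L), ‖ff L (σ + (e * t : ℝ) * I)‖ ^ 2 ≤
      CJ * Real.exp L * XX L ^ (1 - 2 * σ) := by
  set T := Real.exp L with hT
  have hT0 : 0 < T := Real.exp_pos _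
  have hT1 : 2800 ≤ T := by
    have h1 : Real.exp 8 ≤ T := Real.exp_le_exp.2 hL
    have h2 : Real.exp 8 = Real.exp 1 ^ 8 := by rw [← Real.exp_nat_mul]; norm_num
    have h3 := Real.exp_one_gt_d9
    have h4 : (2.7182818283:ℝ) ^ 8 ≤ Real.exp 1 ^ 8 := by gcongr
    rw [h2] at h1
    refine le_trans ?_ (h4.trans h1)
    norm_num
  have hσ : 0 ≤ σ := by
    have : 1 / L ≤ 1 / 8 := one_div_le_one_div_of_le (by norm_num) hL
    linarith
  set η := 1 / (20 * T) with hη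
  have hη' : η = Real.exp (-L) / 20 := by
    rw [hη, hT, Real.exp_neg]; field_simp
  obtain ⟨p1, p2⟩ := HH_plancherel L η σ hL (by rw [hη']; linarith [Real.exp_pos (-L)]) hη'.le h3 h4
  set H : ℝ → ℝ := fun t : ℝ => ‖(riemannZeta (σ + t * I) * MM L (σ + t * I) - 1) * Gs η (σ + t * I)‖ ^ 2 with hH
  have q1 : Integrable (fun t => H (e * t)) := by
    rcases he with rfl | rfl
    · simpa using p1
    · simpa using p1.comp_neg
  have q2 : ∫ t, H (e * t) = ∫ t, H t := by
    rcases he with rfl | rfl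
    · simp
    · have := integral_neg_eq_self H volume
      simpa using this
  have hcont : ContinuousOn (fun t : ℝ => ‖ff L (σ + (e * t : ℝ) * I)‖ ^ 2) (Icc (T / 2) (3 * T)) := by
    intro t ht
    have ht0 : 0 < t := lt_of_lt_of_le (by positivity) ht.1
    have h1 := (ff_diff L _ (ff_ne_one σ e t he ht0)).continuousAt
    have h2 : ContinuousAt (fun t : ℝ => (σ + (e * t : ℝ) * I : ℂ)) t := by fun_prop
    exact ((ContinuousAt.comp (f := fun t : ℝ => (σ + (e * t : ℝ) * I : ℂ)) h1 h2).norm.pow 2).continuousWithinAt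
  have bd : ∀ t ∈ Icc (T / 2) (3 * T), ‖ff L (σ + (e * t : ℝ) * I)‖ ^ 2 ≤ (100000 * T) ^ 2 * H (e * t) := by
    intro t ht
    have ht0 : 0 < t := lt_of_lt_of_le (by positivity) ht.1
    have hab : |e * t| = t := by
      rcases he with rfl | rfl
      · rw [one_mul, abs_of_pos ht0]
      · rw [neg_one_mul, abs_neg, abs_of_pos ht0]
    have hG := Gs_lower T η hT1 hη σ (e * t) hσ h4 (by rw [hab]; exact ht.1) (by rw [hab]; exact ht.2)
    simp only [hH]
    rw [norm_mul, mul_pow]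
    unfold ff
    rw [norm_sub_rev]
    set A := ‖riemannZeta (σ + (e * t : ℝ) * I) * MM L (σ + (e * t : ℝ) * I) - 1‖ ^ 2 with hA
    set g := ‖Gs η (σ + (e * t : ℝ) * I)‖ with hg
    have : 1 ≤ 100000 * T * g := by
      rw [div_le_iff₀ (by positivity)] at hG
      linarith
    have h1 : 1 ≤ (100000 * T * g) ^ 2 := one_le_pow₀ this
    have hA0 : 0 ≤ A := by positivity
    nlinarith
  calc _ ≤ ∫ t in Icc (T / 2) (3 * T), (100000 * T) ^ 2 * H (e * t) :=
        setIntegral_mono_on (hcont.integrableOn_Icc) ((q1.const_mul _).integrableOn) measurableSet_Icc bd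
    _ ≤ ∫ t, (100000 * T) ^ 2 * H (e * t) := by
        refine setIntegral_le_integral (q1.const_mul _) (Eventually.of_forall fun t => ?_)
        simp only [hH]; positivity
    _ = (100000 * T) ^ 2 * ∫ t, H t := by rw [integral_const_mul, q2]
    _ ≤ (100000 * T) ^ 2 * (2 * π * (CD * η * XX L ^ (1 - 2 * σ))) := by gcongr
    _ = _ := by
        rw [hη]; unfold CJ; field_simp; ring

end ZD
end

section
namespace ZD

lemma jensen_ineq (Φ : ℂ → ℂ) (c : ℂ) (R : ℝ) (hR : 0 < R)
    (hΦ : AnalyticOnNhd ℂ Φ (Metric.closedBall c R)) (hc : Φ c ≠ 0)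
    (S : Finset ℂ) (hS : ∀ ρ ∈ S, ρ ∈ Metric.closedBall c R) (m : ℂ → ℕ)
    (hm : ∀ ρ ∈ S, (m ρ : ℕ∞) ≤ analyticOrderAt Φ ρ) :
    ∑ ρ ∈ S, (m ρ : ℝ) * Real.log (R / ‖c - ρ‖) ≤
      circleAverage (fun z => Real.log ‖Φ z‖) c R - Real.log ‖Φ c‖ := by
  have hcb : c ∈ Metric.closedBall c R := Metric.mem_closedBall_self hR.le
  have hΦ' : AnalyticOnNhd ℂ Φ (Metric.closedBall c |R|) := by rwa [abs_of_pos hR]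
  have key := AnalyticOnNhd.circleAverage_log_norm hR.ne' hΦ' hc
  have hab : |R| = R := abs_of_pos hR
  rw [hab] at key
  set D := MeromorphicOn.divisor Φ (Metric.closedBall c R) with hD
  have hfin : D.support.Finite := D.finiteSupport (isCompact_closedBall c R)
  have hconn : IsPreconnected (Metric.closedBall c R) := (convex_closedBall c R).isPreconnected
  have htop : ∀ z ∈ Metric.closedBall c R, analyticOrderAt Φ z ≠ ⊤ := by
    intro z hz
    refine hΦ.analyticOrderAt_ne_top_of_isPreconnected hconn hcb hz ?_
    have := (hΦ c hcb).analyticOrderAt_eq_zero.mpr hc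
    rw [this]; exact ENat.zero_ne_top
  have hDapp : ∀ z ∈ Metric.closedBall c R, (D z : ℤ) = ((analyticOrderAt Φ z).toNat : ℤ) := by
    intro z hz
    rw [hD, MeromorphicOn.AnalyticOnNhd.divisor_apply hΦ hz]
    obtain ⟨n, hn⟩ := ENat.ne_top_iff_exists.mp (htop z hz)
    rw [← hn]
    simp
  have hDnn : ∀ z, 0 ≤ D z := by
    intro z
    by_cases hz : z ∈ Metric.closedBall c R
    · rw [hDapp z hz]; positivity
    · have : D z = 0 := Function.locallyFinsuppWithin.apply_eq_zero_of_notMem D hz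
      rw [this]
  have hlog : ∀ z ∈ Metric.closedBall c R, 0 ≤ Real.log (R / ‖c - z‖) := by
    intro z hz
    by_cases h0 : ‖c - z‖ = 0
    · rw [h0]; simp
    · apply Real.log_nonneg
      rw [le_div_iff₀ (lt_of_le_of_ne (norm_nonneg _) (Ne.symm h0)), one_mul]
      rwa [Metric.mem_closedBall, dist_comm, dist_eq_norm] at hz
  have hsum : ∑ ρ ∈ S, (m ρ : ℝ) * Real.log (R / ‖c - ρ‖) ≤ ∑ᶠ u, (D u : ℝ) * Real.log (R * ‖c - u‖⁻¹) := by
    rw [finsum_eq_sum_of_support_subset (s := S ∪ hfin.toFinset)]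
    · calc ∑ ρ ∈ S, (m ρ : ℝ) * Real.log (R / ‖c - ρ‖) ≤ ∑ ρ ∈ S, (D ρ : ℝ) * Real.log (R * ‖c - ρ‖⁻¹) := by
            apply Finset.sum_le_sum
            intro ρ hρ
            rw [div_eq_mul_inv]
            apply mul_le_mul_of_nonneg_right
            · have h1 := hDapp ρ (hS ρ hρ)
              rw [h1]
              have h2 := hm ρ hρ
              obtain ⟨n, hn⟩ := ENat.ne_top_iff_exists.mp (htop ρ (hS ρ hρ))
              rw [← hn] at h2 ⊢
              simpa using h2
            · rw [← div_eq_mul_inv]; exact hlog ρ (hS ρ hρ)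
        _ ≤ _ := by
            apply Finset.sum_le_sum_of_subset_of_nonneg Finset.subset_union_left
            intro i _ _
            by_cases hz : i ∈ Metric.closedBall c R
            · apply mul_nonneg
              · exact_mod_cast hDnn i
              · rw [← div_eq_mul_inv]; exact hlog i hz
            · have : D i = 0 := Function.locallyFinsuppWithin.apply_eq_zero_of_notMem D hz
              rw [this]; simp
    · intro u hu
      simp only [Function.mem_support] at hu
      simp only [Finset.coe_union, Set.mem_union]
      right
      simp only [Set.Finite.coe_toFinset, Function.mem_support]
      intro h; apply hu; rw [h]; simp
  linarith

end ZD
end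

section
namespace ZD

lemma dir4 (a : ℕ → ℂ) (ha0 : a 0 = 0) (ha1 : a 1 = 1) (ha : ∀ n, 1 ≤ n → ‖a n‖ ≤ 1) (s : ℂ) (hs : s.re = 4) :
    ‖∑' n : ℕ, a n * (n:ℂ) ^ (-s) - 1‖ ≤ 0.09 := by
  have h4 := hasSum_zeta_four
  have hb : ∀ n : ℕ, ‖a n * (n:ℂ) ^ (-s)‖ ≤ 1 / (n:ℝ) ^ 4 := by
    intro n
    rcases Nat.eq_zero_or_pos n with h | h
    · subst h; simp [ha0]
    · rw [norm_mul, Complex.norm_natCast_cpow_of_pos h, Complex.neg_re, hs, Real.rpow_neg (by positivity)]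
      have : (n:ℝ) ^ (4:ℝ) = (n:ℝ) ^ 4 := by exact_mod_cast Real.rpow_natCast (n:ℝ) 4
      rw [this, one_div]
      have := ha n h
      have h2 : 0 ≤ ((n:ℝ) ^ 4)⁻¹ := by positivity
      nlinarith
  have hsum : Summable (fun n : ℕ => a n * (n:ℂ) ^ (-s)) := Summable.of_norm_bounded h4.summable hb
  have h1 := hasSum_ite_sub_hasSum hsum.hasSum 1
  have h2 := hasSum_ite_sub_hasSum h4 1
  simp only [ha1, Nat.cast_one, one_pow, Complex.one_cpow, mul_one, div_one] at h1 h2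
  have h3 : ‖∑' n : ℕ, a n * (n:ℂ) ^ (-s) - 1‖ ≤ π ^ 4 / 90 - 1 := by
    rw [← h1.tsum_eq, ← h2.tsum_eq]
    apply tsum_of_norm_bounded h2.summable.hasSum
    intro n
    by_cases hn : n = 1
    · simp [hn]
    · simp only [hn, if_false]; exact hb n
  have hpi : π < 3.15 := Real.pi_lt_d2
  have hpi4 : π ^ 4 ≤ 3.15 ^ 4 := by gcongr
  have hpi5 : π < 3.1416 := Real.pi_lt_d4
  have hpi6 : π ^ 4 ≤ 3.1416 ^ 4 := by gcongr
  norm_num at hpi6 ⊢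
  linarith

lemma zeta4 (s : ℂ) (hs : s.re = 4) : ‖riemannZeta s - 1‖ ≤ 0.09 := by
  have := dir4 (fun n => if n = 0 then 0 else 1) (by simp) (by simp) (by intro n hn; simp [Nat.one_le_iff_ne_zero.mp hn]) s hs
  rw [zeta_eq_tsum_one_div_nat_cpow (by rw [hs]; norm_num)]
  convert this using 4
  ext n
  rcases Nat.eq_zero_or_pos n with h | h
  · subst h
    have : s ≠ 0 := by rintro rfl; simp at hs
    simp [Complex.zero_cpow this]
  · simp [h.ne', Complex.cpow_neg]

lemma NN_pos (L : ℝ) : 1 ≤ NN L := by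
  unfold NN
  exact Nat.one_le_iff_ne_zero.mpr (Nat.ceil_pos.mpr (by unfold xi; positivity)).ne'

lemma MM4 (L : ℝ) (hL : 8 ≤ L) (s : ℂ) (hs : s.re = 4) : ‖MM L s - 1‖ ≤ 0.09 := by
  have h := dir4 (fun n => if n ∈ Finset.Icc 1 (NN L) then (lam L n : ℂ) else 0) (by simp) (by
      simp [NN_pos]
      rw [lam_of_le L (by linarith) 1 le_rfl (by unfold XX; simpa using (by linarith : 0 ≤ L / 8)), mu_one]) (by
      intro n hn
      by_cases h : n ∈ Finset.Icc 1 (NN L)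
      · simp only [h, if_true]
        rw [Complex.norm_real, Real.norm_eq_abs]; exact abs_lam_le L (by linarith) n hn
      · simp only [h, if_false]; simp) s hs
  rw [tsum_eq_sum (s := Finset.Icc 1 (NN L)) (by intro n hn; simp [hn])] at h
  unfold MM
  convert h using 3
  apply Finset.sum_congr rfl
  intro n hn
  simp [hn]

lemma ff4 (L : ℝ) (hL : 8 ≤ L) (s : ℂ) (hs : s.re = 4) : ‖ff L s‖ ≤ 0.2 := by
  have h1 := zeta4 s hs
  have h2 := MM4 L hL s hs
  have e : ff L s = -((riemannZeta s - 1) + (MM L s - 1) + (riemannZeta s - 1) * (MM L s - 1)) := by unfold ff; ring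
  rw [e, norm_neg]
  refine (norm_add₃_le).trans ?_
  rw [norm_mul]
  have : ‖riemannZeta s - 1‖ * ‖MM L s - 1‖ ≤ 0.09 * 0.09 := by gcongr
  norm_num at *
  linarith

lemma jensen_ff (L : ℝ) (hL : 8 ≤ L) (c : ℂ) (hc : c.re = 4) (R : ℝ) (hR : 0 < R) (h1 : (1:ℂ) ∉ Metric.closedBall c R)
    (S : Finset ℂ) (hS : ∀ ρ ∈ S, ρ ∈ Metric.closedBall c R) :
    ∑ ρ ∈ S, ((analyticOrderAt riemannZeta ρ).toNat : ℝ) * Real.log (R / ‖c - ρ‖) ≤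
      circleAverage (fun z => ‖ff L z‖ ^ 2) c R + 2 * ‖ff L c‖ ^ 2 := by
  set Φ : ℂ → ℂ := riemannZeta * (fun z => MM L z * (2 - riemannZeta z * MM L z)) with hΦd
  have hΦe : ∀ z, Φ z = 1 - ff L z ^ 2 := by
    intro z; simp only [hΦd, Pi.mul_apply, ff]; ring
  have hz : ∀ z ∈ Metric.closedBall c R, AnalyticAt ℂ riemannZeta z := by
    intro z hz
    have hz1 : z ≠ 1 := by rintro rfl; exact h1 hz
    exact DifferentiableOn.analyticAt (s := {1}ᶜ) (fun w hw => (differentiableAt_riemannZeta hw).differentiableWithinAt)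
      (isOpen_compl_singleton.mem_nhds hz1)
  have hg : ∀ z ∈ Metric.closedBall c R, AnalyticAt ℂ (fun z => MM L z * (2 - riemannZeta z * MM L z)) z := by
    intro z hz'
    have hM : AnalyticAt ℂ (MM L) z := (MM_diff L).analyticAt z
    exact hM.fun_mul (analyticAt_const.fun_sub ((hz z hz').fun_mul hM))
  have hΦ : AnalyticOnNhd ℂ Φ (Metric.closedBall c R) := fun z h => (hz z h).mul (hg z h)
  have hfc := ff4 L hL c hc
  have hn2 : ‖ff L c‖ ^ 2 ≤ 0.04 := by
    have : ‖ff L c‖ ^ 2 ≤ 0.2 ^ 2 := by gcongr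
    norm_num at *; linarith
  have hlow : 1 - ‖ff L c‖ ^ 2 ≤ ‖Φ c‖ := by
    rw [hΦe]
    have := norm_sub_norm_le (1:ℂ) (ff L c ^ 2)
    rw [norm_one, norm_pow] at this
    exact this
  have hpos : 0 < ‖Φ c‖ := by norm_num at hn2; linarith
  have hΦc : Φ c ≠ 0 := norm_pos_iff.mp hpos
  have hj := jensen_ineq Φ c R hR hΦ hΦc S hS (fun ρ => (analyticOrderAt riemannZeta ρ).toNat) (by
    intro ρ hρ
    rw [hΦd, analyticOrderAt_mul (hz ρ (hS ρ hρ)) (hg ρ (hS ρ hρ))]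
    exact (ENat.natCast_toNat_le_self _).trans (le_self_add))
  have hlogc : -Real.log ‖Φ c‖ ≤ 2 * ‖ff L c‖ ^ 2 := by
    rw [← Real.log_inv]
    refine (Real.log_le_sub_one_of_pos (by positivity)).trans ?_
    have : ‖Φ c‖⁻¹ ≤ 1 + 2 * ‖ff L c‖ ^ 2 := by
      rw [inv_le_comm₀ hpos (by positivity), inv_le_iff_one_le_mul₀ (by positivity)]
      norm_num at hn2
      nlinarith [sq_nonneg ‖ff L c‖]
    linarith
  have hav : circleAverage (fun z => Real.log ‖Φ z‖) c R ≤ circleAverage (fun z => ‖ff L z‖ ^ 2) c R := by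
    have hsub : Metric.sphere c |R| ⊆ Metric.closedBall c R := by
      rw [abs_of_pos hR]; exact Metric.sphere_subset_closedBall
    apply circleAverage_mono
    · apply MeromorphicOn.circleIntegrable_log_norm
      intro z hz'
      exact (hΦ z (hsub hz')).meromorphicAt
    · apply ContinuousOn.circleIntegrable'
      apply ContinuousOn.pow
      apply ContinuousOn.norm
      intro z hz'
      refine (ff_diff L z ?_).continuousAt.continuousWithinAt
      rintro rfl; exact h1 (hsub hz')
    · intro z hz'
      by_cases h0 : Φ z = 0
      · simp only [h0, norm_zero, Real.log_zero]; positivity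
      · refine (Real.log_le_sub_one_of_pos (norm_pos_iff.mpr h0)).trans ?_
        rw [hΦe]
        have := norm_sub_le (1:ℂ) (ff L z ^ 2)
        rw [norm_one, norm_pow] at this
        linarith
  linarith

end ZD
end

section
namespace ZD

lemma circ_pt (L σ : ℝ) (hL : 8 ≤ L) (h2 : σ ≤ 1) (θ : ℝ) (h0 : 0 ≤ θ) (h1 : θ ≤ 2 * π) :
    XX L ^ (1 - 2 * (4 + (4 - σ + 1 / L) * Real.cos θ)) ≤
      XX L ^ (1 - 2 * σ) * (Real.exp (1 / 4) * Real.exp (-(L / 8) * (θ - π) ^ 2)) := by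
  set R := 4 - σ + 1 / L with hR
  have hL0 : 0 < L := by linarith
  have hR3 : 3 ≤ R := by
    have : 0 < 1 / L := by positivity
    rw [hR]; linarith
  unfold XX
  rw [← Real.exp_mul, ← Real.exp_mul, ← Real.exp_add, ← Real.exp_add]
  apply Real.exp_le_exp.mpr
  have hc := Real.cos_le_one_sub_mul_cos_sq (x := θ - π) (by rw [abs_le]; constructor <;> linarith)
  rw [Real.cos_sub_pi] at hc
  have hpi : π ^ 2 ≤ 12 := by
    have : π < 3.15 := Real.pi_lt_d2
    have h3 : 0 < π := Real.pi_pos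
    norm_num at this
    nlinarith
  have hk : 1 / 6 ≤ 2 / π ^ 2 := by
    rw [div_le_div_iff₀ (by norm_num) (by positivity)]; linarith
  have h3 : 1 / 6 * (θ - π) ^ 2 ≤ 1 + Real.cos θ := by
    have := mul_le_mul_of_nonneg_right hk (sq_nonneg (θ - π))
    linarith
  have h4 : (θ - π) ^ 2 ≤ 2 * R * (1 + Real.cos θ) := by
    nlinarith [sq_nonneg (θ - π)]
  have h5 : 4 + R * Real.cos θ = σ - 1 / L + R * (1 + Real.cos θ) := by rw [hR]; ring
  have h6 : L / 8 * (1 - 2 * (4 + R * Real.cos θ)) = L / 8 * (1 - 2 * σ) + 1 / 4 - L / 8 * (2 * R * (1 + Real.cos θ)) := by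
    rw [h5]; field_simp; ring
  rw [h6]
  have := mul_le_mul_of_nonneg_left h4 (by positivity : 0 ≤ L / 8)
  linarith

lemma circ_int (L σ : ℝ) (hL : 8 ≤ L) (h2 : σ ≤ 1) :
    ∫ θ in Icc 0 (2 * π), XX L ^ (1 - 2 * (4 + (4 - σ + 1 / L) * Real.cos θ)) ≤ XX L ^ (1 - 2 * σ) * (8 / √L) := by
  have hL0 : 0 < L := by linarith
  have hX := XX_pos L
  have hg : Integrable (fun θ : ℝ => Real.exp (-(L / 8) * (θ - π) ^ 2)) :=
    (integrable_exp_neg_mul_sq (by positivity : 0 < L / 8)).comp_sub_right π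
  have hG : ∫ θ : ℝ, Real.exp (-(L / 8) * (θ - π) ^ 2) = √(π / (L / 8)) := by
    rw [integral_sub_right_eq_self (fun θ : ℝ => Real.exp (-(L / 8) * θ ^ 2)) π, integral_gaussian]
  have hcont : Continuous (fun θ : ℝ => XX L ^ (1 - 2 * (4 + (4 - σ + 1 / L) * Real.cos θ))) := by
    apply Continuous.rpow continuous_const (by fun_prop)
    intro x; left; exact hX.ne'
  calc ∫ θ in Icc 0 (2 * π), XX L ^ (1 - 2 * (4 + (4 - σ + 1 / L) * Real.cos θ))
      ≤ ∫ θ in Icc 0 (2 * π), XX L ^ (1 - 2 * σ) * (Real.exp (1 / 4) * Real.exp (-(L / 8) * (θ - π) ^ 2)) := by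
        apply setIntegral_mono_on (hcont.continuousOn.integrableOn_compact isCompact_Icc)
          ((hg.const_mul _).const_mul _).integrableOn measurableSet_Icc
        intro θ hθ
        exact circ_pt L σ hL h2 θ hθ.1 hθ.2
    _ = XX L ^ (1 - 2 * σ) * (Real.exp (1 / 4) * ∫ θ in Icc 0 (2 * π), Real.exp (-(L / 8) * (θ - π) ^ 2)) := by
        rw [integral_const_mul, integral_const_mul]
    _ ≤ XX L ^ (1 - 2 * σ) * (Real.exp (1 / 4) * √(π / (L / 8))) := by
        rw [← hG]
        have := setIntegral_le_integral (s := Icc 0 (2 * π)) hg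
          (Eventually.of_forall (fun x => (Real.exp_pos _).le))
        exact mul_le_mul_of_nonneg_left (mul_le_mul_of_nonneg_left this (Real.exp_pos _).le) (by positivity)
    _ ≤ _ := by
        gcongr
        have e1 : √(π / (L / 8)) = √(8 * π) / √L := by
          rw [← Real.sqrt_div (by positivity)]; congr 1; field_simp
        have e2 : √(8 * π) ≤ 5.1 := by
          apply Real.sqrt_le_iff.mpr
          have : π < 3.15 := Real.pi_lt_d2
          constructor <;> norm_num at * <;> linarith
        have e3 : Real.exp (1 / 4) ≤ 1.5 := by
          have := Real.exp_bound_div_one_sub_of_interval (x := 1 / 4) (by norm_num) (by norm_num)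
          norm_num at *; linarith
        rw [e1, ← mul_div_assoc]
        gcongr
        calc Real.exp (1 / 4) * √(8 * π) ≤ 1.5 * 5.1 := by gcongr
          _ ≤ 8 := by norm_num

lemma exp_big (L : ℝ) (hL : 8 ≤ L) : 2800 ≤ Real.exp L := by
  have h1 : Real.exp 8 ≤ Real.exp L := Real.exp_le_exp.mpr hL
  have h2 : Real.exp 8 = Real.exp 1 ^ 8 := by rw [← Real.exp_nat_mul]; norm_num
  have h3 : (2.7182818283 : ℝ) ^ 8 ≤ Real.exp 1 ^ 8 := by
    gcongr; exact Real.exp_one_gt_d9.le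
  norm_num at h3
  linarith

lemma ffcont (L σ e : ℝ) (he : e = 1 ∨ e = -1) : ContinuousOn (fun t : ℝ => ‖ff L (σ + (e * t : ℝ) * I)‖ ^ 2) (Ioi 0) := by
  apply ContinuousOn.pow
  apply ContinuousOn.norm
  intro t ht
  have h := (ff_diff L _ (ff_ne_one σ e t he ht)).continuousAt
  have h2 : ContinuousAt (fun t : ℝ => (σ + (e * t : ℝ) * I : ℂ)) t := by fun_prop
  exact (ContinuousAt.comp (f := fun t : ℝ => (σ + (e * t : ℝ) * I : ℂ)) (g := ff L) h h2).continuousWithinAt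

lemma slice (L σ e a : ℝ) (hL : 8 ≤ L) (he : e = 1 ∨ e = -1) (h3 : 1 / 2 - 1 / L ≤ σ) (h4 : σ ≤ 8) (ha : |a| ≤ 4) :
    ∫ t in Icc (Real.exp L - 1) (2 * Real.exp L + 1), ‖ff L (σ + (e * (t + a) : ℝ) * I)‖ ^ 2 ≤
      CJ * Real.exp L * XX L ^ (1 - 2 * σ) := by
  have hT := exp_big L hL
  rw [abs_le] at ha
  refine le_trans ?_ (partJ L σ e hL he h3 h4)
  rw [integral_Icc_eq_integral_Ioc, ← intervalIntegral.integral_of_le (by linarith),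
    intervalIntegral.integral_comp_add_right (fun t => ‖ff L (σ + (e * t : ℝ) * I)‖ ^ 2),
    intervalIntegral.integral_of_le (by linarith), ← integral_Icc_eq_integral_Ioc]
  apply setIntegral_mono_set
  · apply ContinuousOn.integrableOn_compact isCompact_Icc
    apply (ffcont L σ e he).mono
    intro t ht
    have := ht.1
    simp only [Set.mem_Ioi]; linarith
  · exact Eventually.of_forall (fun x => by positivity)
  · apply LE.le.eventuallyLE
    apply Icc_subset_Icc <;> linarith

end ZD
end

section
namespace ZD

lemma circle_pt (e t R θ : ℝ) (he : e = 1 ∨ e = -1) :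
    circleMap (4 + (e * t : ℝ) * I) R θ = ((4 + R * Real.cos θ : ℝ) : ℂ) + ((e * (t + e * R * Real.sin θ) : ℝ) : ℂ) * I := by
  have h : e * (e * R * Real.sin θ) = R * Real.sin θ := by
    rcases he with h | h <;> rw [h] <;> ring
  rw [circleMap, mul_add, h, Complex.exp_mul_I]
  push_cast
  ring

lemma avg (L σ e : ℝ) (hL : 8 ≤ L) (he : e = 1 ∨ e = -1) (h1 : 1 / 2 ≤ σ) (h2 : σ ≤ 1) :
    IntegrableOn (fun t : ℝ => circleAverage (fun z => ‖ff L z‖ ^ 2) (4 + (e * t : ℝ) * I) (4 - σ + 1 / L))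
      (Icc (Real.exp L - 1) (2 * Real.exp L + 1)) ∧
    ∫ t in Icc (Real.exp L - 1) (2 * Real.exp L + 1),
      circleAverage (fun z => ‖ff L z‖ ^ 2) (4 + (e * t : ℝ) * I) (4 - σ + 1 / L) ≤
      2 * CJ * Real.exp L * XX L ^ (1 - 2 * σ) / √L := by
  have hT := exp_big L hL
  have hL0 : 0 < L := by linarith
  have hiL : 1 / L ≤ 1 / 8 := by
    apply one_div_le_one_div_of_le <;> linarith
  have hiL0 : 0 < 1 / L := by positivity
  set R := 4 - σ + 1 / L with hR
  have hX := XX_pos L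
  set F : ℝ → ℝ → ℝ := fun t θ => ‖ff L (((4 + R * Real.cos θ : ℝ) : ℂ) + ((e * (t + e * R * Real.sin θ) : ℝ) : ℂ) * I)‖ ^ 2 with hF
  have hab : ∀ θ : ℝ, |e * R * Real.sin θ| ≤ 4 := by
    intro θ
    rw [abs_mul, abs_mul]
    have : |e| = 1 := by rcases he with h | h <;> rw [h] <;> simp
    rw [this, one_mul, abs_of_pos (by linarith)]
    have := Real.abs_sin_le_one θ
    calc R * |Real.sin θ| ≤ 4 * 1 := by gcongr; linarith
      _ = 4 := by norm_num
  have havg : ∀ t : ℝ, circleAverage (fun z => ‖ff L z‖ ^ 2) (4 + (e * t : ℝ) * I) R =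
      (2 * π)⁻¹ * ∫ θ in Icc 0 (2 * π), F t θ := by
    intro t
    rw [circleAverage, intervalIntegral.integral_of_le (by positivity), ← integral_Icc_eq_integral_Ioc, smul_eq_mul]
    simp only [circle_pt e t R _ he, hF]
  have hcontF : ContinuousOn (Function.uncurry F) (Icc (Real.exp L - 1) (2 * Real.exp L + 1) ×ˢ Icc 0 (2 * π)) := by
    simp only [hF, Function.uncurry_def]
    apply ContinuousOn.pow
    apply ContinuousOn.norm
    intro p hp
    have hp1 := hp.1.1
    have hpos : 0 < p.1 + e * R * Real.sin p.2 := by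
      have := abs_le.mp (hab p.2); linarith
    have h := (ff_diff L _ (ff_ne_one (4 + R * Real.cos p.2) e _ he hpos)).continuousAt
    have h2 : ContinuousAt (fun p : ℝ × ℝ => (((4 + R * Real.cos p.2 : ℝ) : ℂ) + ((e * (p.1 + e * R * Real.sin p.2) : ℝ) : ℂ) * I)) p := by fun_prop
    exact (ContinuousAt.comp (f := fun p : ℝ × ℝ => (((4 + R * Real.cos p.2 : ℝ) : ℂ) + ((e * (p.1 + e * R * Real.sin p.2) : ℝ) : ℂ) * I)) (g := ff L) h h2).continuousWithinAt
  have hIntg : Integrable (Function.uncurry F) ((volume.restrict (Icc (Real.exp L - 1) (2 * Real.exp L + 1))).prod (volume.restrict (Icc 0 (2 * π)))) := by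
    rw [Measure.prod_restrict]
    exact hcontF.integrableOn_compact (isCompact_Icc.prod isCompact_Icc)
  simp only [havg]
  constructor
  · exact (hIntg.integral_prod_left).const_mul _
  · rw [integral_const_mul, integral_integral_swap hIntg]
    have hb : ∫ θ in Icc 0 (2 * π), ∫ t in Icc (Real.exp L - 1) (2 * Real.exp L + 1), F t θ ≤
        ∫ θ in Icc 0 (2 * π), CJ * Real.exp L * XX L ^ (1 - 2 * (4 + R * Real.cos θ)) := by
      apply setIntegral_mono_on hIntg.integral_prod_right
      · apply ContinuousOn.integrableOn_compact isCompact_Icc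
        apply Continuous.continuousOn
        apply Continuous.mul continuous_const
        apply Continuous.rpow continuous_const (by fun_prop)
        intro x; left; exact hX.ne'
      · exact measurableSet_Icc
      · intro θ hθ
        apply slice L (4 + R * Real.cos θ) e (e * R * Real.sin θ) hL he _ _ (hab θ)
        · have := Real.neg_one_le_cos θ
          have : R * (-1) ≤ R * Real.cos θ := mul_le_mul_of_nonneg_left this (by linarith)
          rw [hR] at *
          linarith
        · have := Real.cos_le_one θ
          have : R * Real.cos θ ≤ R * 1 := mul_le_mul_of_nonneg_left this (by linarith)
          rw [hR] at *
          linarith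
    rw [integral_const_mul] at hb
    have hc := circ_int L σ hL h2
    rw [← hR] at hc
    have hCJ := CJ_pos
    calc (2 * π)⁻¹ * ∫ θ in Icc 0 (2 * π), ∫ t in Icc (Real.exp L - 1) (2 * Real.exp L + 1), F t θ
        ≤ (2 * π)⁻¹ * (CJ * Real.exp L * (XX L ^ (1 - 2 * σ) * (8 / √L))) := by
          gcongr
          refine hb.trans ?_
          gcongr
      _ ≤ (4)⁻¹ * (CJ * Real.exp L * (XX L ^ (1 - 2 * σ) * (8 / √L))) := by
          gcongr
          have := Real.pi_gt_three; linarith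
      _ = _ := by ring

end ZD
end

section
namespace ZD

lemma log_low (L σ d y x : ℝ) (hL : 8 ≤ L) (h1 : 1 / 2 ≤ σ) (hx : x ≤ 4 - σ) (hx3 : 3 ≤ x)
    (hy : y ^ 2 ≤ 1 / L) (hd : d ^ 2 = x ^ 2 + y ^ 2) (hd0 : 0 ≤ d) :
    d ≤ 4 - σ + 1 / L ∧ 1 / (10 * L) ≤ Real.log ((4 - σ + 1 / L) / d) := by
  have hL0 : 0 < L := by linarith
  have hiL : 1 / L ≤ 1 / 8 := by
    apply one_div_le_one_div_of_le <;> linarith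
  have hiL0 : 0 < 1 / L := by positivity
  set u := 1 / L with hu
  set R := 4 - σ + u with hR
  have hd3 : 3 ≤ d := by nlinarith [sq_nonneg y]
  have hRR : d ^ 2 + 5 * u ≤ R ^ 2 := by
    rw [hR]; nlinarith
  have hR3 : R ≤ 3.625 := by norm_num; linarith
  have hdR : d ≤ R := by nlinarith
  refine ⟨hdR, ?_⟩
  have hR0 : 0 < R := by linarith
  have hlog := Real.one_sub_inv_le_log_of_pos (x := R / d) (by positivity)
  refine le_trans ?_ hlog
  rw [inv_div]
  have e : 1 - d / R = (R - d) / R := by field_simp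
  have e2 : 1 / (10 * L) = u / 10 := by rw [hu]; field_simp
  rw [e, e2, le_div_iff₀ hR0]
  norm_num at hR3
  have h5 : 5 * u ≤ (R - d) * (R + d) := by nlinarith
  have h6 : (R - d) * (R + d) ≤ (R - d) * 8 := by
    apply mul_le_mul_of_nonneg_left <;> linarith
  nlinarith

noncomputable def zm (ρ : ℂ) : ℕ := (analyticOrderAt riemannZeta ρ).toNat

lemma zero_block (L σ e : ℝ) (hL : 8 ≤ L) (he : e = 1 ∨ e = -1) (h1 : 1 / 2 ≤ σ) (h2 : σ ≤ 1)
    (S : Finset ℂ) (hS : ∀ ρ ∈ S, σ ≤ ρ.re ∧ ρ.re ≤ 1 ∧ Real.exp L ≤ e * ρ.im ∧ e * ρ.im ≤ 2 * Real.exp L) :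
    ∑ ρ ∈ S, (zm ρ : ℝ) ≤ 30 * CJ * L * (Real.exp L * XX L ^ (1 - 2 * σ)) := by
  have hT := exp_big L hL
  have hL0 : 0 < L := by linarith
  have hiL : 1 / L ≤ 1 / 8 := by
    apply one_div_le_one_div_of_le <;> linarith
  have hiL0 : 0 < 1 / L := by positivity
  have hCJ := CJ_pos
  have hX := XX_pos L
  obtain ⟨hAi, hA⟩ := avg L σ e hL he h1 h2
  set J := Icc (Real.exp L - 1) (2 * Real.exp L + 1) with hJ
  set R := 4 - σ + 1 / L with hR
  set δ := 1 / √L with hδ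
  have hsL : 1 ≤ √L := by rw [Real.one_le_sqrt]; linarith
  have hδ0 : 0 < δ := by positivity
  have hδ1 : δ ≤ 1 := by rw [hδ, div_le_one (by positivity)]; exact hsL
  have hδ2 : δ ^ 2 = 1 / L := by rw [hδ, div_pow, Real.sq_sqrt hL0.le]; norm_num
  have hee : e * e = 1 := by rcases he with h | h <;> rw [h] <;> norm_num
  -- central point integral
  have hB := slice L 4 e 0 hL he (by linarith) (by norm_num) (by simp)
  simp only [add_zero] at hB
  have hBi : IntegrableOn (fun t : ℝ => ‖ff L (4 + (e * t : ℝ) * I)‖ ^ 2) J := by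
    apply ContinuousOn.integrableOn_compact isCompact_Icc
    have := ffcont L 4 e he
    push_cast at this
    push_cast
    apply this.mono
    intro t ht
    have := ht.1
    simp only [Set.mem_Ioi]; linarith
  have hB' : ∫ t in J, ‖ff L (4 + (e * t : ℝ) * I)‖ ^ 2 ≤ CJ * Real.exp L * XX L ^ (1 - 2 * (4:ℝ)) := by
    exact_mod_cast hB
  -- pointwise inequality
  have hpt : ∀ t ∈ J, ∑ ρ ∈ S, (Icc (e * ρ.im - δ) (e * ρ.im + δ)).indicator (fun _ => (zm ρ : ℝ) * (1 / (10 * L))) t ≤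
      circleAverage (fun z => ‖ff L z‖ ^ 2) (4 + (e * t : ℝ) * I) R + 2 * ‖ff L (4 + (e * t : ℝ) * I)‖ ^ 2 := by
    intro t ht
    have htJ := ht.1
    have hgeo : ∀ ρ ∈ S, t ∈ Icc (e * ρ.im - δ) (e * ρ.im + δ) →
        ‖(4 + (e * t : ℝ) * I : ℂ) - ρ‖ ≤ R ∧ 1 / (10 * L) ≤ Real.log (R / ‖(4 + (e * t : ℝ) * I : ℂ) - ρ‖) := by
      intro ρ hρ hmem
      obtain ⟨a1, a2, a3, a4⟩ := hS ρ hρ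
      apply log_low L σ _ (e * t - ρ.im) (4 - ρ.re) hL h1 (by linarith) (by linarith)
      · have : (e * t - ρ.im) ^ 2 = (t - e * ρ.im) ^ 2 := by
          have : e * t - ρ.im = e * (t - e * ρ.im) := by
            rw [mul_sub, ← mul_assoc, hee, one_mul]
          rw [this, mul_pow, pow_two e, hee, one_mul]
        rw [this, ← hδ2]
        apply sq_le_sq'
        · linarith [hmem.1]
        · linarith [hmem.2]
      · rw [← Complex.normSq_eq_norm_sq, Complex.normSq_apply]
        simp
        ring
      · positivity
    have hnot : (1:ℂ) ∉ Metric.closedBall (4 + (e * t : ℝ) * I : ℂ) R := by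
      intro hmem
      rw [Metric.mem_closedBall, dist_eq_norm] at hmem
      have h3 := Complex.abs_im_le_norm ((1:ℂ) - (4 + (e * t : ℝ) * I : ℂ))
      simp at h3
      have : |e| = 1 := by rcases he with h | h <;> rw [h] <;> simp
      rw [this, one_mul] at h3
      have h4 := le_abs_self t
      simp at hmem
      linarith
    have hj := jensen_ff L hL (4 + (e * t : ℝ) * I) (by simp) R (by linarith) hnot
      (S.filter (fun ρ => t ∈ Icc (e * ρ.im - δ) (e * ρ.im + δ))) (by
        intro ρ hρ
        rw [Finset.mem_filter] at hρ
        rw [Metric.mem_closedBall, dist_comm, dist_eq_norm]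
        exact (hgeo ρ hρ.1 hρ.2).1)
    refine le_trans ?_ hj
    rw [Finset.sum_filter]
    apply Finset.sum_le_sum
    intro ρ hρ
    by_cases hmem : t ∈ Icc (e * ρ.im - δ) (e * ρ.im + δ)
    · rw [Set.indicator_of_mem hmem, if_pos hmem]
      exact mul_le_mul_of_nonneg_left (hgeo ρ hρ hmem).2 (by positivity)
    · rw [Set.indicator_of_notMem hmem, if_neg hmem]
  -- integrate
  have hind : ∀ ρ ∈ S, IntegrableOn ((Icc (e * ρ.im - δ) (e * ρ.im + δ)).indicator (fun _ => (zm ρ : ℝ) * (1 / (10 * L)))) J := by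
    intro ρ hρ
    apply Integrable.indicator _ measurableSet_Icc
    apply integrable_const_iff.mpr
    right
    rw [hJ]
    exact ⟨by simp⟩
  have hmono := setIntegral_mono_on (integrable_finsetSum S hind) (hAi.add (hBi.const_mul 2)) measurableSet_Icc hpt
  rw [integral_finsetSum S hind] at hmono
  have hLHS : ∀ ρ ∈ S, ∫ t in J, (Icc (e * ρ.im - δ) (e * ρ.im + δ)).indicator (fun _ => (zm ρ : ℝ) * (1 / (10 * L))) t =
      (zm ρ : ℝ) * (δ / (5 * L)) := by
    intro ρ hρ
    obtain ⟨a1, a2, a3, a4⟩ := hS ρ hρ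
    rw [setIntegral_indicator measurableSet_Icc]
    have : J ∩ Icc (e * ρ.im - δ) (e * ρ.im + δ) = Icc (e * ρ.im - δ) (e * ρ.im + δ) := by
      apply inter_eq_right.mpr
      apply Icc_subset_Icc <;> linarith
    rw [this, setIntegral_const, Measure.real, Real.volume_Icc, ENNReal.toReal_ofReal (by linarith), smul_eq_mul]
    field_simp
    ring
  rw [Finset.sum_congr rfl hLHS, ← Finset.sum_mul] at hmono
  have hRHS : ∫ t in J, (circleAverage (fun z => ‖ff L z‖ ^ 2) (4 + (e * t : ℝ) * I) R + 2 * ‖ff L (4 + (e * t : ℝ) * I)‖ ^ 2) ≤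
      4 * CJ * Real.exp L * XX L ^ (1 - 2 * σ) / √L := by
    have hsplit := integral_add hAi (hBi.const_mul 2)
    rw [hsplit, integral_const_mul]
    have hpow : XX L ^ (1 - 2 * (4:ℝ)) ≤ XX L ^ (1 - 2 * σ) / √L := by
      have h7 : XX L ^ (1 - 2 * (4:ℝ)) = XX L ^ (1 - 2 * σ) * XX L ^ (2 * σ - 8) := by
        rw [← Real.rpow_add hX]; ring_nf
      rw [h7, div_eq_mul_inv]
      gcongr
      have : XX L ^ (2 * σ - 8) = Real.exp (L / 8 * (2 * σ - 8)) := by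
        unfold XX; rw [← Real.exp_mul]
      rw [this]
      have h8 : Real.exp (L / 8 * (2 * σ - 8)) ≤ Real.exp (-(L / 2)) := by
        apply Real.exp_le_exp.mpr; nlinarith
      refine h8.trans ?_
      rw [Real.exp_neg]
      apply inv_anti₀ (by positivity)
      rw [Real.sqrt_le_iff]
      refine ⟨(Real.exp_pos _).le, ?_⟩
      rw [← Real.exp_nat_mul]
      have := Real.add_one_le_exp L
      norm_num
      rw [mul_div_cancel₀ _ (by norm_num : (2:ℝ) ≠ 0)]
      linarith
    have h9 : 2 * ∫ t in J, ‖ff L (4 + (e * t : ℝ) * I)‖ ^ 2 ≤ 2 * (CJ * Real.exp L * (XX L ^ (1 - 2 * σ) / √L)) := by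
      gcongr
      refine hB'.trans ?_
      gcongr
    calc _ ≤ 2 * CJ * Real.exp L * XX L ^ (1 - 2 * σ) / √L + 2 * (CJ * Real.exp L * (XX L ^ (1 - 2 * σ) / √L)) := add_le_add hA h9
      _ = _ := by ring
  have hfin := hmono.trans hRHS
  have hδe : δ / (5 * L) = 1 / (5 * L * √L) := by rw [hδ]; field_simp
  rw [hδe, mul_one_div, div_le_iff₀ (by positivity)] at hfin
  refine hfin.trans ?_
  have e3 : 4 * CJ * Real.exp L * XX L ^ (1 - 2 * σ) / √L * (5 * L * √L) = 20 * CJ * L * (Real.exp L * XX L ^ (1 - 2 * σ)) := by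
    field_simp; ring
  rw [e3]
  gcongr
  norm_num

end ZD
end

section
namespace ZD

def Zst (σ T : ℝ) : Set ℂ := {ρ : ℂ | riemannZeta ρ = 0 ∧ 0 < ρ.re ∧ ρ.re < 1 ∧ |ρ.im| ≤ T ∧ σ ≤ ρ.re}

lemma Zst_fin (σ T : ℝ) : (Zst σ T).Finite := by
  have hc : IsCompact (Icc (0:ℝ) 1 ×ℂ Icc (-T) T) := isCompact_Icc.reProdIm isCompact_Icc
  refine (hc.inter_riemannZetaZeros_finite).subset ?_
  rintro ρ ⟨h0, h1, h2, h3, h4⟩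
  refine ⟨?_, ?_⟩
  · rw [Complex.mem_reProdIm]
    exact ⟨⟨h1.le, h2.le⟩, abs_le.mp h3⟩
  · exact mem_riemannZetaZeros.mpr h0

noncomputable def Nc (σ T : ℝ) : ℝ := ∑ ρ ∈ (Zst_fin σ T).toFinset, (zm ρ : ℝ)

lemma Nc_mono (σ σ' T T' : ℝ) (h : σ' ≤ σ) (h2 : T ≤ T') : Nc σ T ≤ Nc σ' T' := by
  unfold Nc
  apply Finset.sum_le_sum_of_subset_of_nonneg
  · intro ρ hρ
    rw [Set.Finite.mem_toFinset] at *
    obtain ⟨a, b, c, d, e⟩ := hρ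
    exact ⟨a, b, c, d.trans h2, h.trans e⟩
  · intros; positivity

lemma Nc_nonneg (σ T : ℝ) : 0 ≤ Nc σ T := by
  unfold Nc; positivity

lemma Nc_double (σ T : ℝ) (h1 : 1 / 2 ≤ σ) (h2 : σ ≤ 1) (hT : Real.exp 8 ≤ T) :
    Nc σ (2 * T) ≤ Nc σ T + 60 * CJ * (T ^ (1 - (σ - 1 / 2) / 4) * Real.log T) := by
  have hT0 : 0 < T := lt_of_lt_of_le (Real.exp_pos _) hT
  have hL : 8 ≤ Real.log T := by rwa [Real.le_log_iff_exp_le hT0]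
  have hTe : Real.exp (Real.log T) = T := Real.exp_log hT0
  have hpow : Real.exp (Real.log T) * XX (Real.log T) ^ (1 - 2 * σ) = T ^ (1 - (σ - 1 / 2) / 4) := by
    unfold XX
    rw [← Real.exp_mul, ← Real.exp_add, Real.rpow_def_of_pos hT0]
    congr 1; ring
  set Z := (Zst_fin σ (2 * T)).toFinset with hZ
  have hb : ∀ e : ℝ, (e = 1 ∨ e = -1) → ∑ ρ ∈ Z.filter (fun ρ => T < e * ρ.im), (zm ρ : ℝ) ≤
      30 * CJ * Real.log T * T ^ (1 - (σ - 1 / 2) / 4) := by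
    intro e he
    have := zero_block (Real.log T) σ e hL he h1 h2 (Z.filter (fun ρ => T < e * ρ.im)) (by
      intro ρ hρ
      rw [Finset.mem_filter, hZ, Set.Finite.mem_toFinset] at hρ
      obtain ⟨⟨a, b, c, d, f⟩, g⟩ := hρ
      rw [hTe]
      refine ⟨f, c.le, g.le, ?_⟩
      have := abs_le.mp d
      rcases he with h | h <;> rw [h] <;> linarith)
    rwa [hpow] at this
  have hp := hb 1 (Or.inl rfl)
  have hm := hb (-1) (Or.inr rfl)
  have hsub : Z ⊆ (Zst_fin σ T).toFinset ∪ (Z.filter (fun ρ => T < 1 * ρ.im) ∪ Z.filter (fun ρ => T < -1 * ρ.im)) := by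
    intro ρ hρ
    simp only [Finset.mem_union, Finset.mem_filter, Set.Finite.mem_toFinset, hρ, true_and]
    rw [hZ, Set.Finite.mem_toFinset] at hρ
    obtain ⟨a, b, c, d, f⟩ := hρ
    by_cases h : |ρ.im| ≤ T
    · left; exact ⟨a, b, c, h, f⟩
    · right
      rw [not_le, lt_abs] at h
      rcases h with h | h
      · left; linarith
      · right; linarith
  have hunion : ∀ A B : Finset ℂ, ∑ ρ ∈ A ∪ B, (zm ρ : ℝ) ≤ ∑ ρ ∈ A, (zm ρ : ℝ) + ∑ ρ ∈ B, (zm ρ : ℝ) := by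
    intro A B
    rw [← Finset.sum_union_inter]
    have : 0 ≤ ∑ ρ ∈ A ∩ B, (zm ρ : ℝ) := by positivity
    linarith
  have h3 : Nc σ (2 * T) ≤ _ := Finset.sum_le_sum_of_subset_of_nonneg hsub (fun i _ _ => by positivity)
  have h4 := hunion (Zst_fin σ T).toFinset (Z.filter (fun ρ => T < 1 * ρ.im) ∪ Z.filter (fun ρ => T < -1 * ρ.im))
  have h5 := hunion (Z.filter (fun ρ => T < 1 * ρ.im)) (Z.filter (fun ρ => T < -1 * ρ.im))
  have h6 : Nc σ T = ∑ ρ ∈ (Zst_fin σ T).toFinset, (zm ρ : ℝ) := rfl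
  linarith

lemma Nc_final : ∃ C : ℝ, 0 < C ∧ ∀ σ T : ℝ, 1 / 2 ≤ σ → σ ≤ 1 → 2 ≤ T →
    Nc σ T ≤ C * T ^ (1 - (σ - 1 / 2) / 4) * Real.log T := by
  set K := Nc (1 / 2) (2 * Real.exp 8) with hK
  have hK0 : 0 ≤ K := Nc_nonneg _ _
  have hCJ := CJ_pos
  refine ⟨2 * K + 180 * CJ, by positivity, ?_⟩
  have key : ∀ n : ℕ, ∀ σ T : ℝ, 1 / 2 ≤ σ → σ ≤ 1 → 2 ≤ T → T ≤ 2 ^ n * (2 * Real.exp 8) →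
      Nc σ T ≤ (2 * K + 180 * CJ) * T ^ (1 - (σ - 1 / 2) / 4) * Real.log T := by
    have base : ∀ σ T : ℝ, 1 / 2 ≤ σ → σ ≤ 1 → 2 ≤ T → T ≤ 2 * Real.exp 8 →
      Nc σ T ≤ (2 * K + 180 * CJ) * T ^ (1 - (σ - 1 / 2) / 4) * Real.log T := by
      intro σ T h1 h2 hT hT2
      have ha : 1 ≤ T ^ (1 - (σ - 1 / 2) / 4) := Real.one_le_rpow (by linarith) (by linarith)
      have hb : 1 / 2 ≤ Real.log T := by
        have := Real.log_two_gt_d9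
        have h3 := Real.log_le_log (by norm_num) hT
        norm_num at this ⊢
        linarith
      have hc : Nc σ T ≤ K := Nc_mono _ _ _ _ h1 hT2
      calc Nc σ T ≤ (2 * K) * 1 * (1 / 2) := by linarith
        _ ≤ _ := by gcongr; linarith
    intro n
    induction n with
    | zero =>
      intro σ T h1 h2 hT hT2
      apply base σ T h1 h2 hT; simpa using hT2
    | succ n ih =>
      intro σ T h1 h2 hT hT2
      rcases le_or_gt T (2 * Real.exp 8) with h | h
      · exact base σ T h1 h2 hT h
      · have he8 : 2 ≤ Real.exp 8 := by have := Real.add_one_le_exp 8; linarith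
        have h3 := ih σ (T / 2) h1 h2 (by linarith) (by rw [pow_succ] at hT2; linarith)
        have h4 := Nc_double σ (T / 2) h1 h2 (by linarith)
        rw [mul_div_cancel₀ _ (by norm_num : (2:ℝ) ≠ 0)] at h4
        set a := 1 - (σ - 1 / 2) / 4 with ha
        have hlog : Real.log (T / 2) ≤ Real.log T := Real.log_le_log (by linarith) (by linarith)
        have hlog0 : 0 ≤ Real.log T := Real.log_nonneg (by linarith)
        have hlog1 : 0 ≤ Real.log (T / 2) := Real.log_nonneg (by linarith)
        have hp : (T / 2) ^ a ≤ 3 / 4 * T ^ a := by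
          rw [div_eq_mul_inv, Real.mul_rpow (by linarith) (by norm_num), mul_comm]
          apply mul_le_mul_of_nonneg_right _ (by positivity)
          calc (2⁻¹:ℝ) ^ a ≤ (2⁻¹:ℝ) ^ (1 / 2 : ℝ) := by
                apply Real.rpow_le_rpow_of_exponent_ge (by norm_num) (by norm_num); linarith
            _ ≤ 3 / 4 := by
                rw [← Real.sqrt_eq_rpow, Real.sqrt_le_iff]; norm_num
        have hq : (T / 2) ^ a * Real.log (T / 2) ≤ 3 / 4 * T ^ a * Real.log T := by gcongr
        have hTa : 0 ≤ T ^ a * Real.log T := by positivity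
        calc Nc σ T ≤ (2 * K + 180 * CJ) * ((T / 2) ^ a * Real.log (T / 2)) + 60 * CJ * ((T / 2) ^ a * Real.log (T / 2)) := by linarith
          _ ≤ (2 * K + 180 * CJ) * (3 / 4 * T ^ a * Real.log T) + 60 * CJ * (3 / 4 * T ^ a * Real.log T) := by gcongr
          _ ≤ _ := by nlinarith [mul_nonneg hK0 hTa]
  intro σ T h1 h2 hT
  obtain ⟨n, hn⟩ := pow_unbounded_of_one_lt T (by norm_num : (1:ℝ) < 2)
  apply key n σ T h1 h2 hT
  have he8 : 1 ≤ Real.exp 8 := Real.one_le_exp (by norm_num)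
  have : (0:ℝ) < 2 ^ n := by positivity
  nlinarith

end ZD
end

/-- Lemma 2 of Ford–Zaharescu: Selberg's zero-density estimate. -/
theorem ford_zaharescu_lem2 :
    ∃ C : ℝ, 0 < C ∧ ∀ σ T : ℝ, 1 / 2 ≤ σ → σ ≤ 1 → 2 ≤ T →
      (zetaNsigma σ T : ℝ) ≤ C * T ^ (1 - (σ - 1 / 2) / 4) * Real.log T := by
  obtain ⟨C, hC, h⟩ := ZD.Nc_final
  refine ⟨C, hC, fun σ T h1 h2 h3 => le_trans ?_ (h σ T h1 h2 h3)⟩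
  have hfin := ZD.Zst_fin σ T
  have e : zetaNsigma σ T = ∑ ρ ∈ hfin.toFinset, zetaZeroMult ρ := by
    unfold zetaNsigma
    exact finsum_mem_eq_finite_toFinset_sum _ hfin
  rw [e]
  unfold ZD.Nc
  push_cast
  apply Finset.sum_le_sum
  intro ρ _
  unfold zetaZeroMult ZD.zm
  split_ifs
  · exact le_rfl
  · rw [Nat.cast_zero]; exact Nat.cast_nonneg _
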